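/- arXiv:1505.02280 — 2 statements merged into one kernel-verified Lean document; each statement's English description precedes it below -/
import Mathlib

section
/- For every ε > 0 and every positive integer m there exists δ > 0 such that the following holds: for all finite abelian groups G_1, ..., G_m, every subgroup S of G_1 × ... × G_m, every element s ∈ G_1 × ... × G_m, and all subsets X_i ⊆ G_i, if |(X_1 × ... × X_m) ∩ (s + S)| < δ|S|, then there exist subsets X_i' ⊆ X_i with |X_i'| < ε·|π_i(S)| for all i, such that ((X_1\X_1') × ... × (X_m\X_m')) ∩ (s + S) = ∅, where π_i denotes projection to the i-th coordinate. -/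
namespace HypergraphRemoval

open Finset
open scoped BigOperators

section Averages

variable {Ω A B : Type*} [Fintype Ω]

open Classical in
/-- The conditional expectation of `f` with respect to the partition into fibres of `a`. -/
noncomputable def cavg (a : Ω → A) (f : Ω → ℝ) (x : Ω) : ℝ :=
  𝔼 y with a y = a x, f y

lemma cavg_congr {a : Ω → A} (f : Ω → ℝ) {x y : Ω} (h : a x = a y) :
    cavg a f x = cavg a f y := by
  simp only [cavg]
  exact expect_congr (by ext z; simp [h]) fun _ _ => rfl

lemma cavg_nonneg (a : Ω → A) {f : Ω → ℝ} (hf : ∀ x, 0 ≤ f x) (x : Ω) : 0 ≤ cavg a f x :=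
  expect_nonneg fun y _ => hf y

lemma fiber_nonempty (a : Ω → A) (x : Ω) [DecidablePred fun y => a y = a x] :
    ({y | a y = a x} : Finset Ω).Nonempty :=
  ⟨x, by simp⟩

lemma cavg_le_one (a : Ω → A) {f : Ω → ℝ} (hf : ∀ x, f x ≤ 1) (x : Ω) : cavg a f x ≤ 1 := by
  classical
  exact expect_le (fiber_nonempty a x) fun y _ => hf y

lemma cavg_sum {S : Type*} (s : Finset S) (a : Ω → A) (f : S → Ω → ℝ) (x : Ω) :
    ∑ i ∈ s, cavg a (f i) x = cavg a (fun y => ∑ i ∈ s, f i y) x := by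
  simp only [cavg, expect_sum_comm]

lemma cavg_const (a : Ω → A) (r : ℝ) (x : Ω) : cavg a (fun _ => r) x = r := by
  classical
  exact expect_const (fiber_nonempty a x) r

lemma expect_cavg_mul (a : Ω → A) (f θ : Ω → ℝ) (hθ : ∀ x y, a x = a y → θ x = θ y) :
    𝔼 x, cavg a f x * θ x = 𝔼 x, f x * θ x := by
  classical
  rw [Fintype.expect_eq_sum_div_card, Fintype.expect_eq_sum_div_card]
  congr 1
  have h1 : ∀ x, cavg a f x * θ x =
      ∑ y, if a y = a x then f y * θ y / (#{z | a z = a y} : ℝ) else 0 := by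
    intro x
    rw [cavg, expect_eq_sum_div_card, div_mul_eq_mul_div, sum_mul, sum_div, sum_filter]
    refine sum_congr rfl fun y _ => ?_
    split_ifs with h
    · rw [hθ y x h, h]
    · rfl
  simp_rw [h1]
  rw [sum_comm]
  refine sum_congr rfl fun y _ => ?_
  rw [← sum_filter, sum_const, nsmul_eq_mul]
  have : ({x | a y = a x} : Finset Ω) = ({z | a z = a y} : Finset Ω) := by
    ext z; simp [eq_comm]
  rw [this]
  have hne : (#{z | a z = a y} : ℝ) ≠ 0 := by
    exact_mod_cast (fiber_nonempty a y).card_pos.ne'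
  field_simp

lemma expect_cavg_sub_sq (a : Ω → A) (b : Ω → B) (f : Ω → ℝ)
    (hab : ∀ x y, b x = b y → a x = a y) :
    𝔼 x, (cavg b f x - cavg a f x) ^ 2 = 𝔼 x, cavg b f x ^ 2 - 𝔼 x, cavg a f x ^ 2 := by
  have h1 := expect_cavg_mul b f (cavg a f) fun x y h => cavg_congr f (hab x y h)
  have h2 := expect_cavg_mul a f (cavg a f) fun x y h => cavg_congr f h
  have h3 : ∀ x, (cavg b f x - cavg a f x) ^ 2 =
      cavg b f x ^ 2 + cavg a f x * cavg a f x - 2 * (cavg b f x * cavg a f x) := by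
    intro x; ring
  simp_rw [h3]
  rw [expect_sub_distrib, expect_add_distrib, ← mul_expect, h1, ← h2]
  simp_rw [← pow_two]
  ring

lemma expect_sq_le (f : Ω → ℝ) : (𝔼 x, |f x|) ^ 2 ≤ 𝔼 x, f x ^ 2 := by
  rcases isEmpty_or_nonempty Ω with h | h
  · simp
  have := expect_mul_sq_le_sq_mul_sq univ (fun x => |f x|) (fun _ => (1 : ℝ))
  simpa using this

lemma abs_expect_mul_le (f g : Ω → ℝ) (hg : ∀ x, |g x| ≤ 1) :
    |𝔼 x, f x * g x| ≤ 𝔼 x, |f x| := by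
  refine (abs_expect_le _ _).trans (expect_le_expect fun x _ => ?_)
  rw [abs_mul]
  exact mul_le_of_le_one_right (abs_nonneg _) (hg x)

end Averages

lemma abs_prod_sub_prod_le {J : Type*} (s : Finset J) (f g : J → ℝ) (e : ℝ)
    (hf : ∀ j ∈ s, f j ∈ Set.Icc (0 : ℝ) 1) (hg : ∀ j ∈ s, g j ∈ Set.Icc (0 : ℝ) 1)
    (hfg : ∀ j ∈ s, |f j - g j| ≤ e) :
    |∏ j ∈ s, f j - ∏ j ∈ s, g j| ≤ #s * e := by
  classical
  induction s using Finset.induction_on with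
  | empty => simp
  | insert a s ha ih =>
    have ih' := ih (fun j hj => hf j (mem_insert_of_mem hj))
      (fun j hj => hg j (mem_insert_of_mem hj)) (fun j hj => hfg j (mem_insert_of_mem hj))
    rw [prod_insert ha, prod_insert ha, card_insert_of_notMem ha]
    have h1 : |∏ j ∈ s, f j| ≤ 1 := by
      rw [abs_of_nonneg (prod_nonneg fun j hj => (hf j (mem_insert_of_mem hj)).1)]
      exact prod_le_one (fun j hj => (hf j (mem_insert_of_mem hj)).1)
        fun j hj => (hf j (mem_insert_of_mem hj)).2
    have h2 : |g a| ≤ 1 := by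
      rw [abs_of_nonneg (hg a (mem_insert_self _ _)).1]
      exact (hg a (mem_insert_self _ _)).2
    have h3 : f a * ∏ j ∈ s, f j - g a * ∏ j ∈ s, g j =
      (f a - g a) * ∏ j ∈ s, f j + g a * (∏ j ∈ s, f j - ∏ j ∈ s, g j) := by ring
    rw [h3]
    have h4 : |(f a - g a) * ∏ j ∈ s, f j| ≤ e := by
      rw [abs_mul]
      exact (mul_le_of_le_one_right (abs_nonneg _) h1).trans (hfg a (mem_insert_self _ _))
    have h5 : |g a * (∏ j ∈ s, f j - ∏ j ∈ s, g j)| ≤ #s * e := by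
      rw [abs_mul]
      exact (mul_le_of_le_one_left (abs_nonneg _) h2).trans ih'
    refine (abs_add_le _ _).trans ?_
    push_cast
    linarith

section Regularity

variable {ι : Type} [DecidableEq ι] {V : ι → Type}

/-- The colours of the facets of the `I`-face of `x`. -/
def cell (c : Finset ι → (∀ i, V i) → ℕ) (I : Finset ι) (x : ∀ i, V i) : ι → ℕ :=
  fun j => if j ∈ I then c (I.erase j) x else 0

/-- A colouring with `M` colours of all the faces of a complete multipartite complex. -/
structure IsColoring (M : ℕ) (c : Finset ι → (∀ i, V i) → ℕ) : Prop where
  lt : ∀ J x, c J x < M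
  dependsOn : ∀ J, DependsOn (c J) (J : Set ι)

lemma cell_eq_iff {c : Finset ι → (∀ i, V i) → ℕ} {I : Finset ι} {x y : ∀ i, V i} :
    cell c I x = cell c I y ↔ ∀ j ∈ I, c (I.erase j) x = c (I.erase j) y := by
  constructor
  · intro h j hj
    simpa [cell, hj] using congrFun h j
  · intro h
    funext j
    by_cases hj : j ∈ I
    · simpa [cell, hj] using h j hj
    · simp [cell, hj]

variable [Fintype ι] [∀ i, Fintype (V i)]

/-- The conditional density of the colour `s` on `I`-faces, given the colours of the facets. -/
noncomputable def dens (F c : Finset ι → (∀ i, V i) → ℕ) (I : Finset ι) (s : ℕ)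
    (x : ∀ i, V i) : ℝ :=
  cavg (cell c I) (fun y => if F I y = s then 1 else 0) x

/-- The energy of the colouring `c` relative to the colouring `F`. -/
noncomputable def energy (r : ℕ) (F c : Finset ι → (∀ i, V i) → ℕ) : ℝ :=
  ∑ I, ∑ s ∈ range r, 𝔼 x, dens F c I s x ^ 2

/-- `F` is quasirandom relative to the finer colouring `c`. -/
def IsRegular (r : ℕ) (F c : Finset ι → (∀ i, V i) → ℕ) (τ : ℝ) : Prop :=
  ∀ (I : Finset ι), ∀ s < r, ∀ (G : Finset ι → (∀ i, V i) → ℝ) (θ : (∀ i, V i) → ℝ),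
    (∀ J x, G J x ∈ Set.Icc (0 : ℝ) 1) → (∀ J : Finset ι, DependsOn (G J) (J : Set ι)) →
    (∀ x, |θ x| ≤ 1) → (∀ x y, cell c I x = cell c I y → θ x = θ y) →
    |𝔼 x, ((if F I x = s then 1 else 0) - dens F c I s x) *
      (θ x * ∏ j ∈ I, G (I.erase j) x)| ≤ τ

/-- `c'` is a refinement of `c`. -/
def Refines (c' c : Finset ι → (∀ i, V i) → ℕ) : Prop :=
  ∀ J x y, c' J x = c' J y → c J x = c J y

omit [Fintype ι] [∀ i, Fintype (V i)] in
lemma Refines.cell {c c' : Finset ι → (∀ i, V i) → ℕ} (h : Refines c' c) {I : Finset ι}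
    {x y : ∀ i, V i} (hxy : cell c' I x = cell c' I y) : cell c I x = cell c I y := by
  rw [cell_eq_iff] at *
  exact fun j hj => h _ _ _ (hxy j hj)

omit [DecidableEq ι] [Fintype ι] [∀ i, Fintype (V i)] in
lemma Refines.trans {c c' c'' : Finset ι → (∀ i, V i) → ℕ} (h : Refines c'' c')
    (h' : Refines c' c) : Refines c'' c :=
  fun J x y hxy => h' J x y (h J x y hxy)

lemma dens_nonneg (F c : Finset ι → (∀ i, V i) → ℕ) (I : Finset ι) (s : ℕ)
    (x : ∀ i, V i) : 0 ≤ dens F c I s x :=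
  cavg_nonneg _ (fun y => by split_ifs <;> norm_num) x

lemma dens_le_one (F c : Finset ι → (∀ i, V i) → ℕ) (I : Finset ι) (s : ℕ)
    (x : ∀ i, V i) : dens F c I s x ≤ 1 :=
  cavg_le_one _ (fun y => by split_ifs <;> norm_num) x

lemma energy_le [∀ i, Nonempty (V i)] (r : ℕ) (F c : Finset ι → (∀ i, V i) → ℕ) :
    energy r F c ≤ Fintype.card (Finset ι) * r := by
  have : ∀ I : Finset ι, ∑ s ∈ range r, 𝔼 x, dens F c I s x ^ 2 ≤ r := by
    intro I
    refine (sum_le_sum (g := fun _ => (1 : ℝ)) fun s _ => ?_).trans (by simp)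
    refine expect_le univ_nonempty fun x _ => ?_
    exact pow_le_one₀ (dens_nonneg _ _ _ _ _) (dens_le_one _ _ _ _ _)
  refine (sum_le_sum fun I _ => this I).trans ?_
  simp

lemma energy_sub {r : ℕ} {F c c' : Finset ι → (∀ i, V i) → ℕ} (h : Refines c' c) :
    energy r F c' - energy r F c =
      ∑ I, ∑ s ∈ range r, 𝔼 x, (dens F c' I s x - dens F c I s x) ^ 2 := by
  simp only [energy, ← sum_sub_distrib]
  refine sum_congr rfl fun I _ => sum_congr rfl fun s _ => ?_
  exact (expect_cavg_sub_sq _ _ _ fun x y hxy => h.cell hxy).symm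

lemma expect_sq_le_energy_sub {r : ℕ} {F c c' : Finset ι → (∀ i, V i) → ℕ}
    (h : Refines c' c) (I : Finset ι) {s : ℕ} (hs : s < r) :
    𝔼 x, (dens F c' I s x - dens F c I s x) ^ 2 ≤ energy r F c' - energy r F c := by
  rw [energy_sub h]
  have h0 : ∀ I s, 0 ≤ 𝔼 x, (dens F c' I s x - dens F c I s x) ^ 2 :=
    fun I s => expect_nonneg fun x _ => sq_nonneg _
  refine le_trans ?_ (single_le_sum
    (f := fun I => ∑ s ∈ range r, 𝔼 x, (dens F c' I s x - dens F c I s x) ^ 2)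
    (fun I _ => sum_nonneg fun s _ => h0 I s) (mem_univ I))
  exact single_le_sum (f := fun s => 𝔼 x, (dens F c' I s x - dens F c I s x) ^ 2)
    (fun s _ => h0 I s) (mem_range.2 hs)

end Regularity

section RegularityLemma

variable {ι : Type} [DecidableEq ι] [Fintype ι]

lemma exists_energy_increment {V : ι → Type} [∀ i, Fintype (V i)] {r M N : ℕ} {τ : ℝ}
    (hM : 0 < M) (hN : 0 < N) (hτ : 2 * Fintype.card ι ≤ N * τ)
    {F c : Finset ι → (∀ i, V i) → ℕ} (hc : IsColoring M c) (hreg : ¬ IsRegular r F c τ) :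
    ∃ c', IsColoring (M * (N + 1)) c' ∧ Refines c' c ∧
      energy r F c + τ ^ 2 / 4 ≤ energy r F c' := by
  simp only [IsRegular, not_forall, not_le] at hreg
  obtain ⟨I, s, hs, G, θ, hG, hGd, hθ, hθc, hlarge⟩ := hreg
  have hN' : (0 : ℝ) < N := by exact_mod_cast hN
  have hτ0 : 0 ≤ τ := by
    by_contra h
    have : (N : ℝ) * τ < 0 := mul_neg_of_pos_of_neg hN' (not_le.1 h)
    have h2 : (0 : ℝ) ≤ 2 * Fintype.card ι := by positivity
    linarith
  set c' : Finset ι → (∀ i, V i) → ℕ := fun J x => c J x + M * ⌊N * G J x⌋₊ with hc'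
  have hmod : ∀ J x, c' J x % M = c J x := fun J x => by
    rw [hc', Nat.add_mul_mod_self_left, Nat.mod_eq_of_lt (hc.lt J x)]
  have hdiv : ∀ J x, c' J x / M = ⌊N * G J x⌋₊ := fun J x => by
    rw [hc', Nat.add_mul_div_left _ _ hM, Nat.div_eq_of_lt (hc.lt J x), zero_add]
  have hfloor : ∀ J x, ⌊N * G J x⌋₊ ≤ N := fun J x =>
    Nat.floor_le_of_le (mul_le_of_le_one_right hN'.le (hG J x).2)
  have href : Refines c' c := fun J x y h => by rw [← hmod, h, hmod]
  refine ⟨c', ⟨fun J x => ?_, fun J x y h => ?_⟩, href, ?_⟩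
  · have h1 := hc.lt J x
    have h2 := Nat.mul_le_mul_left M (hfloor J x)
    simp only [hc', mul_add, mul_one]
    omega
  · simp only [hc', hc.dependsOn J h, hGd J h]
  set H : Finset ι → (∀ i, V i) → ℝ := fun J x => ⌊N * G J x⌋₊ / N with hH
  have hH01 : ∀ J x, H J x ∈ Set.Icc (0 : ℝ) 1 := fun J x =>
    ⟨by positivity, (div_le_one hN').2 (by exact_mod_cast hfloor J x)⟩
  have hGH : ∀ J x, |G J x - H J x| ≤ 1 / N := fun J x => by
    have h1 := Nat.floor_le (mul_nonneg hN'.le (hG J x).1)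
    have h2 := Nat.lt_floor_add_one (N * G J x)
    have h3 : G J x - H J x = (N * G J x - ⌊N * G J x⌋₊) / N := by
      simp only [hH]; field_simp
    rw [h3, abs_of_nonneg (div_nonneg (by linarith) hN'.le)]
    gcongr
    linarith
  set f : (∀ i, V i) → ℝ := fun x => if F I x = s then 1 else 0 with hf
  set T : (∀ i, V i) → ℝ := fun x => θ x * ∏ j ∈ I, H (I.erase j) x with hT
  have hf1 : ∀ x, |f x - dens F c I s x| ≤ 1 := fun x => by
    have h1 := dens_nonneg F c I s x
    have h2 := dens_le_one F c I s x
    rw [abs_le]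
    simp only [hf]
    split_ifs <;> constructor <;> linarith
  have hprod01 : ∀ x, |∏ j ∈ I, H (I.erase j) x| ≤ 1 := fun x => by
    rw [abs_of_nonneg (prod_nonneg fun j _ => (hH01 _ x).1)]
    exact prod_le_one (fun j _ => (hH01 _ x).1) fun j _ => (hH01 _ x).2
  have hT1 : ∀ x, |T x| ≤ 1 := fun x => by
    rw [hT, abs_mul]
    exact mul_le_one₀ (hθ x) (abs_nonneg _) (hprod01 x)
  have hdiff : ∀ x, |θ x * ∏ j ∈ I, G (I.erase j) x - T x| ≤ τ / 2 := fun x => by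
    have h1 := abs_prod_sub_prod_le I (fun j => G (I.erase j) x) (fun j => H (I.erase j) x)
      (1 / N) (fun j _ => hG _ x) (fun j _ => hH01 _ x) fun j _ => hGH _ x
    rw [hT, ← mul_sub, abs_mul]
    refine (mul_le_of_le_one_left (abs_nonneg _) (hθ x)).trans (h1.trans ?_)
    have h2 : (#I : ℝ) ≤ Fintype.card ι := by exact_mod_cast card_le_univ I
    rw [mul_one_div, div_le_iff₀ hN']
    linarith
  have hbig : τ / 2 ≤ |𝔼 x, (f x - dens F c I s x) * T x| := by
    have h1 : 𝔼 x, (f x - dens F c I s x) * (θ x * ∏ j ∈ I, G (I.erase j) x) =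
        𝔼 x, (f x - dens F c I s x) * T x +
        𝔼 x, (f x - dens F c I s x) * (θ x * ∏ j ∈ I, G (I.erase j) x - T x) := by
      rw [← expect_add_distrib]
      exact expect_congr rfl fun x _ => by ring
    have h2 : |𝔼 x, (f x - dens F c I s x) * (θ x * ∏ j ∈ I, G (I.erase j) x - T x)| ≤ τ / 2 := by
      rcases isEmpty_or_nonempty (∀ i, V i) with he | he
      · simp; positivity
      refine (abs_expect_le _ _).trans (expect_le univ_nonempty fun x _ => ?_)
      rw [abs_mul]
      exact (mul_le_of_le_one_left (abs_nonneg _) (hf1 x)).trans (hdiff x)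
    rw [h1] at hlarge
    have := abs_add_le (𝔼 x, (f x - dens F c I s x) * T x)
      (𝔼 x, (f x - dens F c I s x) * (θ x * ∏ j ∈ I, G (I.erase j) x - T x))
    linarith
  have hTc : ∀ x y, cell c' I x = cell c' I y → T x = T y := fun x y h => by
    simp only [hT]
    rw [hθc x y (href.cell h)]
    congr 1
    refine prod_congr rfl fun j hj => ?_
    simp only [hH, ← hdiv, cell_eq_iff.1 h j hj]
  have hswap : 𝔼 x, (f x - dens F c I s x) * T x =
      𝔼 x, (dens F c' I s x - dens F c I s x) * T x := by
    simp only [sub_mul, expect_sub_distrib]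
    rw [← expect_cavg_mul (cell c' I) f T hTc]
    rfl
  rw [hswap] at hbig
  have h3 := hbig.trans (abs_expect_mul_le _ _ hT1)
  have h4 := expect_sq_le fun x => dens F c' I s x - dens F c I s x
  have h5 := expect_sq_le_energy_sub (F := F) href I hs
  have h6 : (τ / 2) ^ 2 ≤ (𝔼 x, |dens F c' I s x - dens F c I s x|) ^ 2 :=
    pow_le_pow_left₀ (by positivity) h3 2
  nlinarith

lemma exists_regular_or_energy (ι : Type) [DecidableEq ι] [Fintype ι] (r : ℕ) {τ : ℝ}
    (hτ : 0 < τ) (n : ℕ) :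
    ∀ M : ℕ, 0 < M → ∃ M' : ℕ, 0 < M' ∧ ∀ (V : ι → Type) [∀ i, Fintype (V i)]
      (F c : Finset ι → (∀ i, V i) → ℕ), IsColoring M c →
      ∃ c', IsColoring M' c' ∧ Refines c' c ∧
        (IsRegular r F c' τ ∨ energy r F c + n * (τ ^ 2 / 4) ≤ energy r F c') := by
  obtain ⟨N, hN⟩ := exists_nat_gt (2 * Fintype.card ι / τ)
  have hN0 : 0 < N := by
    have : (0 : ℝ) < N := lt_of_le_of_lt (by positivity) hN
    exact_mod_cast this
  rw [div_lt_iff₀ hτ] at hN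
  induction n with
  | zero =>
    intro M hM
    exact ⟨M, hM, fun V _ F c hc => ⟨c, hc, fun _ _ _ h => h, Or.inr (by simp)⟩⟩
  | succ n ih =>
    intro M hM
    obtain ⟨M₁, hM₁, h₁⟩ := ih M hM
    refine ⟨M₁ * (N + 1), by positivity, fun V _ F c hc => ?_⟩
    obtain ⟨c₁, hc₁, href, hor⟩ := h₁ V F c hc
    by_cases hreg : IsRegular r F c₁ τ
    · refine ⟨c₁, ⟨fun J x => ?_, hc₁.dependsOn⟩, href, Or.inl hreg⟩
      exact (hc₁.lt J x).trans_le (Nat.le_mul_of_pos_right _ (Nat.succ_pos _))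
    · obtain ⟨c₂, hc₂, href₂, he⟩ := exists_energy_increment hM₁ hN0 hN.le hc₁ hreg
      refine ⟨c₂, hc₂, href₂.trans href, Or.inr ?_⟩
      have := hor.resolve_left hreg
      push_cast
      linarith

lemma energy_nonneg {V : ι → Type} [∀ i, Fintype (V i)] (r : ℕ)
    (F c : Finset ι → (∀ i, V i) → ℕ) : 0 ≤ energy r F c :=
  sum_nonneg fun _ _ => sum_nonneg fun _ _ => expect_nonneg fun _ _ => sq_nonneg _

/-- The weak regularity lemma: every colouring has a regular refinement of bounded complexity. -/
lemma exists_regular_refinement (ι : Type) [DecidableEq ι] [Fintype ι] (r : ℕ) {τ : ℝ}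
    (hτ : 0 < τ) (M : ℕ) (hM : 0 < M) :
    ∃ M' : ℕ, 0 < M' ∧ ∀ (V : ι → Type) [∀ i, Fintype (V i)] [∀ i, Nonempty (V i)]
      (F c : Finset ι → (∀ i, V i) → ℕ), IsColoring M c →
      ∃ c', IsColoring M' c' ∧ Refines c' c ∧ IsRegular r F c' τ := by
  obtain ⟨n, hn⟩ := exists_nat_gt (Fintype.card (Finset ι) * r / (τ ^ 2 / 4))
  rw [div_lt_iff₀ (by positivity)] at hn
  obtain ⟨M', hM', h⟩ := exists_regular_or_energy ι r hτ n M hM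
  refine ⟨M', hM', fun V _ _ F c hc => ?_⟩
  obtain ⟨c', hc', href, hor⟩ := h V F c hc
  refine ⟨c', hc', href, hor.resolve_right fun he => ?_⟩
  have := energy_le r F c'
  have := energy_nonneg r F c
  linarith

lemma exists_regular_pair_or_energy (ι : Type) [DecidableEq ι] [Fintype ι] (r : ℕ) (η : ℝ)
    (τ : ℕ → ℝ) (hτ : ∀ M, 0 < τ M) (n : ℕ) :
    ∀ M : ℕ, 0 < M → ∃ B : ℕ, ∀ (V : ι → Type) [∀ i, Fintype (V i)] [∀ i, Nonempty (V i)]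
      (F c : Finset ι → (∀ i, V i) → ℕ), IsColoring M c →
      ∃ M₁ ≤ B, ∃ c₁ c₂, IsColoring M₁ c₁ ∧ (∀ J : Finset ι, DependsOn (c₂ J) (J : Set ι)) ∧
        Refines c₂ c₁ ∧ IsRegular r F c₂ (τ M₁) ∧
        (energy r F c₂ - energy r F c₁ ≤ η ∨ energy r F c + n * η ≤ energy r F c₁) := by
  induction n with
  | zero =>
    intro M hM
    obtain ⟨M', hM', h⟩ := exists_regular_refinement ι r (hτ M) M hM
    refine ⟨M, fun V _ _ F c hc => ?_⟩
    obtain ⟨c', hc', href, hreg⟩ := h V F c hc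
    exact ⟨M, le_rfl, c, c', hc, hc'.dependsOn, href, hreg, Or.inr (by simp)⟩
  | succ n ih =>
    intro M hM
    obtain ⟨M', hM', h⟩ := exists_regular_refinement ι r (hτ M) M hM
    obtain ⟨B, hB⟩ := ih M' hM'
    refine ⟨max M B, fun V _ _ F c hc => ?_⟩
    obtain ⟨c', hc', href, hreg⟩ := h V F c hc
    by_cases hη : energy r F c' - energy r F c ≤ η
    · exact ⟨M, le_max_left _ _, c, c', hc, hc'.dependsOn, href, hreg, Or.inl hη⟩
    · obtain ⟨M₁, hM₁, c₁, c₂, h1, h2, h3, h4, h5⟩ := hB V F c' hc'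
      refine ⟨M₁, hM₁.trans (le_max_right _ _), c₁, c₂, h1, h2, h3, h4, h5.imp_right fun h6 => ?_⟩
      push_cast
      linarith

/-- The strong regularity lemma: a coarse colouring `c₁` with `M₁` colours and a refinement `c₂`
that is regular to a precision depending on `M₁` and has almost the same conditional densities. -/
lemma exists_regular_pair (ι : Type) [DecidableEq ι] [Fintype ι] (r : ℕ) {η : ℝ} (hη : 0 < η)
    (τ : ℕ → ℝ) (hτ : ∀ M, 0 < τ M) :
    ∃ B : ℕ, ∀ (V : ι → Type) [∀ i, Fintype (V i)] [∀ i, Nonempty (V i)]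
      (F : Finset ι → (∀ i, V i) → ℕ),
      ∃ M ≤ B, ∃ c₁ c₂, IsColoring M c₁ ∧ (∀ J : Finset ι, DependsOn (c₂ J) (J : Set ι)) ∧
        Refines c₂ c₁ ∧ IsRegular r F c₂ (τ M) ∧
        ∀ I, ∀ s < r, 𝔼 x, |dens F c₂ I s x - dens F c₁ I s x| ≤ η := by
  obtain ⟨n, hn⟩ := exists_nat_gt (Fintype.card (Finset ι) * r / η ^ 2)
  rw [div_lt_iff₀ (by positivity)] at hn
  obtain ⟨B, hB⟩ := exists_regular_pair_or_energy ι r (η ^ 2) τ hτ n 1 one_pos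
  refine ⟨B, fun V _ _ F => ?_⟩
  obtain ⟨M₁, hM₁, c₁, c₂, h1, h2, h3, h4, h5⟩ := hB V F (fun _ _ => 0)
    ⟨fun _ _ => one_pos, fun _ _ _ _ => rfl⟩
  refine ⟨M₁, hM₁, c₁, c₂, h1, h2, h3, h4, fun I s hs => ?_⟩
  have h6 := h5.resolve_right fun he => by
    have := energy_le r F c₁
    have := energy_nonneg r F fun _ _ => 0
    linarith
  have h7 := expect_sq_le fun x => dens F c₂ I s x - dens F c₁ I s x
  have h8 := expect_sq_le_energy_sub (F := F) h3 I hs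
  exact le_of_sq_le_sq (h7.trans (h8.trans h6)) hη.le

end RegularityLemma

section Coupling

/-- Two distributions on `r` points can be coupled through a transition kernel with the probability
of moving away from a point controlled by the difference of the distributions. -/
lemma exists_coupling (r : ℕ) (p q : ℕ → ℝ) (hp : ∀ s < r, 0 ≤ p s) (hq : ∀ s < r, 0 ≤ q s)
    (hp1 : ∑ s ∈ range r, p s = 1) (hq1 : ∑ s ∈ range r, q s = 1) :
    ∃ K : ℕ → ℕ → ℝ, (∀ s < r, ∀ t < r, 0 ≤ K s t) ∧ (∀ s < r, ∑ t ∈ range r, K s t = 1) ∧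
      (∀ t < r, ∑ s ∈ range r, q s * K s t = p t) ∧
      ∀ s < r, q s * (1 - K s s) ≤ |q s - p s| := by
  set m : ℕ → ℝ := fun s => min (q s) (p s) with hm
  have hmq : ∀ s, m s ≤ q s := fun s => min_le_left _ _
  have hmp : ∀ s, m s ≤ p s := fun s => min_le_right _ _
  have hm0 : ∀ s < r, 0 ≤ m s := fun s hs => le_min (hq s hs) (hp s hs)
  set D : ℝ := 1 - ∑ s ∈ range r, m s with hD
  have hDp : ∑ s ∈ range r, (p s - m s) = D := by rw [sum_sub_distrib, hp1]
  have hDq : ∑ s ∈ range r, (q s - m s) = D := by rw [sum_sub_distrib, hq1]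
  have hD0 : 0 ≤ D := hDp ▸ sum_nonneg fun s _ => sub_nonneg.2 (hmp s)
  rcases hD0.eq_or_lt with h0 | hpos
  · have hpm : ∀ s < r, p s = q s := fun s hs => by
      have h1 := (sum_eq_zero_iff_of_nonneg fun s _ => sub_nonneg.2 (hmp s)).1
        (hDp.trans h0.symm) s (mem_range.2 hs)
      have h2 := (sum_eq_zero_iff_of_nonneg fun s _ => sub_nonneg.2 (hmq s)).1
        (hDq.trans h0.symm) s (mem_range.2 hs)
      linarith
    refine ⟨fun s t => if s = t then 1 else 0, fun s _ t _ => by dsimp only; split_ifs <;> norm_num,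
      fun s hs => by simp [hs], fun t ht => by simp [ht, hpm t ht], fun s _ => by simp⟩
  · set a : ℕ → ℝ := fun s => m s / q s with ha
    have haq : ∀ s < r, q s * a s = m s := fun s hs => by
      rcases (hq s hs).eq_or_lt with h | h
      · have : m s = 0 := le_antisymm (h ▸ hmq s) (hm0 s hs)
        rw [this, ← h, zero_mul]
      · simp only [ha]; field_simp
    have ha0 : ∀ s < r, 0 ≤ a s := fun s hs => div_nonneg (hm0 s hs) (hq s hs)
    have ha1 : ∀ s < r, a s ≤ 1 := fun s hs => div_le_one_of_le₀ (hmq s) (hq s hs)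
    have hB0 : ∀ t, 0 ≤ (p t - m t) / D := fun t => div_nonneg (sub_nonneg.2 (hmp t)) hD0
    refine ⟨fun s t => a s * (if s = t then 1 else 0) + (1 - a s) * ((p t - m t) / D),
      fun s hs t _ => ?_, fun s hs => ?_, fun t ht => ?_, fun s hs => ?_⟩
    · have := ha0 s hs
      have := sub_nonneg.2 (ha1 s hs)
      have := hB0 t
      dsimp only
      split_ifs <;> positivity
    · rw [sum_add_distrib, ← mul_sum, ← mul_sum, ← sum_div, hDp, div_self hpos.ne']
      simp [hs]
    · have h1 : ∀ s ∈ range r, q s * (a s * (if s = t then 1 else 0) +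
          (1 - a s) * ((p t - m t) / D)) =
          (if s = t then m s else 0) + (q s - m s) * ((p t - m t) / D) := fun s hs => by
        have := haq s (mem_range.1 hs)
        rw [mul_add, ← mul_assoc, ← mul_assoc, mul_sub, this]
        split_ifs <;> ring
      rw [sum_congr rfl h1, sum_add_distrib, ← sum_mul, hDq]
      simp only [sum_ite_eq', mem_range, ht, if_true]
      field_simp
      ring
    · have h1 : q s * (1 - (a s * (if s = s then 1 else 0) + (1 - a s) * ((p s - m s) / D))) =
          q s - m s - (q s - m s) * ((p s - m s) / D) := by
        rw [if_pos rfl, ← haq s hs]; ring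
      rw [h1]
      have h2 : 0 ≤ (q s - m s) * ((p s - m s) / D) :=
        mul_nonneg (sub_nonneg.2 (hmq s)) (hB0 s)
      have h3 : q s - m s ≤ |q s - p s| := by
        simp only [hm]
        rcases le_total (q s) (p s) with h | h
        · simp [min_eq_left h]
        · rw [min_eq_right h]; exact le_abs_self _
      linarith

end Coupling

section ColorSum

variable {K : Type} [Fintype K] [DecidableEq K]

/-- The average of `φ` over independent random colours, the `J`-th one with distribution `κ J`. -/
noncomputable def colorSum (R : ℕ) (κ : K → ℕ → ℝ) (φ : (K → ℕ) → ℝ) : ℝ :=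
  ∑ β ∈ Fintype.piFinset fun _ : K => range R, (∏ J, κ J (β J)) * φ β

lemma colorSum_one {R : ℕ} {κ : K → ℕ → ℝ} (hκ : ∀ J, ∑ b ∈ range R, κ J b = 1) :
    colorSum R κ (fun _ => 1) = 1 := by
  simp only [colorSum, mul_one]
  rw [← prod_univ_sum]
  simp [hκ]

lemma colorSum_mono {R : ℕ} {κ : K → ℕ → ℝ} (hκ : ∀ J b, 0 ≤ κ J b) {φ ψ : (K → ℕ) → ℝ}
    (h : ∀ β, φ β ≤ ψ β) : colorSum R κ φ ≤ colorSum R κ ψ :=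
  sum_le_sum fun β _ => mul_le_mul_of_nonneg_left (h β) (prod_nonneg fun J _ => hκ J _)

lemma colorSum_nonneg {R : ℕ} {κ : K → ℕ → ℝ} (hκ : ∀ J b, 0 ≤ κ J b) {φ : (K → ℕ) → ℝ}
    (h : ∀ β, 0 ≤ φ β) : 0 ≤ colorSum R κ φ :=
  sum_nonneg fun β _ => mul_nonneg (prod_nonneg fun J _ => hκ J _) (h β)

lemma colorSum_add (R : ℕ) (κ : K → ℕ → ℝ) (φ ψ : (K → ℕ) → ℝ) :
    colorSum R κ (fun β => φ β + ψ β) = colorSum R κ φ + colorSum R κ ψ := by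
  simp only [colorSum, mul_add, sum_add_distrib]

lemma colorSum_sum {S : Type*} (s : Finset S) (R : ℕ) (κ : K → ℕ → ℝ)
    (φ : S → (K → ℕ) → ℝ) :
    colorSum R κ (fun β => ∑ i ∈ s, φ i β) = ∑ i ∈ s, colorSum R κ (φ i) := by
  simp only [colorSum, mul_sum]
  exact sum_comm

lemma colorSum_single {R : ℕ} {κ : K → ℕ → ℝ} (hκ : ∀ J, ∑ b ∈ range R, κ J b = 1) (I : K)
    (φ : ℕ → ℝ) : colorSum R κ (fun β => φ (β I)) = ∑ b ∈ range R, κ I b * φ b := by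
  have h1 : ∀ β : K → ℕ, (∏ J, κ J (β J)) * φ (β I) =
      ∏ J, κ J (β J) * (if J = I then φ (β J) else 1) := fun β => by
    rw [prod_mul_distrib]
    simp
  simp only [colorSum, h1]
  rw [← prod_univ_sum (fun _ => range R) fun J b => κ J b * (if J = I then φ b else 1)]
  rw [Fintype.prod_eq_single I]
  · simp
  · intro J hJ
    simp [hJ, hκ]

lemma colorSum_congr {R : ℕ} {κ κ' : K → ℕ → ℝ} (hκ : ∀ J, ∑ b ∈ range R, κ J b = 1)
    (hκ' : ∀ J, ∑ b ∈ range R, κ' J b = 1) {S : Finset K} (h : ∀ J ∈ S, κ J = κ' J)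
    {φ : (K → ℕ) → ℝ} (hφ : DependsOn φ (S : Set K)) :
    colorSum R κ φ = colorSum R κ' φ := by
  have h1 := colorSum_one hκ
  have h2 := colorSum_one hκ'
  have e1 : colorSum R κ φ = ∑ β ∈ (Fintype.piFinset fun _ : K => range R) ×ˢ
      (Fintype.piFinset fun _ : K => range R),
      (∏ J, κ J (β.1 J)) * (∏ J, κ' J (β.2 J)) * φ β.1 := by
    rw [sum_product, ← mul_one (colorSum R κ φ), ← h2, colorSum, colorSum, sum_mul_sum]
    exact sum_congr rfl fun _ _ => sum_congr rfl fun _ _ => by ring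
  have e2 : colorSum R κ' φ = ∑ β ∈ (Fintype.piFinset fun _ : K => range R) ×ˢ
      (Fintype.piFinset fun _ : K => range R),
      (∏ J, κ J (β.1 J)) * (∏ J, κ' J (β.2 J)) * φ β.2 := by
    rw [sum_product, ← one_mul (colorSum R κ' φ), ← h1, colorSum, colorSum, sum_mul_sum]
    exact sum_congr rfl fun _ _ => sum_congr rfl fun _ _ => by ring
  rw [e1, e2]
  have hmem : ∀ β ∈ (Fintype.piFinset fun _ : K => range R) ×ˢ
      (Fintype.piFinset fun _ : K => range R), (S.piecewise β.2 β.1, S.piecewise β.1 β.2) ∈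
      (Fintype.piFinset fun _ : K => range R) ×ˢ (Fintype.piFinset fun _ : K => range R) := by
    intro β hβ
    simp only [mem_product, Fintype.mem_piFinset] at hβ ⊢
    constructor <;> intro J <;> by_cases hJ : J ∈ S <;> simp [hJ, hβ.1 J, hβ.2 J]
  refine sum_nbij' (fun β => (S.piecewise β.2 β.1, S.piecewise β.1 β.2))
    (fun β => (S.piecewise β.2 β.1, S.piecewise β.1 β.2)) hmem hmem ?_ ?_ ?_
  · intro β _
    ext J <;> by_cases hJ : J ∈ S <;> simp [hJ]
  · intro β _
    ext J <;> by_cases hJ : J ∈ S <;> simp [hJ]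
  · intro β _
    dsimp only
    rw [hφ (x := S.piecewise β.1 β.2) (y := β.1) fun J hJ => by
      simp [mem_coe.1 hJ]]
    congr 1
    rw [← prod_mul_distrib, ← prod_mul_distrib]
    refine prod_congr rfl fun J _ => ?_
    by_cases hJ : J ∈ S
    · simp [hJ, h J hJ, mul_comm]
    · simp [hJ]

end ColorSum

section Uniformity

variable {ι : Type} [DecidableEq ι] {V : ι → Type}

/-- Products of `[0, 1]`-valued functions each ignoring one of the coordinates in `I`. -/
def IsTest (I : Finset ι) (t : (∀ i, V i) → ℝ) : Prop :=
  ∃ g : ι → (∀ i, V i) → ℝ, (∀ j x, g j x ∈ Set.Icc (0 : ℝ) 1) ∧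
    (∀ j, DependsOn (g j) ({j}ᶜ : Set ι)) ∧ ∀ x, t x = ∏ j ∈ I, g j x

omit [DecidableEq ι] in
lemma IsTest.one (I : Finset ι) : IsTest (V := V) I fun _ => 1 :=
  ⟨fun _ _ => 1, by simp, fun _ _ _ _ => rfl, by simp⟩

omit [DecidableEq ι] in
lemma IsTest.mul {I : Finset ι} {t u : (∀ i, V i) → ℝ} (ht : IsTest I t) (hu : IsTest I u) :
    IsTest I fun x => t x * u x := by
  obtain ⟨g, hg, hgd, hgt⟩ := ht
  obtain ⟨h, hh, hhd, hhu⟩ := hu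
  refine ⟨fun j x => g j x * h j x, fun j x => ?_, fun j x y hxy => ?_, fun x => ?_⟩
  · exact ⟨mul_nonneg (hg j x).1 (hh j x).1, mul_le_one₀ (hg j x).2 (hh j x).1 (hh j x).2⟩
  · simp only [hgd j hxy, hhd j hxy]
  · dsimp only
    rw [hgt, hhu, prod_mul_distrib]

lemma IsTest.of_dependsOn {I J : Finset ι} (hIJ : ¬ I ⊆ J) {g : (∀ i, V i) → ℝ}
    (hg : ∀ x, g x ∈ Set.Icc (0 : ℝ) 1) (hgd : DependsOn g (J : Set ι)) : IsTest I g := by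
  obtain ⟨j, hj, hjJ⟩ := not_subset.1 hIJ
  refine ⟨fun i x => if i = j then g x else 1, fun i x => ?_, fun i x y hxy => ?_, fun x => ?_⟩
  · dsimp only
    split_ifs
    exacts [hg x, ⟨zero_le_one, le_rfl⟩]
  · dsimp only
    split_ifs with h
    · subst h
      refine hgd fun k hk => hxy k fun hki => ?_
      rw [Set.mem_singleton_iff] at hki
      exact hjJ (hki ▸ mem_coe.1 hk)
    · rfl
  · simp [hj]

omit [DecidableEq ι] in
lemma IsTest.prod {K : Type*} {I : Finset ι} (s : Finset K) {t : K → (∀ i, V i) → ℝ}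
    (h : ∀ k ∈ s, IsTest I (t k)) : IsTest I fun x => ∏ k ∈ s, t k x := by
  classical
  induction s using Finset.induction_on with
  | empty => simpa using IsTest.one I
  | insert a s ha ih =>
    simp only [prod_insert ha]
    exact (h a (mem_insert_self _ _)).mul (ih fun k hk => h k (mem_insert_of_mem hk))

variable [Fintype ι] [∀ i, Fintype (V i)]

/-- The function `h` has correlation at most `τ` with every product of functions of fewer than
all the coordinates in `I`. -/
def IsUniform (τ : ℝ) (I : Finset ι) (h : (∀ i, V i) → ℝ) : Prop :=
  ∀ t, IsTest I t → |𝔼 x, h x * t x| ≤ τ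

lemma abs_expect_prod_sub_le {τ : ℝ} {κ : Finset ι → (∀ i, V i) → ℝ} {π : Finset ι → ℝ}
    (hκ : ∀ J x, κ J x ∈ Set.Icc (0 : ℝ) 1)
    (hκd : ∀ J : Finset ι, DependsOn (κ J) (J : Set ι))
    (hπ : ∀ J, π J ∈ Set.Icc (0 : ℝ) 1) (hu : ∀ J, IsUniform τ J fun x => κ J x - π J)
    (w : (∀ i, V i) → ℝ) (S : Finset (Finset ι)) (hw : ∀ J ∈ S, IsTest J w) :
    |𝔼 x, w x * ∏ J ∈ S, κ J x - (∏ J ∈ S, π J) * 𝔼 x, w x| ≤ #S * τ := by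
  induction hn : #S generalizing S with
  | zero => simp [card_eq_zero.1 hn]
  | succ n ih =>
    obtain ⟨J, hJ, hmax⟩ := exists_max_image S card (card_pos.1 (by omega))
    have h1 := ih (S.erase J) (fun J' hJ' => hw J' (mem_of_mem_erase hJ'))
      (by rw [card_erase_of_mem hJ]; omega)
    have htest : IsTest J fun x => w x * ∏ J' ∈ S.erase J, κ J' x := by
      refine (hw J hJ).mul (IsTest.prod _ fun J' hJ' => ?_)
      refine IsTest.of_dependsOn (J := J') (fun hsub => ?_) (hκ J') (hκd J')
      exact (ne_of_mem_erase hJ') (eq_of_subset_of_card_le hsub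
        (hmax J' (mem_of_mem_erase hJ'))).symm
    have h2 := hu J _ htest
    have h3 : 𝔼 x, w x * ∏ J ∈ S, κ J x =
        𝔼 x, (κ J x - π J) * (w x * ∏ J' ∈ S.erase J, κ J' x) +
        π J * 𝔼 x, w x * ∏ J' ∈ S.erase J, κ J' x := by
      rw [mul_expect, ← expect_add_distrib]
      refine expect_congr rfl fun x _ => ?_
      rw [← mul_prod_erase S _ hJ]
      ring
    rw [h3, ← mul_prod_erase S _ hJ]
    have h4 : |π J * (𝔼 x, w x * ∏ J' ∈ S.erase J, κ J' x -
        (∏ J' ∈ S.erase J, π J') * 𝔼 x, w x)| ≤ n * τ := by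
      rw [abs_mul, abs_of_nonneg (hπ J).1]
      exact (mul_le_of_le_one_left (abs_nonneg _) (hπ J).2).trans h1
    have h5 := abs_add_le (𝔼 x, (κ J x - π J) * (w x * ∏ J' ∈ S.erase J, κ J' x))
      (π J * (𝔼 x, w x * ∏ J' ∈ S.erase J, κ J' x -
        (∏ J' ∈ S.erase J, π J') * 𝔼 x, w x))
    push_cast
    refine le_trans (le_of_eq (congrArg abs ?_)) (h5.trans (by linarith))
    ring

lemma expect_expect_piecewise [∀ i, Nonempty (V i)] (I : Finset ι) (f : (∀ i, V i) → ℝ) :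
    𝔼 y, 𝔼 x, f (I.piecewise x y) = 𝔼 x, f x := by
  have h1 : 𝔼 z : (∀ i, V i) × (∀ i, V i), f (I.piecewise z.2 z.1) =
      𝔼 z : (∀ i, V i) × (∀ i, V i), f z.2 := by
    refine Fintype.expect_equiv (Function.Involutive.toPerm
      (fun z : (∀ i, V i) × (∀ i, V i) => (I.piecewise z.1 z.2, I.piecewise z.2 z.1))
      fun z => ?_) _ _ fun z => rfl
    ext i <;> by_cases hi : i ∈ I <;> simp [hi]
  rw [← univ_product_univ, expect_product, expect_product] at h1
  simpa using h1

omit [Fintype ι] [∀ i, Fintype (V i)] in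
lemma dependsOn_piecewise {α : Type*} {f : (∀ i, V i) → α} {I : Finset ι}
    (hf : DependsOn f (I : Set ι)) (x y : ∀ i, V i) : f (I.piecewise x y) = f x :=
  hf fun i hi => by simp [mem_coe.1 hi]

lemma IsRegular.isUniform [∀ i, Nonempty (V i)] {r : ℕ} {F c : Finset ι → (∀ i, V i) → ℕ}
    {τ : ℝ} (hreg : IsRegular r F c τ) (hF : ∀ J : Finset ι, DependsOn (F J) (J : Set ι))
    (hc : ∀ J : Finset ι, DependsOn (c J) (J : Set ι)) (I : Finset ι) {s : ℕ} (hs : s < r)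
    {θ : (∀ i, V i) → ℝ} (hθ : ∀ x, |θ x| ≤ 1)
    (hθc : ∀ x y, cell c I x = cell c I y → θ x = θ y) :
    IsUniform τ I fun x => ((if F I x = s then 1 else 0) - dens F c I s x) * θ x := by
  rintro t ⟨g, hg, hgd, hgt⟩
  have hcell : DependsOn (cell c I) (I : Set ι) := by
    intro x y h
    rw [cell_eq_iff]
    exact fun j _ => hc _ fun i hi => h i (mem_of_mem_erase hi)
  have hh : DependsOn (fun x => ((if F I x = s then (1 : ℝ) else 0) - dens F c I s x) * θ x)
      (I : Set ι) := by
    intro x y h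
    have h1 : dens F c I s x = dens F c I s y := cavg_congr _ (hcell h)
    simp only [hF I h, hθc x y (hcell h), h1]
  rw [← expect_expect_piecewise I]
  refine (abs_expect_le _ _).trans (expect_le univ_nonempty fun y _ => ?_)
  have key := hreg I s hs
    (fun J x => ∏ j ∈ I with I.erase j = J, g j (I.piecewise x y)) θ ?_ ?_ hθ hθc
  · refine le_of_eq_of_le ?_ key
    congr 1
    refine expect_congr rfl fun x _ => ?_
    have h1 := dependsOn_piecewise hh x y
    refine (congrArg (· * t (I.piecewise x y)) h1).trans ?_
    rw [mul_assoc, hgt]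
    congr 2
    refine prod_congr rfl fun j hj => ?_
    have h2 : ({i ∈ I | I.erase i = I.erase j} : Finset ι) = {j} := by
      ext i
      simp only [mem_filter, mem_singleton]
      constructor
      · rintro ⟨hi, he⟩
        exact erase_injOn I hi hj he
      · rintro rfl
        exact ⟨hj, rfl⟩
    rw [h2, prod_singleton]
  · intro J x
    exact ⟨prod_nonneg fun j _ => (hg j _).1, prod_le_one (fun j _ => (hg j _).1)
      fun j _ => (hg j _).2⟩
  · intro J x x' h
    refine prod_congr rfl fun j hj => hgd j fun i hi => ?_
    rw [mem_filter] at hj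
    by_cases hiI : i ∈ I
    · have : i ∈ J := hj.2 ▸ mem_erase.2 ⟨hi, hiI⟩
      simp [hiI, h i this]
    · simp [hiI]

end Uniformity

section Sampling

variable {Ω Γ A : Type*} [Fintype Ω] [Nonempty Ω] [Fintype Γ] [DecidableEq Γ]

/-- Given a coarse partition `a` and a fine partition `a'`, a function `f` with few values can be
resampled independently on each cell of `a` so that the outcome is almost determined by `f`
whenever the densities of `f` on the two partitions are close, while the probability of every
outcome deviates from a constant only by the deviation of `f` from its densities on `a'`. -/
lemma exists_sampling (r : ℕ) {a : Ω → Γ} {a' : Ω → A} (haa' : ∀ x y, a' x = a' y → a x = a y)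
    {f : Ω → ℕ} (hf : ∀ x, f x < r) :
    ∃ (w : Ω → Γ → ℕ → ℝ) (P : Γ → ℕ → ℝ) (θ : (Γ → ℕ) → ℕ → Ω → ℝ),
      (∀ x γ, ∀ s < r, 0 ≤ w x γ s) ∧ (∀ x γ, ∑ s ∈ range r, w x γ s = 1) ∧
      (∀ x y, f x = f y → a' x = a' y → w x = w y) ∧
      (∀ γ s, P γ s ∈ Set.Icc (0 : ℝ) 1) ∧
      (∀ b : Γ → ℕ, (∀ γ, b γ < r) → (∀ x, ∏ γ, w x γ (b γ) - ∏ γ, P γ (b γ) =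
        ∑ s ∈ range r, ((if f x = s then 1 else 0) -
          cavg a' (fun y => if f y = s then 1 else 0) x) * θ b s x) ∧
        (∀ s < r, ∀ x, |θ b s x| ≤ 1) ∧ ∀ s x y, a' x = a' y → θ b s x = θ b s y) ∧
      𝔼 x, ∑ s ∈ range r, w x (a x) s * (if f x ≠ s then 1 else 0) ≤
        ∑ s ∈ range r, 𝔼 x, |cavg a' (fun y => if f y = s then 1 else 0) x -
          cavg a (fun y => if f y = s then 1 else 0) x| := by
  set p : Ω → ℕ → ℝ := fun x s => cavg a (fun y => if f y = s then 1 else 0) x with hp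
  set q : Ω → ℕ → ℝ := fun x s => cavg a' (fun y => if f y = s then 1 else 0) x with hq
  have hp0 : ∀ x s, 0 ≤ p x s := fun x s =>
    cavg_nonneg _ (fun y => by split_ifs <;> norm_num) x
  have hp1 : ∀ x s, p x s ≤ 1 := fun x s =>
    cavg_le_one _ (fun y => by split_ifs <;> norm_num) x
  have hq0 : ∀ x s, 0 ≤ q x s := fun x s =>
    cavg_nonneg _ (fun y => by split_ifs <;> norm_num) x
  have hps : ∀ x, ∑ s ∈ range r, p x s = 1 := fun x => by
    simp only [hp]
    rw [cavg_sum]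
    simp only [sum_ite_eq, mem_range, hf, if_true, cavg_const]
  have hqs : ∀ x, ∑ s ∈ range r, q x s = 1 := fun x => by
    simp only [hq]
    rw [cavg_sum]
    simp only [sum_ite_eq, mem_range, hf, if_true, cavg_const]
  have hpa : ∀ x y, a x = a y → p x = p y := fun x y h => funext fun s => cavg_congr _ h
  have hqa : ∀ x y, a' x = a' y → q x = q y := fun x y h => funext fun s => cavg_congr _ h
  choose! Kf hKf using exists_coupling r
  set K : Ω → ℕ → ℕ → ℝ := fun x => Kf (p x) (q x) with hK
  have hK' := fun x => hKf (p x) (q x) (fun s _ => hp0 x s) (fun s _ => hq0 x s) (hps x) (hqs x)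
  have hK0 : ∀ x, ∀ s < r, ∀ t < r, 0 ≤ K x s t := fun x => (hK' x).1
  have hKs : ∀ x, ∀ s < r, ∑ t ∈ range r, K x s t = 1 := fun x => (hK' x).2.1
  have hKp : ∀ x, ∀ t < r, ∑ s ∈ range r, q x s * K x s t = p x t := fun x => (hK' x).2.2.1
  have hKd : ∀ x, ∀ s < r, q x s * (1 - K x s s) ≤ |q x s - p x s| := fun x => (hK' x).2.2.2
  have hKa : ∀ x y, a' x = a' y → K x = K y := fun x y h => by
    simp only [hK, hpa x y (haa' x y h), hqa x y h]
  have hK1 : ∀ x, ∀ s < r, ∀ t < r, K x s t ≤ 1 := fun x s hs t ht =>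
    (single_le_sum (f := fun t => K x s t) (fun t ht => hK0 x s hs t (mem_range.1 ht))
      (mem_range.2 ht)).trans (hKs x s hs).le
  set g : Γ → Ω := Function.invFun a with hg
  have hga : ∀ x, p (g (a x)) = p x := fun x => hpa _ _ (Function.invFun_eq ⟨x, rfl⟩)
  refine ⟨fun x γ s => if a x = γ then K x (f x) s else p (g γ) s, fun γ => p (g γ),
    fun b s x => K x s (b (a x)) * ∏ γ ∈ univ.erase (a x), p (g γ) (b γ),
    fun x γ s hs => ?_, fun x γ => ?_, fun x y h h' => ?_, fun γ s => ⟨hp0 _ _, hp1 _ _⟩,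
    fun b hb => ⟨fun x => ?_, fun s hs x => ?_, fun s x y h => ?_⟩, ?_⟩
  · dsimp only
    split_ifs
    exacts [hK0 x _ (hf x) _ hs, hp0 _ _]
  · dsimp only
    split_ifs
    exacts [hKs x _ (hf x), hps _]
  · funext γ s
    dsimp only
    rw [h, haa' x y h', hKa x y h']
  · dsimp only
    rw [← mul_prod_erase univ (fun γ => p (g γ) (b γ)) (mem_univ (a x)),
      ← mul_prod_erase univ _ (mem_univ (a x)), if_pos rfl, hga, ← hKp x _ (hb _)]
    have h1 : ∏ γ ∈ univ.erase (a x), (if a x = γ then K x (f x) (b γ) else p (g γ) (b γ)) =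
        ∏ γ ∈ univ.erase (a x), p (g γ) (b γ) :=
      prod_congr rfl fun γ hγ => if_neg (ne_of_mem_erase hγ).symm
    have h2 : K x (f x) (b (a x)) =
        ∑ s ∈ range r, (if f x = s then 1 else 0) * K x s (b (a x)) := by
      simp [hf]
    rw [h1, h2, ← sub_mul, ← sum_sub_distrib, sum_mul]
    exact sum_congr rfl fun s _ => by ring
  · have h1 : 0 ≤ ∏ γ ∈ univ.erase (a x), p (g γ) (b γ) := prod_nonneg fun _ _ => hp0 _ _
    have h2 : ∏ γ ∈ univ.erase (a x), p (g γ) (b γ) ≤ 1 :=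
      prod_le_one (fun _ _ => hp0 _ _) fun _ _ => hp1 _ _
    rw [abs_of_nonneg (mul_nonneg (hK0 x s hs _ (hb _)) h1)]
    exact mul_le_one₀ (hK1 x s hs _ (hb _)) h1 h2
  · dsimp only
    rw [hKa x y h, haa' x y h]
  · have h1 : ∀ x, ∑ s ∈ range r, (if a x = a x then K x (f x) s else p (g (a x)) s) *
        (if f x ≠ s then 1 else 0) =
        ∑ s ∈ range r, (if f x = s then 1 else 0) * (1 - K x s s) := fun x => by
      have h2 : ∀ s, (if a x = a x then K x (f x) s else p (g (a x)) s) *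
          (if f x ≠ s then 1 else 0) =
          K x (f x) s - (if f x = s then K x s s else 0) := fun s => by
        rw [if_pos rfl]
        by_cases h : f x = s <;> simp [h]
      rw [sum_congr rfl fun s _ => h2 s, sum_sub_distrib, hKs x _ (hf x)]
      simp [hf]
    rw [expect_congr rfl fun x _ => h1 x]
    rw [expect_sum_comm]
    refine sum_le_sum fun s hs => ?_
    rw [← expect_cavg_mul a' (fun y => if f y = s then 1 else 0) _
      fun x y h => by rw [hKa x y h]]
    exact expect_le_expect fun x _ => hKd x s (mem_range.1 hs)

lemma exists_enum {α : Type*} [Nonempty α] (s : Finset α) : ∃ dec : ℕ → α,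
    (∀ n < #s, dec n ∈ s) ∧ ∀ φ : α → ℝ, ∑ n ∈ range #s, φ (dec n) = ∑ b ∈ s, φ b := by
  classical
  let e := s.equivFin
  refine ⟨fun n => if h : n < #s then e.symm ⟨n, h⟩ else Classical.arbitrary α,
    fun n hn => by simp [hn], fun φ => ?_⟩
  rw [← Fin.sum_univ_eq_sum_range (fun n => φ (if h : n < #s then (e.symm ⟨n, h⟩ : α) else
    Classical.arbitrary α)), ← sum_coe_sort s]
  refine Fintype.sum_equiv e.symm _ _ fun n => ?_
  simp

end Sampling

lemma colorSum_of_le {K : Type} [Fintype K] [DecidableEq K] {R R' : ℕ} (hR : R ≤ R')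
    {κ : K → ℕ → ℝ} (hκ : ∀ J b, R ≤ b → κ J b = 0) (φ : (K → ℕ) → ℝ) :
    colorSum R κ φ = colorSum R' κ φ := by
  refine sum_subset (Fintype.piFinset_subset _ _ fun _ => range_subset_range.2 hR)
    fun β _ hβ => ?_
  simp only [Fintype.mem_piFinset, mem_range, not_forall, not_lt] at hβ
  obtain ⟨J, hJ⟩ := hβ
  rw [prod_eq_zero (mem_univ J) (hκ J _ hJ), zero_mul]

section Approximation

variable {ι : Type} [DecidableEq ι] [Fintype ι] {V : ι → Type} [∀ i, Fintype (V i)]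

/-- `κ` is a system of random colourings with `R` colours of all the faces, in which every colour
is quasirandom of density `π`, up to an error `τ`. -/
structure IsApprox (R : ℕ) (τ : ℝ) (κ : Finset ι → ℕ → (∀ i, V i) → ℝ) (π : Finset ι → ℕ → ℝ) :
    Prop where
  nonneg : ∀ J b x, 0 ≤ κ J b x
  sum_eq : ∀ J x, ∑ b ∈ range R, κ J b x = 1
  eq_zero : ∀ J b, R ≤ b → κ J b = 0
  dependsOn : ∀ J b, DependsOn (κ J b) (J : Set ι)
  mem_Icc : ∀ J b, π J b ∈ Set.Icc (0 : ℝ) 1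
  uniform : ∀ J b, IsUniform τ J fun x => κ J b x - π J b

lemma IsApprox.of_le {R R' : ℕ} {τ : ℝ} {κ : Finset ι → ℕ → (∀ i, V i) → ℝ}
    {π : Finset ι → ℕ → ℝ} (h : IsApprox R τ κ π) (hR : R ≤ R') : IsApprox R' τ κ π where
  nonneg := h.nonneg
  sum_eq J x := by
    rw [← h.sum_eq J x]
    refine (sum_subset (range_subset_range.2 hR) fun b _ hb => ?_).symm
    rw [h.eq_zero J b (by simpa using hb)]
    rfl
  eq_zero J b hb := h.eq_zero J b (hR.trans hb)
  dependsOn := h.dependsOn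
  mem_Icc := h.mem_Icc
  uniform := h.uniform

lemma IsApprox.le_one {R : ℕ} {τ : ℝ} {κ : Finset ι → ℕ → (∀ i, V i) → ℝ}
    {π : Finset ι → ℕ → ℝ} (h : IsApprox R τ κ π) (J : Finset ι) (b : ℕ) (x : ∀ i, V i) :
    κ J b x ≤ 1 := by
  rcases lt_or_ge b R with hb | hb
  · rw [← h.sum_eq J x]
    exact single_le_sum (f := fun b => κ J b x) (fun b _ => h.nonneg J b x) (mem_range.2 hb)
  · rw [h.eq_zero J b hb]
    exact zero_le_one

lemma IsUniform.sum {S : Type*} {τ : ℝ} {I : Finset ι}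
    (s : Finset S) {h : S → (∀ i, V i) → ℝ} (hh : ∀ k ∈ s, IsUniform τ I (h k)) :
    IsUniform (#s * τ) I fun x => ∑ k ∈ s, h k x := by
  intro t ht
  simp only [sum_mul]
  rw [expect_sum_comm]
  refine (abs_sum_le_sum_abs _ _).trans ((sum_le_sum fun k hk => hh k hk t ht).trans ?_)
  simp

/-- The colour classes of the boundary faces of `I`, as a function to a finite type. -/
def cellFin (M : ℕ) (c : Finset ι → (∀ i, V i) → ℕ) (I : Finset ι) (x : ∀ i, V i) :
    ι → Fin (M + 1) :=
  fun j => Fin.ofNat (M + 1) (cell c I x j)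

omit [Fintype ι] [∀ i, Fintype (V i)] in
lemma IsColoring.cellFin_eq_iff {M : ℕ} {c : Finset ι → (∀ i, V i) → ℕ} (hc : IsColoring M c)
    (I : Finset ι) (x y : ∀ i, V i) :
    cellFin M c I x = cellFin M c I y ↔ cell c I x = cell c I y := by
  refine ⟨fun h => ?_, fun h => by unfold cellFin; rw [h]⟩
  rw [cell_eq_iff]
  intro j hj
  have := congrArg Fin.val (congrFun h j)
  simp only [cellFin, cell, hj, if_true, Fin.ofNat, Fin.val_mk] at this
  rwa [Nat.mod_eq_of_lt ((hc.lt _ _).trans (Nat.lt_succ_self _)),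
    Nat.mod_eq_of_lt ((hc.lt _ _).trans (Nat.lt_succ_self _))] at this

lemma cavg_eq_cavg {Ω A B : Type*} [Fintype Ω] {a : Ω → A} {b : Ω → B}
    (h : ∀ x y, a x = a y ↔ b x = b y) (f : Ω → ℝ) (x : Ω) : cavg a f x = cavg b f x := by
  simp only [cavg]
  exact expect_congr (by ext z; simp [h]) fun _ _ => rfl

lemma exists_random_coloring [∀ i, Nonempty (V i)] {r M : ℕ} {τ τ' : ℝ}
    {F c c' : Finset ι → (∀ i, V i) → ℕ} (hF : IsColoring r F) (hc : IsColoring M c)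
    (hc' : ∀ J : Finset ι, DependsOn (c' J) (J : Set ι)) (hcc : Refines c' c)
    (hreg : IsRegular r F c' τ) (hτ : r * τ ≤ τ') {N : ℕ}
    {dec : ℕ → (ι → Fin (M + 1)) → ℕ} (hdec : ∀ n < N, ∀ γ, dec n γ < r)
    (hsum : ∀ φ : ((ι → Fin (M + 1)) → ℕ) → ℝ, ∑ n ∈ range N, φ (dec n) =
      ∑ b ∈ Fintype.piFinset fun _ : ι → Fin (M + 1) => range r, φ b) (I : Finset ι) :
    ∃ (h : ℕ → (∀ i, V i) → ℝ) (p : ℕ → ℝ), (∀ n x, 0 ≤ h n x) ∧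
      (∀ x, ∑ n ∈ range N, h n x = 1) ∧ (∀ n, N ≤ n → h n = 0) ∧
      (∀ n, DependsOn (h n) (I : Set ι)) ∧ (∀ n, p n ∈ Set.Icc (0 : ℝ) 1) ∧
      (∀ n, IsUniform τ' I fun x => h n x - p n) ∧
      𝔼 x, ∑ n ∈ range N, h n x * (if F I x ≠ dec n (cellFin M c I x) then 1 else 0) ≤
        ∑ s ∈ range r, 𝔼 x, |dens F c' I s x - dens F c I s x| := by
  have hcell : DependsOn (cell c' I) (I : Set ι) := by
    intro x y h
    rw [cell_eq_iff]
    exact fun j _ => hc' _ fun i hi => h i (mem_of_mem_erase hi)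
  obtain ⟨w, P, θ, hw0, hw1, hwd, hP, hθ, herr⟩ := exists_sampling r (a := cellFin M c I)
    (a' := cell c' I) (fun x y h => (hc.cellFin_eq_iff I x y).2 (hcc.cell h))
    (f := F I) (hF.lt I)
  have hτ'0 : 0 ≤ τ' := by
    refine le_trans ?_ hτ
    rcases Nat.eq_zero_or_pos r with rfl | hr
    · simp
    · have := hreg I 0 hr (fun _ _ => 0) (fun _ => 0) (by simp) (fun _ _ _ _ => rfl)
        (by simp) (fun _ _ _ => rfl)
      exact mul_nonneg (Nat.cast_nonneg _) ((abs_nonneg _).trans this)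
  refine ⟨fun n x => if n < N then ∏ γ, w x γ (dec n γ) else 0,
    fun n => if n < N then ∏ γ, P γ (dec n γ) else 0, fun n x => ?_, fun x => ?_, fun n hn => ?_,
    fun n x y h => ?_, fun n => ?_, fun n => ?_, ?_⟩
  · dsimp only
    split_ifs with hn
    exacts [prod_nonneg fun γ _ => hw0 _ _ _ (hdec n hn γ), le_rfl]
  · rw [sum_congr rfl fun n hn => if_pos (mem_range.1 hn)]
    rw [hsum fun b => ∏ γ, w x γ (b γ)]
    simpa [colorSum] using colorSum_one (hw1 x)
  · funext x
    simp [hn.not_gt]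
  · dsimp only
    rw [hwd x y (hF.dependsOn I h) (hcell h)]
  · dsimp only
    split_ifs
    exacts [⟨prod_nonneg fun γ _ => (hP _ _).1, prod_le_one (fun γ _ => (hP _ _).1)
      fun γ _ => (hP _ _).2⟩, ⟨le_rfl, zero_le_one⟩]
  · by_cases hn : n < N
    · simp only [hn, if_true]
      obtain ⟨h1, h2, h3⟩ := hθ (dec n) (hdec n hn)
      simp only [h1]
      intro t ht
      refine (IsUniform.sum (range r) (τ := τ) (fun s hs => ?_) t ht).trans (by simpa using hτ)
      exact hreg.isUniform hF.dependsOn hc' I (mem_range.1 hs) (h2 s (mem_range.1 hs)) (h3 s)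
    · simp only [hn, if_false]
      intro t ht
      simpa using hτ'0
  · refine le_trans (le_of_eq ?_) (herr.trans (le_of_eq ?_))
    · refine expect_congr rfl fun x _ => ?_
      rw [← colorSum_single (hw1 x) (cellFin M c I x) fun s => if F I x ≠ s then 1 else 0]
      refine (sum_congr rfl fun n hn => ?_).trans (hsum fun b =>
        (∏ γ, w x γ (b γ)) * if F I x ≠ b (cellFin M c I x) then 1 else 0)
      dsimp only
      rw [if_pos (mem_range.1 hn)]
    · refine sum_congr rfl fun s _ => expect_congr rfl fun x _ => ?_
      simp only [dens]
      rw [cavg_eq_cavg (hc.cellFin_eq_iff I)]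

end Approximation

section Induction

lemma exists_pos_forall_le {Φ : ℕ → ℝ} (hΦ : ∀ R, 0 < Φ R) (N : ℕ) :
    ∃ t, 0 < t ∧ ∀ R ≤ N, t ≤ Φ R := by
  obtain ⟨R, hR, hmin⟩ := exists_min_image (range (N + 1)) Φ ⟨0, by simp⟩
  exact ⟨Φ R, hΦ R, fun R' hR' => hmin R' (by simpa [Nat.lt_succ_iff] using hR')⟩

variable (ι : Type) [DecidableEq ι] [Fintype ι]

/-- The conclusion of the approximation theorem for faces of size `k`. -/
def ApproxStatement (k : ℕ) : Prop :=
  ∀ (r : ℕ) {ε : ℝ}, 0 < ε → ∀ Φ : ℕ → ℝ, (∀ R, 0 < Φ R) → ∃ B : ℕ,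
    ∀ (V : ι → Type) [∀ i, Fintype (V i)] [∀ i, Nonempty (V i)]
      (F : Finset ι → (∀ i, V i) → ℕ), IsColoring r F →
      ∃ R ≤ B, ∃ (κ : Finset ι → ℕ → (∀ i, V i) → ℝ) (π : Finset ι → ℕ → ℝ)
        (Ψ : Finset ι → (Finset ι → ℕ) → ℕ),
        IsApprox R (Φ R) κ π ∧
        (∀ I : Finset ι, DependsOn (Ψ I) (I.powerset : Set (Finset ι))) ∧
        ∀ I : Finset ι, #I = k →
          𝔼 x, colorSum R (fun J b => κ J b x) (fun β => if F I x ≠ Ψ I β then 1 else 0) ≤ ε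

lemma approxStatement_zero : ApproxStatement ι 0 := by
  intro r ε hε Φ hΦ
  refine ⟨1, fun V _ _ F hF => ⟨1, le_rfl, fun _ b _ => if b = 0 then 1 else 0,
    fun _ b => if b = 0 then 1 else 0, fun I _ => F I (Classical.arbitrary _), ?_, ?_, ?_⟩⟩
  · refine ⟨fun J b x => ?_, fun J x => by simp, fun J b hb => ?_, fun J b x y _ => rfl,
      fun J b => ?_, fun J b t ht => ?_⟩
    · split_ifs <;> norm_num
    · funext x
      simp [show b ≠ 0 by omega]
    · split_ifs <;> norm_num
    · simpa using (hΦ 1).le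
  · intro I β β' _
    rfl
  · intro I hI
    have h1 : ∀ x, F I x = F I (Classical.arbitrary _) := fun x =>
      hF.dependsOn I fun i hi => by simp [card_eq_zero.1 hI] at hi
    have h2 : ∀ x, F I x ≠ F I (Classical.arbitrary _) ↔ False := fun x => by
      simp [h1 x]
    simp only [h2, if_false, colorSum, mul_zero, sum_const_zero, expect_const_zero]
    exact hε.le

variable {ι}

lemma approxStatement_succ {k : ℕ} (ih : ApproxStatement ι k) : ApproxStatement ι (k + 1) := by
  intro r ε hε Φ hΦ
  have hdec : ∀ M : ℕ, ∃ dec : ℕ → (ι → Fin (M + 1)) → ℕ, _ := fun M =>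
    exists_enum (Fintype.piFinset fun _ : ι → Fin (M + 1) => range r)
  choose dec hdecr hdecsum using hdec
  set N : ℕ → ℕ := fun M => #(Fintype.piFinset fun _ : ι → Fin (M + 1) => range r) with hN
  have hε' : 0 < ε / (2 * (k + 1)) := by positivity
  have hη : 0 < ε / (2 * (r + 1)) := by positivity
  choose B' hB' using fun M => ih M hε' (fun R => Φ (max R (N M))) fun R => hΦ _
  choose t ht htΦ using fun M => exists_pos_forall_le hΦ (max (B' M) (N M))
  obtain ⟨B, hB⟩ := exists_regular_pair ι r hη (fun M => t M / (r + 1))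
    fun M => div_pos (ht M) (by positivity)
  refine ⟨(range (B + 1)).sup fun M => max (B' M) (N M), fun V _ _ F hF => ?_⟩
  obtain ⟨M, hM, c, c', hc, hc', hcc, hreg, hdens⟩ := hB V F
  obtain ⟨R, hR, κ, π, Ψ, hκ, hΨ, herr⟩ := hB' M V c hc
  have hRB : max R (N M) ≤ max (B' M) (N M) := max_le_max hR le_rfl
  have hτ : r * (t M / (r + 1)) ≤ Φ (max R (N M)) := by
    refine le_trans ?_ (htΦ M _ hRB)
    rw [mul_div_assoc', div_le_iff₀ (by positivity)]
    nlinarith [ht M]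
  choose h p hh0 hh1 hhz hhd hp hhu hherr using
    exists_random_coloring hF hc hc' hcc hreg hτ (N := N M) (dec := dec M)
    (fun n hn γ => by simpa using Fintype.mem_piFinset.1 (hdecr M n hn) γ) (hdecsum M)
  have hκ' := hκ.of_le (le_max_left R (N M))
  set κ₁ : Finset ι → ℕ → (∀ i, V i) → ℝ := fun I => if #I = k + 1 then h I else κ I with hκ₁
  have hκ₁k : ∀ I, #I = k + 1 → κ₁ I = h I := fun I hI => if_pos hI
  have hκ₁n : ∀ I, #I ≠ k + 1 → κ₁ I = κ I := fun I hI => if_neg hI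
  have hκ₁a : IsApprox (max R (N M)) (Φ (max R (N M))) κ₁
      fun I => if #I = k + 1 then p I else π I := by
    refine ⟨fun I b x => ?_, fun I x => ?_, fun I b hb => ?_, fun I b => ?_, fun I b => ?_,
      fun I b => ?_⟩ <;> by_cases hI : #I = k + 1 <;> simp only [hκ₁, hI, if_true, if_false]
    · exact hh0 I b x
    · exact hκ'.nonneg I b x
    · rw [← hh1 I x]
      refine (sum_subset (range_subset_range.2 (le_max_right _ _)) fun b _ hb => ?_).symm
      rw [hhz I b (by simpa using hb)]
      rfl
    · exact hκ'.sum_eq I x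
    · exact hhz I b ((le_max_right _ _).trans hb)
    · exact hκ'.eq_zero I b hb
    · exact hhd I b
    · exact hκ'.dependsOn I b
    · exact hp I b
    · exact hκ'.mem_Icc I b
    · exact hhu I b
    · exact hκ'.uniform I b
  refine ⟨max R (N M), hRB.trans (le_sup (f := fun M => max (B' M) (N M))
    (mem_range.2 (Nat.lt_succ_of_le hM))), κ₁, _,
    fun I β => dec M (β I) fun j => Fin.ofNat (M + 1) (if j ∈ I then Ψ (I.erase j) β else 0),
    hκ₁a, fun I β β' hβ => ?_, fun I hI => ?_⟩
  · dsimp only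
    rw [hβ I (by simp)]
    congr 1
    funext j
    split_ifs
    · rw [hΨ (I.erase j) fun J hJ => hβ J ?_]
      simp only [coe_powerset, Set.mem_preimage, Set.mem_powerset_iff, coe_subset] at hJ ⊢
      exact hJ.trans (erase_subset j I)
    · rfl
  · have hpt : ∀ x, colorSum (max R (N M)) (fun J b => κ₁ J b x) (fun β => if F I x ≠
        dec M (β I) (fun j => Fin.ofNat (M + 1) (if j ∈ I then Ψ (I.erase j) β else 0))
          then 1 else 0) ≤
        ∑ n ∈ range (N M), h I n x *
          (if F I x ≠ dec M n (cellFin M c I x) then 1 else 0) +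
        ∑ j ∈ I, colorSum R (fun J b => κ J b x)
          (fun β => if c (I.erase j) x ≠ Ψ (I.erase j) β then 1 else 0) := by
      intro x
      refine (colorSum_mono (fun J b => hκ₁a.nonneg J b x)
        (ψ := fun β => (if F I x ≠ dec M (β I) (cellFin M c I x) then 1 else 0) +
          ∑ j ∈ I, if c (I.erase j) x ≠ Ψ (I.erase j) β then 1 else 0) fun β => ?_).trans
        (le_of_eq ?_)
      · have h0 : (0 : ℝ) ≤ ∑ j ∈ I, if c (I.erase j) x ≠ Ψ (I.erase j) β then 1 else 0 :=
          sum_nonneg fun j _ => by split_ifs <;> norm_num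
        by_cases hall : ∀ j ∈ I, c (I.erase j) x = Ψ (I.erase j) β
        · have : (fun j => Fin.ofNat (M + 1) (if j ∈ I then Ψ (I.erase j) β else 0)) =
              cellFin M c I x := by
            funext j
            by_cases hj : j ∈ I
            · simp [cellFin, cell, hj, hall j hj]
            · simp [cellFin, cell, hj]
          rw [this]
          linarith
        · push Not at hall
          obtain ⟨j, hj, hne⟩ := hall
          have h1 : (1 : ℝ) ≤ ∑ j ∈ I, if c (I.erase j) x ≠ Ψ (I.erase j) β then 1 else 0 := by
            refine le_trans (by rw [if_pos hne]) (single_le_sum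
              (f := fun j => if c (I.erase j) x ≠ Ψ (I.erase j) β then (1 : ℝ) else 0)
              (fun j _ => by split_ifs <;> norm_num) hj)
          split_ifs <;> linarith
      · rw [colorSum_add, colorSum_sum]
        congr 1
        · rw [colorSum_single (fun J => hκ₁a.sum_eq J x) I
            fun n => if F I x ≠ dec M n (cellFin M c I x) then 1 else 0, hκ₁k I hI]
          refine (sum_subset (range_subset_range.2 (le_max_right _ _)) fun b _ hb => ?_).symm
          rw [hhz I b (by simpa using hb)]
          simp
        · refine sum_congr rfl fun j hj => ?_
          rw [colorSum_of_le (le_max_left R (N M))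
            fun J b hb => by rw [hκ.eq_zero J b hb]; rfl]
          refine colorSum_congr (fun J => hκ₁a.sum_eq J x) (fun J => hκ'.sum_eq J x)
            (S := (I.erase j).powerset) (fun J hJ => ?_) fun β β' hβ => ?_
          · rw [hκ₁n]
            have := card_le_card (mem_powerset.1 hJ)
            rw [card_erase_of_mem hj] at this
            omega
          · rw [hΨ _ hβ]
    refine (expect_le_expect fun x _ => hpt x).trans ?_
    rw [expect_add_distrib]
    have h1 : ∑ s ∈ range r, 𝔼 x, |dens F c' I s x - dens F c I s x| ≤ ε / 2 := by
      refine (sum_le_sum fun s hs => hdens I s (mem_range.1 hs)).trans ?_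
      rw [sum_const, card_range, nsmul_eq_mul, mul_div_assoc', div_le_div_iff₀ (by positivity)
        (by norm_num)]
      nlinarith
    have h2 : 𝔼 x, ∑ j ∈ I, colorSum R (fun J b => κ J b x)
        (fun β => if c (I.erase j) x ≠ Ψ (I.erase j) β then 1 else 0) ≤ ε / 2 := by
      rw [expect_sum_comm]
      refine (sum_le_sum fun j hj => herr (I.erase j) (by rw [card_erase_of_mem hj]; omega)).trans
        (le_of_eq ?_)
      rw [sum_const, hI, nsmul_eq_mul]
      push_cast
      field_simp
    exact (add_le_add ((hherr I).trans h1) h2).trans (add_halves ε).le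

variable (ι) in
lemma approxStatement (k : ℕ) : ApproxStatement ι k := by
  induction k with
  | zero => exact approxStatement_zero ι
  | succ k ih => exact approxStatement_succ ih

end Induction

section Removal

variable {ι : Type} [DecidableEq ι] [Fintype ι] {V : ι → Type} [∀ i, Fintype (V i)]
  {R : ℕ} {τ : ℝ} {κ : Finset ι → ℕ → (∀ i, V i) → ℝ} {π : Finset ι → ℕ → ℝ}

lemma IsApprox.nonneg_error (h : IsApprox R τ κ π) : 0 ≤ τ :=
  (abs_nonneg _).trans (h.uniform ∅ 0 _ (IsTest.one _))

lemma IsApprox.abs_expect_prod_sub_le [∀ i, Nonempty (V i)] (h : IsApprox R τ κ π)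
    (β : Finset ι → ℕ) (T : Finset (Finset ι)) :
    |𝔼 x, ∏ J ∈ T, κ J (β J) x - ∏ J ∈ T, π J (β J)| ≤ Fintype.card (Finset ι) * τ := by
  have h1 := HypergraphRemoval.abs_expect_prod_sub_le (κ := fun J => κ J (β J))
    (π := fun J => π J (β J)) (τ := τ) (fun J x => ⟨h.nonneg _ _ _, h.le_one _ _ _⟩)
    (fun J => h.dependsOn _ _) (fun J => h.mem_Icc _ _) (fun J => h.uniform _ _) (fun _ => 1) T
    fun J _ => IsTest.one J
  simp only [one_mul, expect_const univ_nonempty, mul_one] at h1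
  exact h1.trans (mul_le_mul_of_nonneg_right (by exact_mod_cast card_le_univ T) h.nonneg_error)

lemma IsApprox.abs_expect_mul_prod_sub_le (h : IsApprox R τ κ π) (β : Finset ι → ℕ) (i : ι)
    {u : (∀ i, V i) → ℝ} (hu : ∀ x, u x ∈ Set.Icc (0 : ℝ) 1)
    (hud : DependsOn u ({i}ᶜ : Set ι)) {T : Finset (Finset ι)}
    (hT : (univ.erase i).powerset ⊆ T) :
    |𝔼 x, u x * ∏ J ∈ T, κ J (β J) x - (∏ J ∈ T \ (univ.erase i).powerset, π J (β J)) *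
      𝔼 x, u x * ∏ J ∈ (univ.erase i).powerset, κ J (β J) x| ≤
      Fintype.card (Finset ι) * τ := by
  have hκ : ∀ J x, κ J (β J) x ∈ Set.Icc (0 : ℝ) 1 := fun J x =>
    ⟨h.nonneg _ _ _, h.le_one _ _ _⟩
  have h1 := HypergraphRemoval.abs_expect_prod_sub_le (κ := fun J => κ J (β J))
    (π := fun J => π J (β J)) (τ := τ) hκ
    (fun J => h.dependsOn _ _) (fun J => h.mem_Icc _ _) (fun J => h.uniform _ _)
    (fun x => u x * ∏ J ∈ (univ.erase i).powerset, κ J (β J) x)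
    (T \ (univ.erase i).powerset) fun J hJ => ?_
  · refine le_trans (le_of_eq ?_) (h1.trans
      (mul_le_mul_of_nonneg_right (by exact_mod_cast card_le_univ _) h.nonneg_error))
    congr 2
    refine expect_congr rfl fun x _ => ?_
    rw [← prod_sdiff hT]
    ring
  · simp only [mem_sdiff, mem_powerset] at hJ
    refine (IsTest.of_dependsOn hJ.2 hu ?_).mul (IsTest.prod _ fun J' hJ' =>
      IsTest.of_dependsOn (J := J') (fun hsub => hJ.2 (hsub.trans (mem_powerset.1 hJ')))
        (hκ J') (h.dependsOn _ _))
    simpa [Set.compl_eq_univ_sdiff] using hud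

lemma IsApprox.expect_colorSum_small_le (h : IsApprox R τ κ π) [∀ i, Nonempty (V i)] {θ : ℝ}
    (hθ : 0 ≤ θ) (J : Finset ι) :
    𝔼 x, colorSum R (fun J b => κ J b x) (fun β => if π J (β J) < θ then 1 else 0) ≤
      R * (θ + τ) := by
  have h1 : ∀ x, colorSum R (fun J b => κ J b x) (fun β => if π J (β J) < θ then 1 else 0) =
      ∑ b ∈ range R, κ J b x * (if π J b < θ then 1 else 0) := fun x =>
    colorSum_single (fun J => h.sum_eq J x) J fun b => if π J b < θ then 1 else 0
  simp only [h1]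
  rw [expect_sum_comm]
  refine (sum_le_sum (g := fun _ => θ + τ) fun b _ => ?_).trans
    (by rw [sum_const, card_range, nsmul_eq_mul])
  split_ifs with hb
  · have h2 := h.uniform J b _ (IsTest.one J)
    simp only [mul_one, expect_sub_distrib, expect_const univ_nonempty] at h2 ⊢
    linarith [(abs_le.1 h2).2]
  · have := h.nonneg_error
    simp only [mul_zero, expect_const_zero]
    linarith

lemma pow_card_le_prod {K : Type*} [Fintype K] (T : Finset K) {θ : ℝ} (hθ : 0 ≤ θ)
    (hθ1 : θ ≤ 1) {f : K → ℝ} (hf : ∀ J ∈ T, θ ≤ f J) : θ ^ Fintype.card K ≤ ∏ J ∈ T, f J :=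
  calc θ ^ Fintype.card K ≤ θ ^ #T := pow_le_pow_of_le_one hθ hθ1 (card_le_univ T)
    _ = ∏ _J ∈ T, θ := (prod_const θ).symm
    _ ≤ _ := prod_le_prod (fun _ _ => hθ) hf

lemma IsApprox.expect_prod_le [∀ i, Nonempty (V i)] (h : IsApprox R τ κ π)
    {θ : ℝ} (hθ : 0 < θ) (hθ1 : θ ≤ 1) {m : ℝ} (hm : 1 ≤ m)
    (hτ : Fintype.card (Finset ι) * τ ≤ θ ^ Fintype.card (Finset ι) / (8 * m))
    {β : Finset ι → ℕ} (hβ : ∀ J, θ ≤ π J (β J)) (i : ι)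
    {u : (∀ i, V i) → ℝ} (hu : ∀ x, u x ∈ Set.Icc (0 : ℝ) 1)
    (hud : DependsOn u ({i}ᶜ : Set ι))
    (hA : (∏ J ∈ (univ.erase i).powerset, π J (β J)) / (4 * m) ≤
      𝔼 x, u x * ∏ J ∈ (univ.erase i).powerset, κ J (β J) x) :
    𝔼 x, ∏ J, κ J (β J) x ≤ 16 * m * 𝔼 x, u x * ∏ J, κ J (β J) x := by
  have h1 := (abs_le.1 (h.abs_expect_prod_sub_le β univ)).2
  have h2 := (abs_le.1 (h.abs_expect_mul_prod_sub_le β i hu hud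
    (subset_univ (univ.erase i).powerset))).1
  have h3 := pow_card_le_prod univ hθ.le hθ1 fun J _ => hβ J
  have h4 := prod_sdiff (subset_univ (univ.erase i).powerset) (f := fun J => π J (β J))
  have h5 : 0 ≤ ∏ J ∈ univ \ (univ.erase i).powerset, π J (β J) :=
    prod_nonneg fun J _ => (h.mem_Icc _ _).1
  have h6 := mul_le_mul_of_nonneg_left hA h5
  rw [← mul_div_assoc, h4] at h6
  set Q := ∏ J, π J (β J)
  have h7 : θ ^ Fintype.card (Finset ι) / (8 * m) ≤ Q / (8 * m) := by gcongr
  have h8 : Q / (8 * m) ≤ 𝔼 x, u x * ∏ J, κ J (β J) x := by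
    have : Q / (4 * m) = 2 * (Q / (8 * m)) := by field_simp; ring
    linarith
  have h9 : Q / (8 * m) ≤ Q :=
    div_le_self ((pow_pos hθ _).le.trans h3) (by linarith)
  have h10 : 16 * m * (Q / (8 * m)) = 2 * Q := by field_simp; ring
  have h11 := mul_le_mul_of_nonneg_left h8 (show 0 ≤ 16 * m by linarith)
  linarith

open Classical in
lemma IsApprox.le_expect_inter [∀ i, Nonempty (V i)] [Nonempty ι] (h : IsApprox R τ κ π)
    {θ : ℝ} (hθ : 0 < θ) (hθ1 : θ ≤ 1)
    (hτ : (Fintype.card ι + 1) * (Fintype.card (Finset ι) * τ) ≤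
      θ ^ Fintype.card (Finset ι) / 4)
    {β : Finset ι → ℕ} (hβ : ∀ J, J ≠ univ → θ ≤ π J (β J)) {E : ι → Set (∀ i, V i)}
    (hE : ∀ i, DependsOn (· ∈ E i) ({i}ᶜ : Set ι))
    (hA : ∀ i, 𝔼 x, (if x ∈ E i then 0 else 1) * ∏ J ∈ (univ.erase i).powerset, κ J (β J) x ≤
      (∏ J ∈ (univ.erase i).powerset, π J (β J)) / (4 * Fintype.card ι)) :
    θ ^ Fintype.card (Finset ι) / 2 ≤ 𝔼 x, if ∀ i, x ∈ E i then (1 : ℝ) else 0 := by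
  set T : Finset (Finset ι) := univ.erase univ with hT
  set Q := ∏ J ∈ T, π J (β J) with hQ
  have h1 := (abs_le.1 (h.abs_expect_prod_sub_le β T)).1
  have h3 : θ ^ Fintype.card (Finset ι) ≤ Q :=
    pow_card_le_prod T hθ.le hθ1 fun J hJ => hβ J (ne_of_mem_erase hJ)
  have hκ : ∀ x, ∏ J ∈ T, κ J (β J) x ∈ Set.Icc (0 : ℝ) 1 := fun x =>
    ⟨prod_nonneg fun J _ => h.nonneg _ _ _,
      prod_le_one (fun J _ => h.nonneg _ _ _) fun J _ => h.le_one _ _ _⟩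
  have h2 : ∀ i, 𝔼 x, (if x ∈ E i then 0 else 1) * ∏ J ∈ T, κ J (β J) x ≤
      Q / (4 * Fintype.card ι) + Fintype.card (Finset ι) * τ := fun i => by
    have hsub : (univ.erase i).powerset ⊆ T := fun J hJ => by
      rw [hT, mem_erase]
      refine ⟨?_, mem_univ _⟩
      rintro rfl
      exact (notMem_erase i univ) (mem_powerset.1 hJ (mem_univ i))
    have h4 := (abs_le.1 (h.abs_expect_mul_prod_sub_le β i
      (u := fun x => if x ∈ E i then 0 else 1) (fun x => by split_ifs <;> norm_num)
      (fun x y hxy => by have := hE i hxy; simp only [this]) hsub)).2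
    have h5 : 0 ≤ ∏ J ∈ T \ (univ.erase i).powerset, π J (β J) :=
      prod_nonneg fun J _ => (h.mem_Icc _ _).1
    have h6 := mul_le_mul_of_nonneg_left (hA i) h5
    rw [← mul_div_assoc, prod_sdiff hsub] at h6
    linarith
  have h4 : 𝔼 x, ∏ J ∈ T, κ J (β J) x ≤ (𝔼 x, if ∀ i, x ∈ E i then (1 : ℝ) else 0) +
      ∑ i, 𝔼 x, (if x ∈ E i then 0 else 1) * ∏ J ∈ T, κ J (β J) x := by
    rw [← expect_sum_comm, ← expect_add_distrib]
    refine expect_le_expect fun x _ => ?_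
    have hnn : ∀ i, 0 ≤ (if x ∈ E i then 0 else 1) * ∏ J ∈ T, κ J (β J) x := fun i =>
      mul_nonneg (by split_ifs <;> norm_num) (hκ x).1
    split_ifs with hx
    · linarith [(hκ x).2, sum_nonneg fun i (_ : i ∈ univ) => hnn i]
    · push Not at hx
      obtain ⟨i, hi⟩ := hx
      rw [zero_add]
      refine le_trans ?_ (single_le_sum (fun i _ => hnn i) (mem_univ i))
      simp [hi]
  have h5 := sum_le_sum fun i (_ : i ∈ univ) => h2 i
  have hm : (0 : ℝ) < Fintype.card ι := by exact_mod_cast Fintype.card_pos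
  have h6 : ∑ _i : ι, (Q / (4 * Fintype.card ι) + Fintype.card (Finset ι) * τ) =
      Q / 4 + Fintype.card ι * (Fintype.card (Finset ι) * τ) := by
    rw [sum_const, card_univ, nsmul_eq_mul]
    field_simp
  linarith

end Removal

section RemovalLemma

open Classical in
/-- The removal lemma for simplices in `m`-partite `(m - 1)`-uniform hypergraphs with `m` vertex
classes: if few points lie in all the cylinders `E i`, then all such points can be destroyed by
removing a small cylinder from each of them. -/
theorem exists_cylinder_removal (ι : Type) [Fintype ι] [Nonempty ι] {ε : ℝ} (hε : 0 < ε) :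
    ∃ δ, 0 < δ ∧ ∀ (V : ι → Type) [∀ i, Fintype (V i)] [∀ i, Nonempty (V i)]
      (E : ι → Set (∀ i, V i)), (∀ i, DependsOn (· ∈ E i) ({i}ᶜ : Set ι)) →
      (𝔼 x, if ∀ i, x ∈ E i then (1 : ℝ) else 0) < δ →
      ∃ D : ι → Set (∀ i, V i), (∀ i, DependsOn (· ∈ D i) ({i}ᶜ : Set ι)) ∧
        (∀ i, (𝔼 x, if x ∈ D i then (1 : ℝ) else 0) ≤ ε) ∧
        ∀ x, (∀ i, x ∈ E i) → ∃ i, x ∈ D i := by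
  set m : ℝ := (Fintype.card ι : ℝ) with hm
  set n : ℕ := Fintype.card (Finset ι) with hn
  have hm1 : 1 ≤ m := Nat.one_le_cast.2 Fintype.card_pos
  have hn1 : 1 ≤ n := Fintype.card_pos
  have hn1' : (1 : ℝ) ≤ n := by exact_mod_cast hn1
  set ζ : ℝ := min 1 (ε / (4 * m * n)) with hζ
  have hζ0 : 0 < ζ := lt_min one_pos (by positivity)
  set θ : ℕ → ℝ := fun R => ζ / (R + 1) with hθ
  have hθ0 : ∀ R, 0 < θ R := fun R => by positivity
  have hθ1 : ∀ R, θ R ≤ 1 := fun R =>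
    (div_le_self hζ0.le (by linarith [Nat.cast_nonneg (α := ℝ) R])).trans (min_le_left _ _)
  set Φ : ℕ → ℝ := fun R => θ R ^ n / (8 * (m + 1) * n) with hΦ
  have hΦ0 : ∀ R, 0 < Φ R := fun R => by have := hθ0 R; positivity
  have hε1 : 0 < ε / (34 * m ^ 2) := by positivity
  obtain ⟨B, hB⟩ := approxStatement ι (Fintype.card ι - 1) 2 hε1 Φ hΦ0
  refine ⟨θ B ^ n / 2, by have := hθ0 B; positivity, fun V _ _ E hE hEδ => ?_⟩
  set F : Finset ι → (∀ i, V i) → ℕ := fun J x =>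
    if ∃ i, J = univ.erase i ∧ x ∈ E i then 1 else 0 with hF
  have hFc : IsColoring 2 F := by
    refine ⟨fun J x => by simp only [hF]; split_ifs <;> norm_num, fun J x y hxy => ?_⟩
    have : ∀ i, (J = univ.erase i ∧ x ∈ E i) ↔ (J = univ.erase i ∧ y ∈ E i) := fun i => by
      refine and_congr_right fun hJ => iff_of_eq (hE i fun j hj => hxy j ?_)
      rw [hJ]
      simpa using hj
    simp only [hF, this]
  have hFE : ∀ i x, F (univ.erase i) x = 1 ↔ x ∈ E i := fun i x => by
    have : (∃ j, univ.erase i = univ.erase j ∧ x ∈ E j) ↔ x ∈ E i := by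
      refine ⟨?_, fun h => ⟨i, rfl, h⟩⟩
      rintro ⟨j, hj, hx⟩
      rwa [erase_injOn univ (mem_coe.2 (mem_univ i)) (mem_coe.2 (mem_univ j)) hj]
    simp only [hF, this]
    split_ifs with h <;> simp [h]
  obtain ⟨R, hR, κ, π, Ψ, hκ, hΨ, herr⟩ := hB V F hFc
  have hτ1 : (m + 1) * (n * Φ R) = θ R ^ n / 8 := by
    simp only [hΦ]; field_simp
  have hpow : 0 < θ R ^ n := pow_pos (hθ0 R) n
  have hτ2 : n * Φ R ≤ θ R ^ n / (8 * m) := by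
    rw [le_div_iff₀ (by positivity)]
    nlinarith [hΦ0 R]
  have hτ3 : Φ R ≤ θ R := by
    have h1 : θ R ^ n ≤ θ R := pow_le_of_le_one (hθ0 R).le (hθ1 R) (by omega)
    refine le_trans (div_le_self hpow.le ?_) h1
    nlinarith
  set A : ι → (Finset ι → ℕ) → ℝ := fun i β =>
    𝔼 x, (if x ∈ E i then 0 else 1) * ∏ J ∈ (univ.erase i).powerset, κ J (β J) x with hA
  set good : ι → (Finset ι → ℕ) → Prop := fun i β =>
    (∀ J ∈ (univ.erase i).powerset, θ R ≤ π J (β J)) ∧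
      A i β ≤ (∏ J ∈ (univ.erase i).powerset, π J (β J)) / (4 * m) with hgood
  set Z : ι → (∀ i, V i) → ℝ := fun i x =>
    colorSum R (fun J b => κ J b x) fun β => if good i β then 0 else 1 with hZ
  have hgoodd : ∀ i, DependsOn (good i) ((univ.erase i).powerset : Set (Finset ι)) := by
    intro i β β' h
    have h1 : ∀ J ∈ (univ.erase i).powerset, β J = β' J := fun J hJ => h J (mem_coe.2 hJ)
    have h2 : A i β = A i β' := expect_congr rfl fun x _ => by
      rw [prod_congr rfl fun J hJ => by rw [h1 J hJ]]
    simp only [hgood, h2]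
    rw [prod_congr rfl fun J hJ => by rw [h1 J hJ]]
    refine propext (and_congr_left fun _ => forall₂_congr fun J hJ => by rw [h1 J hJ])
  have hZd : ∀ i, DependsOn (Z i) ({i}ᶜ : Set ι) := by
    intro i x y hxy
    refine colorSum_congr (fun J => hκ.sum_eq J x) (fun J => hκ.sum_eq J y)
      (S := (univ.erase i).powerset) (fun J hJ => ?_) fun β β' hβ => ?_
    · funext b
      refine hκ.dependsOn J b fun j hj => hxy j ?_
      simpa using mem_powerset.1 hJ hj
    · simp only [hgoodd i hβ]
  set D : ι → Set (∀ i, V i) := fun i => {x | x ∈ E i ∧ 1 / m ≤ Z i x} with hD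
  refine ⟨D, fun i x y hxy => ?_, fun i => ?_,
    fun x hx => ?_⟩
  · have h1 := hE i hxy
    have h2 := hZd i hxy
    simp only [hD, Set.mem_ofPred_eq, h2] at h1 ⊢
    rw [h1]
  · set I : Finset ι := univ.erase i with hI
    have hIcard : #I = Fintype.card ι - 1 := by rw [hI, card_erase_of_mem (mem_univ i), card_univ]
    set bad : (Finset ι → ℕ) → Prop := fun β =>
      (∀ J, θ R ≤ π J (β J)) ∧ Ψ I β = 1 ∧ ¬ good i β with hbaddef
    have hmis := herr I hIcard
    have hbad : 𝔼 x, colorSum R (fun J b => κ J b x) (fun β => if bad β then 1 else 0) ≤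
        16 * m * 𝔼 x, colorSum R (fun J b => κ J b x)
          (fun β => if F I x ≠ Ψ I β then 1 else 0) := by
      simp only [colorSum]
      rw [expect_sum_comm, expect_sum_comm, mul_sum]
      refine sum_le_sum fun β _ => ?_
      have hprod : ∀ x, 0 ≤ ∏ J, κ J (β J) x := fun x => prod_nonneg fun J _ => hκ.nonneg _ _ _
      have hrhs : 0 ≤ 𝔼 x, (∏ J, κ J (β J) x) * if F I x ≠ Ψ I β then (1 : ℝ) else 0 :=
        expect_nonneg fun x _ => mul_nonneg (hprod x) (by split_ifs <;> norm_num)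
      by_cases hβ : bad β
      · simp only [hβ, if_true, mul_one]
        obtain ⟨hβ1, hβ2, hβ3⟩ := hβ
        have hA' : (∏ J ∈ (univ.erase i).powerset, π J (β J)) / (4 * m) ≤ A i β := by
          by_contra! h
          exact hβ3 ⟨fun J _ => hβ1 J, h.le⟩
        refine (hκ.expect_prod_le (hθ0 R) (hθ1 R) hm1 hτ2 hβ1 i
          (u := fun x => if x ∈ E i then 0 else 1) (fun x => by split_ifs <;> norm_num)
          (fun x y hxy => by have := hE i hxy; simp only [this]) hA').trans ?_
        refine mul_le_mul_of_nonneg_left (expect_le_expect fun x _ => ?_) (by positivity)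
        rw [mul_comm, hβ2]
        refine mul_le_mul_of_nonneg_left (le_of_eq ?_) (hprod x)
        have h : F I x = 1 ↔ x ∈ E i := hFE i x
        by_cases hx : x ∈ E i <;> simp [hx, h]
      · simp only [hβ, if_false, mul_zero, expect_const_zero]
        exact mul_nonneg (by positivity) hrhs
    have hpt : ∀ x, (if x ∈ E i then Z i x else 0) ≤
        ∑ J, colorSum R (fun J b => κ J b x) (fun β => if π J (β J) < θ R then 1 else 0) +
        colorSum R (fun J b => κ J b x) (fun β => if F I x ≠ Ψ I β then 1 else 0) +
        colorSum R (fun J b => κ J b x) (fun β => if bad β then 1 else 0) := by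
      intro x
      rw [← colorSum_sum, ← colorSum_add, ← colorSum_add]
      have hs0 : ∀ β : Finset ι → ℕ, ∀ J, (0 : ℝ) ≤ if π J (β J) < θ R then 1 else 0 :=
        fun β J => by split_ifs <;> norm_num
      have hs : ∀ β : Finset ι → ℕ, (0 : ℝ) ≤ ∑ J, if π J (β J) < θ R then 1 else 0 :=
        fun β => sum_nonneg fun J _ => hs0 β J
      split_ifs with hx
      · refine colorSum_mono (fun J b => hκ.nonneg J b x) fun β => ?_
        by_cases h1 : ∀ J, θ R ≤ π J (β J)
        · by_cases h2 : Ψ I β = 1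
          · have h3 : F I x = Ψ I β := by rw [h2]; exact (hFE i x).2 hx
            have h4 : bad β ↔ ¬ good i β := by simp [hbaddef, h1, h2]
            have := hs β
            simp only [h3, h4, ne_eq, not_true, if_false, ite_not]
            linarith
          · have h3 : F I x ≠ Ψ I β := by rw [(hFE i x).2 hx]; exact Ne.symm h2
            have := hs β
            rw [if_pos h3]
            split_ifs <;> linarith
        · push Not at h1
          obtain ⟨J, hJ⟩ := h1
          have := single_le_sum (fun J _ => hs0 β J) (mem_univ J)
          rw [if_pos hJ] at this
          split_ifs <;> linarith
      · refine colorSum_nonneg (fun J b => hκ.nonneg J b x) fun β => ?_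
        have := hs β
        split_ifs <;> linarith
    have hmain : (𝔼 x, if x ∈ D i then (1 : ℝ) else 0) ≤
        m * 𝔼 x, if x ∈ E i then Z i x else 0 := by
      rw [mul_expect]
      refine expect_le_expect fun x _ => ?_
      have hZ0 : 0 ≤ Z i x := colorSum_nonneg (fun J b => hκ.nonneg J b x)
        fun β => by split_ifs <;> norm_num
      by_cases hx : x ∈ E i
      · by_cases hz : 1 / m ≤ Z i x
        · simp only [hD, Set.mem_ofPred_eq, hx, hz, and_self, if_true]
          rwa [div_le_iff₀' (by positivity)] at hz
        · simp only [hD, Set.mem_ofPred_eq, hx, hz, and_false, if_false, if_true]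
          positivity
      · simp [hD, hx]
    have hsum : (𝔼 x, if x ∈ E i then Z i x else 0) ≤
        n * (R * (θ R + Φ R)) + ε / (34 * m ^ 2) + 16 * m * (ε / (34 * m ^ 2)) := by
      refine (expect_le_expect fun x _ => hpt x).trans ?_
      rw [expect_add_distrib, expect_add_distrib, expect_sum_comm]
      refine add_le_add (add_le_add ?_ hmis)
        (hbad.trans (mul_le_mul_of_nonneg_left hmis (by positivity)))
      refine (sum_le_sum fun J _ => hκ.expect_colorSum_small_le (hθ0 R).le J).trans ?_
      rw [sum_const, card_univ, nsmul_eq_mul]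
    have hRθ : R * (θ R + Φ R) ≤ 2 * ζ := by
      have h1 : R * θ R ≤ ζ := by
        simp only [hθ]
        rw [mul_div_assoc', div_le_iff₀ (by positivity)]
        nlinarith
      nlinarith [Nat.cast_nonneg (α := ℝ) R]
    have hζε : m * (n * (2 * ζ)) ≤ ε / 2 := by
      have h1 : ζ ≤ ε / (4 * m * n) := min_le_right _ _
      rw [le_div_iff₀ (by positivity)] at h1
      linarith
    have h34 : m * (ε / (34 * m ^ 2) + 16 * m * (ε / (34 * m ^ 2))) ≤ ε / 2 := by
      have : m * (ε / (34 * m ^ 2) + 16 * m * (ε / (34 * m ^ 2))) =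
          ε * (1 + 16 * m) / (34 * m) := by field_simp
      rw [this, div_le_div_iff₀ (by positivity) (by norm_num)]
      nlinarith
    refine (le_of_eq (expect_congr rfl fun x _ => by congr)).trans (hmain.trans
      ((mul_le_mul_of_nonneg_left hsum (by positivity)).trans ?_))
    have h5 : m * (n * (R * (θ R + Φ R))) ≤ m * (n * (2 * ζ)) := by gcongr
    linarith
  · by_contra! hcon
    have hlt : ∀ i, Z i x < 1 / m := fun i => by
      have := hcon i
      simp only [hD, Set.mem_ofPred_eq, not_and, not_le] at this
      exact this (hx i)
    have hex : ∃ β, ∀ i, good i β := by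
      by_contra! hno
      have h1 : colorSum R (fun J b => κ J b x) (fun _ => 1) ≤ ∑ i, Z i x := by
        rw [← colorSum_sum]
        refine colorSum_mono (fun J b => hκ.nonneg J b x) fun β => ?_
        obtain ⟨i, hi⟩ := hno β
        refine le_trans (by rw [if_neg hi]) (single_le_sum
          (f := fun i => if good i β then (0 : ℝ) else 1)
          (fun j _ => by split_ifs <;> norm_num) (mem_univ i))
      rw [colorSum_one fun J => hκ.sum_eq J x] at h1
      have h2 : ∑ i, Z i x < ∑ _i : ι, 1 / m :=
        sum_lt_sum_of_nonempty univ_nonempty fun i _ => hlt i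
      rw [sum_const, card_univ, nsmul_eq_mul, ← hm, mul_one_div_cancel (by positivity)] at h2
      linarith
    obtain ⟨β, hβ⟩ := hex
    have h1 := hκ.le_expect_inter (hθ0 R) (hθ1 R) (by rw [← hm, ← hn, hτ1]; linarith)
      (β := β) (fun J hJ => ?_) hE fun i => (hβ i).2
    · have h2 : θ B ≤ θ R := by
        simp only [hθ]
        gcongr
      have h3 : θ B ^ n ≤ θ R ^ n := pow_le_pow_left₀ (hθ0 B).le h2 n
      linarith
    · obtain ⟨i, hi⟩ : ∃ i, i ∉ J := by
        by_contra! h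
        exact hJ (eq_univ_of_forall h)
      exact (hβ i).1 J (mem_powerset.2 fun j hj =>
        mem_erase.2 ⟨fun h => hi (h ▸ hj), mem_univ j⟩)

end RemovalLemma

section Subgroups

variable {ι W : Type} [AddCommGroup W]

/-- The sum map from the product of a family of subgroups. -/
def sumHom [Fintype ι] (K : ι → AddSubgroup W) : (∀ i, K i) →+ W :=
  ∑ i, (K i).subtype.comp (Pi.evalAddMonoidHom (fun i => K i) i)

theorem sumHom_apply [Fintype ι] (K : ι → AddSubgroup W) (v : ∀ i, K i) :
    sumHom K v = ∑ i, (v i : W) := by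
  simp [sumHom]

open Classical in
theorem sumHom_single [Fintype ι] (K : ι → AddSubgroup W) (i : ι) (k : K i) :
    sumHom K (Pi.single i k) = k := by
  rw [sumHom_apply, Fintype.sum_eq_single i fun j hj => by rw [Pi.single_eq_of_ne hj]; rfl,
    Pi.single_eq_same]

theorem expect_add_right {A : Type*} [AddCommGroup A] [Fintype A] (f : A → ℝ) (a : A) :
    𝔼 x, f (x + a) = 𝔼 x, f x :=
  Fintype.expect_equiv (Equiv.addRight a) _ _ fun _ => rfl

open Classical in
theorem eq_add_single_of_eqOn {K : ι → AddSubgroup W} {i : ι} {v v' : ∀ i, K i}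
    (h : ∀ j ∈ ({i}ᶜ : Set ι), v j = v' j) : v' = v + Pi.single i (v' i - v i) := by
  funext j
  rw [Pi.add_apply]
  by_cases hj : j = i
  · subst hj
    simp
  · rw [Pi.single_eq_of_ne hj, add_zero, h j (by simpa using hj)]

open Classical in
/-- If few points in the sum of the subgroups `K i` lie in all the `K i`-invariant sets `P i`, then
all of these points can be covered by small `K i`-invariant sets. Pulling back along the sum map,
this is `exists_cylinder_removal`. -/
theorem exists_invariant_removal (ι : Type) [Fintype ι] [Nonempty ι] {ε : ℝ} (hε : 0 < ε) :
    ∃ δ, 0 < δ ∧ ∀ (W : Type) [AddCommGroup W] [Fintype W] (K : ι → AddSubgroup W)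
      (P : ι → Set W), (∀ i, ∀ x ∈ P i, ∀ k ∈ K i, x + k ∈ P i) →
      (𝔼 v, if ∀ i, sumHom K v ∈ P i then (1 : ℝ) else 0) < δ →
      ∃ B : ι → Set W, (∀ i, ∀ x ∈ B i, ∀ k ∈ K i, x + k ∈ B i) ∧
        (∀ i, (𝔼 v, if sumHom K v ∈ B i then (1 : ℝ) else 0) ≤ ε) ∧
        ∀ v, (∀ i, sumHom K v ∈ P i) → ∃ i, sumHom K v ∈ B i := by
  set m : ℝ := (Fintype.card ι : ℝ) with hm
  have hm0 : 0 < m := Nat.cast_pos.2 Fintype.card_pos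
  obtain ⟨δ, hδ, hrem⟩ := exists_cylinder_removal ι (div_pos hε hm0)
  refine ⟨δ, hδ, fun W _ _ K P hP hPδ => ?_⟩
  obtain ⟨D, hD, hDε, hcov⟩ := hrem (fun i => K i) (fun i => {v | sumHom K v ∈ P i})
    (fun i v v' h => by
      rw [eq_add_single_of_eqOn h]
      simp only [Set.mem_ofPred_eq, map_add, sumHom_single]
      refine propext ⟨fun hv => hP i _ hv _ (v' i - v i).2, fun hv => ?_⟩
      have := hP i _ hv _ ((K i).neg_mem (v' i - v i).2)
      rwa [add_neg_cancel_right] at this)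
    hPδ
  set p : ι → (∀ i, K i) → ℝ := fun i v =>
    𝔼 u : (sumHom K).ker, if v + u ∈ D i then 1 else 0 with hp
  have hp0 : ∀ i v, 0 ≤ p i v := fun i v => expect_nonneg fun u _ => by split_ifs <;> norm_num
  have hpker : ∀ i v v', sumHom K v = sumHom K v' → p i v = p i v' := fun i v v' h => by
    have hk : v - v' ∈ (sumHom K).ker := by rw [AddMonoidHom.mem_ker, map_sub, h, sub_self]
    rw [hp]
    dsimp only
    rw [← expect_add_right (fun u : (sumHom K).ker => if v' + u ∈ D i then (1 : ℝ) else 0)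
      ⟨v - v', hk⟩]
    refine expect_congr rfl fun u _ => ?_
    have : v' + ((u + ⟨v - v', hk⟩ : (sumHom K).ker) : ∀ i, K i) = v + u := by
      rw [AddSubgroup.coe_add, add_left_comm, add_sub_cancel, add_comm]
    rw [this]
  have hpsingle : ∀ i v (k : K i), p i (v + Pi.single i k) = p i v := fun i v k => by
    refine expect_congr rfl fun u _ => ?_
    have : (v + Pi.single i k + (u : ∀ i, K i) ∈ D i) = (v + u ∈ D i) := hD i fun j hj => by
      have hj' : j ≠ i := by simpa using hj
      rw [Pi.add_apply, Pi.add_apply, Pi.single_eq_of_ne hj', add_zero, Pi.add_apply]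
    simp only [this]
  have hpavg : ∀ i, 𝔼 v, p i v = 𝔼 v, if v ∈ D i then (1 : ℝ) else 0 := fun i => by
    simp only [hp]
    rw [expect_comm]
    rw [expect_congr rfl fun (u : (sumHom K).ker) _ => expect_add_right
      (fun v : (∀ i, K i) => if v ∈ D i then (1 : ℝ) else 0) (u : ∀ i, K i)]
    exact Fintype.expect_const _
  have hB : ∀ i v, sumHom K v ∈ {w | ∃ v, sumHom K v = w ∧ 1 / m ≤ p i v} ↔ 1 / m ≤ p i v := by
    refine fun i v => ⟨?_, fun h => ⟨v, rfl, h⟩⟩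
    rintro ⟨v', h, hv'⟩
    rwa [← hpker i v' v h]
  refine ⟨fun i => {w | ∃ v, sumHom K v = w ∧ 1 / m ≤ p i v}, ?_, fun i => ?_, fun v hv => ?_⟩
  · rintro i _ ⟨v, rfl, hv⟩ k hk
    refine ⟨v + Pi.single i ⟨k, hk⟩, ?_, by rwa [hpsingle]⟩
    rw [map_add, sumHom_single]
  · simp only [hB]
    calc (𝔼 v, if 1 / m ≤ p i v then (1 : ℝ) else 0) ≤ 𝔼 v, m * p i v := by
          refine expect_le_expect fun v _ => ?_
          split_ifs with h
          · rwa [div_le_iff₀' hm0] at h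
          · exact mul_nonneg hm0.le (hp0 i v)
      _ ≤ ε := by
          rw [← mul_expect, hpavg, ← le_div_iff₀' hm0]
          exact hDε i
  · simp only [hB]
    by_contra! hlt
    have h1 : 1 ≤ ∑ i, p i v := by
      simp only [hp]
      rw [← expect_sum_comm]
      refine (Fintype.expect_const (ι := (sumHom K).ker) (1 : ℝ)).ge.trans
        (expect_le_expect fun u _ => ?_)
      obtain ⟨i, hi⟩ := hcov (v + u) fun i => by
        rw [Set.mem_ofPred_eq, map_add, AddMonoidHom.mem_ker.1 u.2, add_zero]
        exact hv i
      refine le_trans (le_of_eq (if_pos hi).symm) (single_le_sum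
        (f := fun i => if v + (u : ∀ i, K i) ∈ D i then (1 : ℝ) else 0)
        (fun j _ => by split_ifs <;> norm_num) (mem_univ i))
    have h2 : ∑ i, p i v < ∑ _i : ι, 1 / m := sum_lt_sum_of_nonempty univ_nonempty fun i _ => hlt i
    rw [sum_const, card_univ, nsmul_eq_mul, ← hm, mul_one_div_cancel hm0.ne'] at h2
    linarith

theorem expect_indicator_eq {A : Type} [Fintype A] (p : A → Prop) [DecidablePred p] :
    (𝔼 x, if p x then (1 : ℝ) else 0) = Nat.card {x | p x} / Nat.card A := by
  rw [Fintype.expect_eq_sum_div_card, sum_boole, Nat.card_eq_fintype_card (α := A),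
    ← Fintype.card_subtype p, ← Nat.card_eq_fintype_card]
  rfl

/-- The points lying in all the `K i`-invariant sets `P i` can be covered by `K i`-invariant sets
`B i` of size controlled by the number of these points. -/
theorem exists_invariant_cover (ι : Type) [Fintype ι] [Nonempty ι] {ε : ℝ} (hε : 0 < ε) :
    ∃ M, 0 < M ∧ ∀ (W : Type) [AddCommGroup W] [Fintype W] (K : ι → AddSubgroup W)
      (P : ι → Set W), (∀ i, ∀ x ∈ P i, ∀ k ∈ K i, x + k ∈ P i) →
      ∃ B : ι → Set W, (∀ i, ∀ x ∈ B i, ∀ k ∈ K i, x + k ∈ B i) ∧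
        (∀ i, (Nat.card (B i) : ℝ) ≤ ε * Nat.card W + M * Nat.card {x | ∀ i, x ∈ P i}) ∧
        ∀ x, (∀ i, x ∈ P i) → ∃ i, x ∈ B i := by
  classical
  obtain ⟨δ, hδ, hrem⟩ := exists_invariant_removal ι hε
  refine ⟨1 / δ, by positivity, fun W _ _ K P hP => ?_⟩
  have hcoset : ∀ t : W, ∃ B : ι → Set W, (∀ i, ∀ x ∈ B i, ∀ k ∈ K i, x + k ∈ B i) ∧
      (∀ i, (𝔼 v, if sumHom K v ∈ B i then (1 : ℝ) else 0) ≤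
        ε + 1 / δ * 𝔼 v, if ∀ i, t + sumHom K v ∈ P i then (1 : ℝ) else 0) ∧
      ∀ v, (∀ i, t + sumHom K v ∈ P i) → ∃ i, sumHom K v ∈ B i := by
    intro t
    by_cases ht : (𝔼 v, if ∀ i, t + sumHom K v ∈ P i then (1 : ℝ) else 0) < δ
    · obtain ⟨B, hB, hBε, hcov⟩ := hrem W K (fun i => {x | t + x ∈ P i})
        (fun i x hx k hk => by
          rw [Set.mem_ofPred_eq, ← add_assoc]
          exact hP i _ hx k hk) ht
      refine ⟨B, hB, fun i => (hBε i).trans (le_add_of_nonneg_right ?_), hcov⟩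
      exact mul_nonneg (by positivity) (expect_nonneg fun v _ => by split_ifs <;> norm_num)
    · refine ⟨fun _ => Set.univ, fun _ _ _ _ _ => trivial, fun i => ?_,
        fun _ _ => ⟨Classical.arbitrary ι, trivial⟩⟩
      simp only [Set.mem_univ, if_true, Fintype.expect_const]
      rw [not_lt, ← one_le_div hδ] at ht
      rw [one_div_mul_eq_div]
      linarith
  choose C hC hCε hcov using hcoset
  set r : W → W := fun x => Quotient.out (x : W ⧸ (sumHom K).range) with hr
  have hradd : ∀ x v, r (x + sumHom K v) = r x := fun x v => by
    simp only [hr]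
    congr 1
    rw [QuotientAddGroup.mk_add_of_mem]
    exact ⟨v, rfl⟩
  have hrsub : ∀ x, ∃ v, x = r x + sumHom K v := fun x => by
    obtain ⟨v, hv⟩ : -r x + x ∈ (sumHom K).range :=
      QuotientAddGroup.eq.1 (QuotientAddGroup.out_eq' (x : W ⧸ (sumHom K).range))
    exact ⟨v, by rw [hv]; abel⟩
  have havg : ∀ f : W → ℝ, 𝔼 x, f x = 𝔼 x, 𝔼 v, f (x + sumHom K v) := fun f => by
    rw [expect_comm]
    simp only [expect_add_right, Fintype.expect_const]
  have hshift : ∀ (f : W → ℝ) x, 𝔼 v, f (x + sumHom K v) = 𝔼 v, f (r x + sumHom K v) := by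
    intro f x
    obtain ⟨u, hu⟩ := hrsub x
    rw [← expect_add_right (fun v => f (r x + sumHom K v)) u]
    refine expect_congr rfl fun v _ => ?_
    rw [map_add, add_comm (sumHom K v), ← add_assoc, ← hu]
  have hrr : ∀ x, r (r x) = r x := fun x => by
    obtain ⟨u, hu⟩ := hrsub x
    rw [← hradd (r x) u, ← hu]
  refine ⟨fun i => {x | x - r x ∈ C (r x) i}, fun i x hx k hk => ?_, fun i => ?_, fun x hx => ?_⟩
  · have := hradd x (Pi.single i ⟨k, hk⟩)
    rw [sumHom_single] at this
    simp only at this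
    rw [Set.mem_ofPred_eq, this, add_sub_right_comm]
    exact hC _ i _ hx k hk
  · have hW : (0 : ℝ) < Nat.card W := Nat.cast_pos.2 Nat.card_pos
    have hsol := expect_indicator_eq fun x => ∀ i, x ∈ P i
    have hmem := expect_indicator_eq fun x => x - r x ∈ C (r x) i
    rw [← div_le_div_iff_of_pos_right hW, add_div, mul_div_assoc, mul_div_assoc, div_self hW.ne',
      mul_one, ← hsol, ← hmem, havg,
      havg (fun x => if ∀ i, x ∈ P i then (1 : ℝ) else 0), mul_expect,
      ← Fintype.expect_const (ι := W) ε, ← expect_add_distrib]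
    refine expect_le_expect fun x _ => ?_
    rw [hshift (fun x => if x - r x ∈ C (r x) i then 1 else 0),
      hshift (fun x => if ∀ i, x ∈ P i then 1 else 0)]
    refine le_trans (le_of_eq ?_) (hCε (r x) i)
    refine expect_congr rfl fun v _ => ?_
    rw [hradd, hrr, add_sub_cancel_left]
  · obtain ⟨v, hv⟩ := hrsub x
    rw [hv] at hx
    obtain ⟨i, hi⟩ := hcov (r x) v hx
    refine ⟨i, ?_⟩
    rw [Set.mem_ofPred_eq]
    convert hi using 1
    rw [sub_eq_iff_eq_add', ← hv]

theorem card_le_card_ker_mul_card_image {A H : Type} [AddCommGroup A] [Fintype A]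
    [AddCommGroup H] (f : A →+ H) : Nat.card A ≤ Nat.card f.ker * Nat.card (Set.range f) := by
  rw [← AddSubgroup.card_mul_index f.ker, AddSubgroup.index_ker]
  rfl

theorem card_image_mul_card_ker_le {A H : Type} [AddCommGroup A] [Fintype A] [AddCommGroup H]
    (f : A →+ H) (B : Set A) (hB : ∀ x ∈ B, ∀ k ∈ f.ker, x + k ∈ B) :
    Nat.card f.ker * Nat.card (f '' B) ≤ Nat.card B := by
  have hrep : ∀ y : f '' B, ∃ x ∈ B, f x = y := fun y => y.2
  choose g hgB hg using hrep
  rw [← Nat.card_prod]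
  refine Nat.card_le_card_of_injective
    (fun q : f.ker × f '' B => (⟨g q.2 + q.1, hB _ (hgB q.2) _ q.1.2⟩ : B)) ?_
  rintro ⟨k, y⟩ ⟨k', y'⟩ h
  have h1 : g y + k = g y' + k' := congrArg Subtype.val h
  have h2 : y = y' := by
    have := congrArg f h1
    rw [map_add, map_add, hg, hg, AddMonoidHom.mem_ker.1 k.2, AddMonoidHom.mem_ker.1 k'.2,
      add_zero, add_zero] at this
    exact Subtype.ext this
  subst h2
  rw [Prod.mk.injEq]
  exact ⟨Subtype.ext (add_left_cancel h1), rfl⟩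

end Subgroups

end HypergraphRemoval

theorem removal_lemma_for_subgroups
    (ε : ℝ) (hε : 0 < ε) (m : ℕ) (hm : 0 < m) :
    ∃ δ : ℝ, 0 < δ ∧
      ∀ (G : Fin m → Type) [∀ i, AddCommGroup (G i)] [∀ i, Fintype (G i)]
        (S : AddSubgroup (∀ i, G i)) (s : ∀ i, G i) (X : ∀ i, Set (G i)),
        (Nat.card ↥(Set.univ.pi X ∩ ((s + ·) '' (S : Set (∀ i, G i)))) : ℝ) <
            δ * Nat.card S →
          ∃ X' : ∀ i, Set (G i),
            (∀ i, X' i ⊆ X i) ∧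
            (∀ i, (Nat.card ↥(X' i) : ℝ) <
              ε * Nat.card ((fun x : ∀ j, G j => x i) '' (S : Set (∀ j, G j)))) ∧
            Set.univ.pi (fun i => X i \ X' i) ∩
              ((s + ·) '' (S : Set (∀ i, G i))) = ∅ := by
  have : Nonempty (Fin m) := ⟨⟨0, hm⟩⟩
  obtain ⟨M, hM, hcover⟩ := HypergraphRemoval.exists_invariant_cover (Fin m) (half_pos hε)
  refine ⟨ε / 2 / M, by positivity, fun G _ _ S s X hX => ?_⟩
  have := Fintype.ofFinite S
  let f : ∀ i, S →+ G i := fun i => (Pi.evalAddMonoidHom G i).comp S.subtype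
  obtain ⟨B, hB, hBε, hcov⟩ := hcover S (fun i => (f i).ker) (fun i => {x | s i + f i x ∈ X i})
    (fun i x hx k hk => by
      rw [Set.mem_ofPred_eq, map_add, AddMonoidHom.mem_ker.1 hk, add_zero]
      exact hx)
  have hsol : (Nat.card {x : S | ∀ i, x ∈ {x | s i + f i x ∈ X i}} : ℝ) <
      ε / 2 / M * Nat.card S := by
    refine lt_of_le_of_lt (Nat.cast_le.2 ?_) hX
    refine Nat.card_le_card_of_injective
      (fun x => ⟨s + (x.1 : ∀ i, G i), fun i _ => x.2 i, x.1, x.1.2, rfl⟩) fun x y h => ?_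
    exact Subtype.ext (Subtype.ext (add_left_cancel (congrArg Subtype.val h)))
  have hBS : ∀ i, (Nat.card (B i) : ℝ) < ε * Nat.card S := fun i => by
    have h1 := mul_lt_mul_of_pos_left hsol hM
    rw [← mul_assoc, mul_div_cancel₀ _ hM.ne'] at h1
    linarith [hBε i]
  refine ⟨fun i => X i ∩ (s i + ·) '' (f i '' B i), fun i => Set.inter_subset_left, fun i => ?_, ?_⟩
  · have h1 : Nat.card ↥(X i ∩ (s i + ·) '' (f i '' B i)) ≤ Nat.card (f i '' B i) :=
      (Nat.card_mono (Set.toFinite _) Set.inter_subset_right).trans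
        (Nat.card_image_le (Set.toFinite _))
    have h2 := HypergraphRemoval.card_image_mul_card_ker_le (f i) (B i) (hB i)
    have h3 := HypergraphRemoval.card_le_card_ker_mul_card_image (f i)
    have h4 : Set.range (f i) = (fun x : ∀ j, G j => x i) '' (S : Set (∀ j, G j)) := by
      ext y
      simp [f]
    rw [h4] at h3
    have hk : (0 : ℝ) < Nat.card (f i).ker := Nat.cast_pos.2 Nat.card_pos
    refine lt_of_le_of_lt (Nat.cast_le.2 h1) (lt_of_mul_lt_mul_left ?_ hk.le)
    calc (Nat.card (f i).ker : ℝ) * Nat.card (f i '' B i) ≤ Nat.card (B i) := by exact_mod_cast h2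
      _ < ε * Nat.card S := hBS i
      _ ≤ ε * (Nat.card (f i).ker *
          Nat.card ((fun x : ∀ j, G j => x i) '' (S : Set (∀ j, G j)))) := by
        gcongr
        exact_mod_cast h3
      _ = _ := by ring
  · rw [Set.eq_empty_iff_forall_notMem]
    rintro _ ⟨hx, x, hxS, rfl⟩
    obtain ⟨i, hi⟩ := hcov ⟨x, hxS⟩ fun i => (hx i trivial).1
    exact (hx i trivial).2 ⟨(hx i trivial).1, _, ⟨_, hi, rfl⟩, rfl⟩
end

section
/- For every ε > 0 and every positive integer m there exists δ = δ(ε, m+1) > 0 such that for every finite abelian group G and every subset S ⊆ G^m with |S| ≥ ε|G^m|, the number of tuples (x_1,...,x_m, a) ∈ G^m × G such that all of the m+1 points (x_1,...,x_m), (x_1+a, x_2,...,x_m), (x_1, x_2+a, x_3,...,x_m), ..., (x_1,...,x_{m-1}, x_m+a) lie in S is at least δ|G|^{m+1}. -/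
open Combinatorics

/-! ### Averages and indicators -/

/-- The indicator of a proposition, as a real number. -/
noncomputable def ind (P : Prop) : ℝ := by
  classical exact if P then 1 else 0

lemma ind_of {P : Prop} (h : P) : ind P = 1 := by simp [ind, h]

lemma ind_of_not {P : Prop} (h : ¬ P) : ind P = 0 := by simp [ind, h]

lemma ind_nonneg (P : Prop) : 0 ≤ ind P := by
  by_cases h : P <;> simp [ind, h]

lemma ind_le_one (P : Prop) : ind P ≤ 1 := by
  by_cases h : P <;> simp [ind, h]

lemma ind_mono {P Q : Prop} (h : P → Q) : ind P ≤ ind Q := by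
  by_cases hP : P
  · rw [ind_of hP, ind_of (h hP)]
  · rw [ind_of_not hP]
    exact ind_nonneg Q

lemma mul_ind_le {a b : ℝ} (hb : 0 ≤ b) (h : a ≤ b) (P : Prop) : a * ind P ≤ b := by
  by_cases hP : P
  · rwa [ind_of hP, mul_one]
  · rwa [ind_of_not hP, mul_zero]

/-- The uniform average of a real function on a finite type. -/
noncomputable def avg {X : Type*} [Finite X] (f : X → ℝ) : ℝ :=
  letI := Fintype.ofFinite X
  (∑ x, f x) / Nat.card X

section avg

variable {X Y Z : Type*} [Finite X] [Finite Y] [Finite Z]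

lemma avg_eq_sum [Fintype X] (f : X → ℝ) : avg f = (∑ x, f x) / Nat.card X := by
  unfold avg
  congr!

lemma avg_ind (S : Set X) : avg (fun x => ind (x ∈ S)) = Nat.card S / Nat.card X := by
  classical
  have := Fintype.ofFinite X
  rw [avg_eq_sum]
  congr 1
  simp only [ind, Finset.sum_boole, Nat.card_eq_fintype_card, Fintype.card_subtype]

lemma avg_add (f g : X → ℝ) : avg (fun x => f x + g x) = avg f + avg g := by
  have := Fintype.ofFinite X
  simp only [avg_eq_sum, Finset.sum_add_distrib, add_div]

lemma avg_sub (f g : X → ℝ) : avg (fun x => f x - g x) = avg f - avg g := by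
  have := Fintype.ofFinite X
  simp only [avg_eq_sum, Finset.sum_sub_distrib, sub_div]

lemma avg_const_mul (c : ℝ) (f : X → ℝ) : avg (fun x => c * f x) = c * avg f := by
  have := Fintype.ofFinite X
  simp only [avg_eq_sum, ← Finset.mul_sum, mul_div_assoc]

lemma avg_const [Nonempty X] (c : ℝ) : avg (fun _ : X => c) = c := by
  have := Fintype.ofFinite X
  rw [avg_eq_sum, Finset.sum_const, Finset.card_univ, nsmul_eq_mul, Nat.card_eq_fintype_card]
  field_simp

lemma avg_sum {I : Type*} (s : Finset I) (f : I → X → ℝ) :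
    avg (fun x => ∑ i ∈ s, f i x) = ∑ i ∈ s, avg (f i) := by
  have := Fintype.ofFinite X
  simp only [avg_eq_sum, ← Finset.sum_div]
  rw [Finset.sum_comm]

lemma avg_mono {f g : X → ℝ} (h : ∀ x, f x ≤ g x) : avg f ≤ avg g := by
  have := Fintype.ofFinite X
  simp only [avg_eq_sum]
  gcongr with x
  exact h x

lemma avg_le [Nonempty X] {f : X → ℝ} {c : ℝ} (h : ∀ x, f x ≤ c) : avg f ≤ c :=
  (avg_mono h).trans_eq (avg_const c)

lemma le_avg [Nonempty X] {f : X → ℝ} {c : ℝ} (h : ∀ x, c ≤ f x) : c ≤ avg f :=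
  (avg_const c).symm.trans_le (avg_mono h)

lemma avg_nonneg {f : X → ℝ} (h : ∀ x, 0 ≤ f x) : 0 ≤ avg f := by
  have := Fintype.ofFinite X
  rw [avg_eq_sum]
  exact div_nonneg (Finset.sum_nonneg fun x _ => h x) (Nat.cast_nonneg _)

lemma avg_comm (f : X → Y → ℝ) :
    avg (fun x => avg (fun y => f x y)) = avg (fun y => avg (fun x => f x y)) := by
  have := Fintype.ofFinite X
  have := Fintype.ofFinite Y
  simp only [avg_eq_sum, ← Finset.sum_div]
  rw [Finset.sum_comm, div_right_comm]

lemma avg_equiv (e : X ≃ Y) (f : Y → ℝ) : avg (fun x => f (e x)) = avg f := by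
  have := Fintype.ofFinite X
  have := Fintype.ofFinite Y
  simp only [avg_eq_sum, Nat.card_congr e, e.sum_comp]

lemma avg_prod (f : X × Y → ℝ) : avg f = avg (fun x => avg (fun y => f (x, y))) := by
  have := Fintype.ofFinite X
  have := Fintype.ofFinite Y
  simp only [avg_eq_sum, ← Finset.sum_div, Fintype.sum_prod_type, Nat.card_prod, Nat.cast_mul,
    div_div]
  rw [mul_comm]

lemma avg_mul_ind_mem_range {g : X → Y} (hg : g.Injective) (f : Y → ℝ) :
    avg (fun y => f y * ind (y ∈ Set.range g)) =
      avg (fun x => f (g x)) * (Nat.card X / Nat.card Y) := by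
  classical
  have := Fintype.ofFinite X
  have := Fintype.ofFinite Y
  rcases isEmpty_or_nonempty X with hX | hX
  · simp [avg_eq_sum, ind]
  have h0 : (Nat.card X : ℝ) ≠ 0 := by
    simp [Nat.card_eq_fintype_card]
  rw [avg_eq_sum, avg_eq_sum, div_mul_div_cancel₀ h0]
  congr 1
  rw [← Finset.sum_image (f := f) (g := g) (s := Finset.univ) hg.injOn]
  simp only [ind, mul_ite, mul_one, mul_zero, ← Finset.sum_filter]
  congr 1
  ext y
  simp

/-- If the fibres of a relation are dense on average, and every dense set contains one of finitely
many configurations, then some configuration lies in many fibres. -/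
lemma exists_config_of_avg {L : Type*} [Fintype L] [Nonempty X] [Nonempty Y]
    (R : X → Y → Prop) (c : L → X → Prop) {ε : ℝ} (hε : 0 < ε)
    (hR : ε ≤ avg (fun y => avg (fun x => ind (R x y))))
    (h : ∀ S : Set X, ε / 2 ≤ avg (fun x => ind (x ∈ S)) → ∃ l, ∀ x, c l x → x ∈ S) :
    ∃ l, ε / 2 / (Nat.card L + 1) ≤ avg (fun y => ind (∀ x, c l x → R x y)) := by
  by_contra! hcon
  have key : ∀ y, avg (fun x => ind (R x y)) ≤ ε / 2 + ∑ l, ind (∀ x, c l x → R x y) := by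
    intro y
    have hnn : 0 ≤ ∑ l, ind (∀ x, c l x → R x y) := Finset.sum_nonneg fun l _ => ind_nonneg _
    by_cases hd : ε / 2 ≤ avg (fun x => ind (R x y))
    · obtain ⟨l, hl⟩ := h {x | R x y} hd
      have h1 : ind (∀ x, c l x → R x y) ≤ ∑ l, ind (∀ x, c l x → R x y) :=
        Finset.single_le_sum (f := fun l => ind (∀ x, c l x → R x y))
          (fun l _ => ind_nonneg _) (Finset.mem_univ l)
      rw [ind_of (show ∀ x, c l x → R x y from hl)] at h1
      have h2 : avg (fun x => ind (R x y)) ≤ 1 := avg_le fun x => ind_le_one _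
      linarith
    · linarith
  have h1 := avg_mono key
  rw [avg_add, avg_const, avg_sum] at h1
  have h2 : ∑ l, avg (fun y => ind (∀ x, c l x → R x y)) ≤
      ∑ _l : L, ε / 2 / (Nat.card L + 1) := Finset.sum_le_sum fun l _ => (hcon l).le
  rw [Finset.sum_const, Finset.card_univ, nsmul_eq_mul, ← Nat.card_eq_fintype_card] at h2
  have h3 : (Nat.card L : ℝ) * (ε / 2 / (Nat.card L + 1)) < ε / 2 := by
    have : (0 : ℝ) ≤ Nat.card L := Nat.cast_nonneg _
    rw [mul_div_assoc', div_lt_iff₀ (by positivity)]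
    nlinarith
  linarith

end avg

/-! ### Combinatorial subspaces -/

namespace Combinatorics.Subspace

variable {α ι κ η ζ : Type*}

/-- The composition of two combinatorial subspaces. -/
def comp (l : Subspace η α ι) (m : Subspace ζ α η) : Subspace ζ α ι where
  idxFun i := (l.idxFun i).elim Sum.inl m.idxFun
  proper e := by
    obtain ⟨j, hj⟩ := m.proper e
    obtain ⟨i, hi⟩ := l.proper j
    exact ⟨i, by simp [hi, hj]⟩

@[simp] lemma comp_apply (l : Subspace η α ι) (m : Subspace ζ α η) (x : ζ → α) :
    l.comp m x = l (m x) := by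
  ext i
  cases h : l.idxFun i <;> simp [comp, coe_apply, h]

/-- A bijection of coordinates as a combinatorial subspace. -/
def ofEquiv (α : Type*) (e : ι ≃ η) : Subspace η α ι where
  idxFun i := Sum.inr (e i)
  proper j := ⟨e.symm j, by simp⟩

@[simp] lemma ofEquiv_apply (e : ι ≃ η) (x : η → α) : ofEquiv α e x = fun i => x (e i) := rfl

/-- The subspace over a larger alphabet with the same constant letters and wildcards. -/
def toOption (l : Subspace η α ι) : Subspace η (Option α) ι where
  idxFun i := (l.idxFun i).map some id
  proper e := by
    obtain ⟨i, hi⟩ := l.proper e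
    exact ⟨i, by simp [hi]⟩

lemma toOption_some (l : Subspace η α ι) (x : η → α) :
    l.toOption (fun j => some (x j)) = fun i => some (l x i) := by
  ext i : 1
  cases h : l.idxFun i <;> simp [toOption, coe_apply, h]

lemma toOption_getD (l : Subspace η α ι) (x : η → Option α) (a : α) :
    (fun i => (l.toOption x i).getD a) = l (fun j => (x j).getD a) := by
  ext i : 1
  cases h : l.idxFun i <;> simp [toOption, coe_apply, h]

lemma exists_toOption_eq_none (l : Subspace η α ι) {x : η → Option α} (hx : ∃ j, x j = none) :
    ∃ i, l.toOption x i = none := by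
  obtain ⟨j, hj⟩ := hx
  obtain ⟨i, hi⟩ := l.proper j
  exact ⟨i, by simp [toOption, coe_apply, hi, hj]⟩

lemma injective (l : Subspace η α ι) : Function.Injective (l : (η → α) → ι → α) := by
  intro x y h
  ext e
  obtain ⟨i, hi⟩ := l.proper e
  simpa [coe_apply, hi] using congrFun h i

/-- Fixing the second group of coordinates and varying the first one in a subspace. -/
def inLeft (l : Subspace η α ι) (y : κ → α) : Subspace η α (ι ⊕ κ) where
  idxFun := Sum.elim l.idxFun fun k => Sum.inl (y k)
  proper e := by
    obtain ⟨i, hi⟩ := l.proper e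
    exact ⟨Sum.inl i, hi⟩

@[simp] lemma inLeft_apply (l : Subspace η α ι) (y : κ → α) (x : η → α) :
    l.inLeft y x = Sum.elim (l x) y := by
  ext (i | i) <;> rfl

/-- Fixing the first group of coordinates and varying the second one in a subspace. -/
def inRight (y : κ → α) (l : Subspace η α ι) : Subspace η α (κ ⊕ ι) where
  idxFun := Sum.elim (fun k => Sum.inl (y k)) l.idxFun
  proper e := by
    obtain ⟨i, hi⟩ := l.proper e
    exact ⟨Sum.inr i, hi⟩

@[simp] lemma inRight_apply (y : κ → α) (l : Subspace η α ι) (x : η → α) :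
    inRight y l x = Sum.elim y (l x) := by
  ext (i | i) <;> rfl

/-- The subspace obtained from a map sending each coordinate to a wildcard or to `none`,
where the coordinates without a wildcard are given the letter `a`. -/
def ofOption (a : α) (g : ι → Option η) (hg : ∀ e, ∃ i, g i = some e) : Subspace η α ι where
  idxFun i := (g i).elim (Sum.inl a) Sum.inr
  proper e := by
    obtain ⟨i, hi⟩ := hg e
    exact ⟨i, by simp [hi]⟩

/-- Combine a subspace on the first group of coordinates with a line on the second one. -/
def sumLine (p : Subspace η α ι) (l : Line α κ) : Subspace (Option η) α (ι ⊕ κ) where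
  idxFun := Sum.elim (fun i => (p.idxFun i).map id some)
    fun k => (l.idxFun k).elim (Sum.inr none) Sum.inl
  proper e := by
    cases e with
    | none =>
      obtain ⟨k, hk⟩ := l.proper
      exact ⟨Sum.inr k, by simp [hk]⟩
    | some e =>
      obtain ⟨i, hi⟩ := p.proper e
      exact ⟨Sum.inl i, by simp [hi]⟩

lemma sumLine_apply (p : Subspace η α ι) (l : Line α κ) (x : Option η → α) :
    p.sumLine l x = Sum.elim (p fun e => x (some e)) (l (x none)) := by
  ext (i | k)
  · cases h : p.idxFun i <;> simp [sumLine, coe_apply, h]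
  · cases h : l.idxFun k <;> simp [sumLine, coe_apply, h]

lemma toOption_sumLine_apply (p : Subspace η α ι) (l : Line α κ) (x : Option η → Option α) :
    (p.sumLine l).toOption x =
      Sum.elim (p.toOption fun e => x (some e)) (fun k => (l.idxFun k).elim (x none) some) := by
  ext (i | k) : 1
  · cases h : p.idxFun i <;> simp [sumLine, toOption, coe_apply, h]
  · cases h : l.idxFun k <;> simp [sumLine, toOption, coe_apply, h]

end Combinatorics.Subspace

/-! ### A Graham–Rothschild theorem for variable words -/

/-- Every colouring of words over `Option A` depends, on a suitable `A`-subspace, only on the set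
of coordinates equal to `none`. -/
lemma exists_subspace_color_eq_of_none_iff (A : Type) [Finite A] (η : Type) [Finite η] :
    ∀ (K : Type) [Finite K], ∃ (ι : Type) (_ : Finite ι), ∀ c : (ι → Option A) → K,
      ∃ p : Subspace η A ι, ∀ x y : η → Option A, (∀ j, x j = none ↔ y j = none) →
        c (p.toOption x) = c (p.toOption y) := by
  induction η using Finite.induction_empty_option with
  | of_equiv e ih =>
    intro K _
    obtain ⟨ι, hι, h⟩ := ih K
    refine ⟨ι, hι, fun c => ?_⟩
    obtain ⟨p, hp⟩ := h c
    refine ⟨p.reindex e (Equiv.refl _) (Equiv.refl _), fun x y hxy => ?_⟩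
    have key : ∀ x, (p.reindex e (Equiv.refl _) (Equiv.refl _)).toOption x =
        p.toOption (fun j => x (e j)) := by
      intro x
      ext i : 1
      cases h : p.idxFun i <;>
        simp [Subspace.toOption, Subspace.coe_apply, Subspace.reindex, h]
    rw [key, key]
    exact hp _ _ fun j => hxy _
  | h_empty =>
    intro K _
    refine ⟨Empty, inferInstance, fun c => ⟨⟨Empty.elim, nofun⟩, fun x y _ => ?_⟩⟩
    rw [Subsingleton.elim x y]
  | h_option ih =>
    intro K _
    obtain ⟨ι₁, _, h₁⟩ := ih (Option A → K)
    obtain ⟨ι₂, _, h₂⟩ := Line.exists_mono_in_high_dimension A ((ι₁ → Option A) → K)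
    refine ⟨ι₁ ⊕ ι₂, inferInstance, fun c => ?_⟩
    obtain ⟨l, col, hl⟩ := h₂ fun u w => c (Sum.elim w fun k => some (u k))
    obtain ⟨p, hp⟩ := h₁ fun w b => c (Sum.elim w fun k => (l.idxFun k).elim b some)
    refine ⟨p.sumLine l, fun x y hxy => ?_⟩
    rw [Subspace.toOption_sumLine_apply, Subspace.toOption_sumLine_apply]
    have h1 := congrFun (hp (fun e => x (some e)) (fun e => y (some e)) fun j => hxy _) (x none)
    refine h1.trans ?_
    cases hx : x none with
    | none => rw [(hxy none).1 hx]
    | some a =>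
      cases hy : y none with
      | none => simp [(hxy none).2 hy] at hx
      | some b =>
        have h3 : ∀ a, (fun k => (l.idxFun k).elim (some a) some) = fun k => some (l a k) := by
          intro a
          ext k : 1
          cases h : l.idxFun k <;> simp [h]
        rw [h3, h3]
        exact congrFun ((hl a).trans (hl b).symm) _

/-- In a coloured discrete cube of large dimension there are disjoint nonempty blocks such that the
colour of a nonempty union of blocks depends only on the last block. -/
lemma exists_blocks_color_eq_of_last (K : Type) [Finite K] (m : ℕ) :
    ∃ (ι : Type) (_ : Finite ι), ∀ c : (ι → Bool) → K,
      ∃ (g : ι → Option (Fin m)) (t : Fin m → K), (∀ e, ∃ i, g i = some e) ∧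
        ∀ (x : Fin m → Bool) (j : Fin m), x j = true → (∀ j', j < j' → x j' = false) →
          c (fun i => (g i).elim false x) = t j := by
  induction m with
  | zero => exact ⟨Empty, inferInstance, fun c => ⟨nofun, nofun, nofun, nofun⟩⟩
  | succ m ih =>
    obtain ⟨ι, _, h₁⟩ := ih
    obtain ⟨κ, _, h₂⟩ := Subspace.exists_mono_in_high_dimension Bool K ι
    refine ⟨Option κ, inferInstance, fun c => ?_⟩
    obtain ⟨q, col, hq⟩ := h₂ fun u => c fun i => i.elim true u
    -- The words in which the last block is switched on or off.
    let w : Bool → (ι → Bool) → Option κ → Bool := fun b y i =>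
      i.elim b fun k => (q.idxFun k).elim (fun a => a && b) y
    obtain ⟨g, t, hg, hgt⟩ := h₁ fun y => c (w false y)
    let G : Option κ → Option (Fin (m + 1)) := fun i =>
      i.elim (some (Fin.last m)) fun k => (q.idxFun k).elim
        (fun a => if a then some (Fin.last m) else none) fun j => (g j).map Fin.castSucc
    have hG : ∀ x : Fin (m + 1) → Bool, (fun i => (G i).elim false x) =
        w (x (Fin.last m)) (fun j => (g j).elim false fun e => x e.castSucc) := by
      intro x
      ext (_ | k) : 1
      · rfl
      · rcases h : q.idxFun k with (_ | _) | j
        · simp [G, w, h]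
        · simp [G, w, h]
        · cases h' : g j <;> simp [G, w, h, h']
    refine ⟨G, Fin.lastCases col t, fun e => ?_, fun x j => ?_⟩
    · induction e using Fin.lastCases with
      | last => exact ⟨none, rfl⟩
      | cast e =>
        obtain ⟨j, hj⟩ := hg e
        obtain ⟨k, hk⟩ := q.proper j
        exact ⟨some k, by simp [G, hk, hj]⟩
    · intro hj hlt
      rw [hG]
      beta_reduce
      induction j using Fin.lastCases with
      | last =>
        rw [hj, Fin.lastCases_last, ← hq fun j => (g j).elim false fun e => x e.castSucc]
        congr 1
        ext (_ | k) : 1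
        · rfl
        · cases h : q.idxFun k <;> simp [w, h, Subspace.coe_apply]
      | cast j =>
        rw [hlt _ (Fin.castSucc_lt_last j), Fin.lastCases_castSucc]
        exact hgt _ j hj fun j' hj' => hlt _ (Fin.castSucc_lt_castSucc_iff.2 hj')

/-- The finite unions theorem. -/
lemma exists_blocks_mono (K : Type) [Finite K] (m : ℕ) :
    ∃ (ι : Type) (_ : Finite ι), ∀ c : (ι → Bool) → K,
      ∃ (g : ι → Option (Fin m)) (t : K), (∀ e, ∃ i, g i = some e) ∧
        ∀ x : Fin m → Bool, (∃ j, x j = true) → c (fun i => (g i).elim false x) = t := by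
  classical
  have := Fintype.ofFinite K
  obtain ⟨ι, hι, h⟩ := exists_blocks_color_eq_of_last K (Fintype.card K * m + 1)
  refine ⟨ι, hι, fun c => ?_⟩
  obtain ⟨g, t, hg, hgt⟩ := h c
  have : Nonempty K := ⟨t 0⟩
  obtain ⟨k, hk⟩ := Fintype.exists_le_card_fiber_of_mul_le_card (n := m) t (by simp)
  obtain ⟨s, hs, hcard⟩ := Finset.exists_subset_card_eq hk
  let e := s.equivFinOfCardEq hcard
  let r : Fin (Fintype.card K * m + 1) → Option (Fin m) := fun j =>
    if hj : j ∈ s then some (e ⟨j, hj⟩) else none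
  have hr : ∀ j, r (e.symm j) = some j := by
    intro j
    simp [r]
  refine ⟨fun i => (g i).bind r, k, fun j => ?_, fun x hx => ?_⟩
  · obtain ⟨i, hi⟩ := hg (e.symm j)
    exact ⟨i, by simp only [hi, Option.bind_some, hr]⟩
  · have hc : (fun i => ((g i).bind r).elim false x) =
        fun i => (g i).elim false fun j => (r j).elim false x := by
      ext i : 1
      cases h : g i <;> simp
    rw [hc]
    let S : Finset (Fin (Fintype.card K * m + 1)) :=
      Finset.univ.filter fun j => (r j).elim false x = true
    have hS : S.Nonempty := by
      obtain ⟨j, hj⟩ := hx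
      exact ⟨e.symm j, by simp [S, hr, hj]⟩
    have hmem := S.max'_mem hS
    have hmax : (r (S.max' hS)).elim false x = true := (Finset.mem_filter.1 hmem).2
    rw [hgt _ (S.max' hS) hmax]
    · have : S.max' hS ∈ s := by
        by_contra hn
        simp [r, hn] at hmax
      exact (Finset.mem_filter.1 (hs this)).2
    · intro j' hj'
      by_contra hn
      have : j' ∈ S := by
        simp only [S, Finset.mem_filter, Finset.mem_univ, true_and]
        simpa using hn
      exact absurd (S.le_max' j' this) (not_le.2 hj')

/-- The **Graham–Rothschild theorem** for variable words: every finite colouring of the words over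
`Option A` is constant on the words of a suitable `A`-subspace that contain the letter `none`. -/
lemma exists_subspace_mono_of_exists_none (A : Type) [Finite A] [Nonempty A] (K : Type) [Finite K]
    (m : ℕ) : ∃ (ι : Type) (_ : Finite ι), ∀ c : (ι → Option A) → K,
      ∃ (p : Subspace (Fin m) A ι) (t : K), ∀ x : Fin m → Option A, (∃ j, x j = none) →
        c (p.toOption x) = t := by
  obtain ⟨η, _, h₂⟩ := exists_blocks_mono K m
  obtain ⟨ι, hι, h₁⟩ := exists_subspace_color_eq_of_none_iff A η K
  refine ⟨ι, hι, fun c => ?_⟩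
  let a₀ : A := Classical.arbitrary A
  obtain ⟨p, hp⟩ := h₁ c
  obtain ⟨g, t, hg, hgt⟩ := h₂ fun s => c (p.toOption fun j => if s j then none else some a₀)
  refine ⟨p.comp (Subspace.ofOption a₀ g hg), t, fun x hx => ?_⟩
  rw [← hgt (fun j => (x j).isNone) (by simpa using hx)]
  have h1 : ∀ x, (p.comp (Subspace.ofOption a₀ g hg)).toOption x =
      p.toOption ((Subspace.ofOption a₀ g hg).toOption x) := by
    intro x
    ext i : 1
    cases h : p.idxFun i <;> simp [Subspace.toOption, Subspace.coe_apply, Subspace.comp, h]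
  rw [h1]
  apply hp
  intro j
  cases h : g j <;> simp [Subspace.toOption, Subspace.coe_apply, Subspace.ofOption, h]

/-! ### Density Hales–Jewett and its multidimensional version -/

/-- The density Hales–Jewett property of an alphabet. -/
def DensityHJ (A : Type) [Finite A] : Prop :=
  ∀ ε : ℝ, 0 < ε → ∃ N : ℕ, ∀ (ι : Type) [Finite ι], N ≤ Nat.card ι → ∀ S : Set (ι → A),
    ε ≤ avg (fun x => ind (x ∈ S)) → ∃ l : Line A ι, ∀ a, l a ∈ S

instance {A ι : Type*} [Finite A] [Finite ι] : Finite (Line A ι) :=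
  Finite.of_injective Line.idxFun fun _ _ => Line.ext

lemma avg_arrow_sum {B ι κ : Type*} [Finite B] [Finite ι] [Finite κ] (f : (ι ⊕ κ → B) → ℝ) :
    avg f = avg (fun x => avg (fun y => f (Sum.elim x y))) := by
  rw [← avg_equiv (Equiv.sumArrowEquivProdArrow ι κ B).symm f, avg_prod]
  rfl

lemma avg_arrow_equiv {B ι κ : Type*} [Finite B] [Finite ι] [Finite κ] (e : ι ≃ κ)
    (f : (ι → B) → ℝ) : avg f = avg (fun x : κ → B => f (fun i => x (e i))) :=
  (avg_equiv (e.arrowCongr (Equiv.refl B)).symm f).symm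

lemma nonempty_equiv_sum {ι : Type*} [Finite ι] {m n : ℕ} (h : m + n ≤ Nat.card ι) :
    ∃ r, n ≤ r ∧ Nonempty (ι ≃ Fin m ⊕ Fin r) := by
  refine ⟨Nat.card ι - m, by omega, ⟨Finite.equivFinOfCardEq ?_ |>.trans finSumFinEquiv.symm⟩⟩
  omega

lemma DensityHJ.exists_subspace {A : Type} [Finite A] [Nonempty A] (hA : DensityHJ A) (η : Type)
    [Finite η] : ∀ ε : ℝ, 0 < ε → ∃ N : ℕ, ∀ (ι : Type) [Finite ι], N ≤ Nat.card ι →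
      ∀ S : Set (ι → A), ε ≤ avg (fun x => ind (x ∈ S)) →
        ∃ p : Subspace η A ι, ∀ x, p x ∈ S := by
  induction η using Finite.induction_empty_option with
  | of_equiv e ih =>
    intro ε hε
    obtain ⟨N, hN⟩ := ih ε hε
    refine ⟨N, fun ι _ hι S hS => ?_⟩
    obtain ⟨p, hp⟩ := hN ι hι S hS
    exact ⟨p.comp (Subspace.ofEquiv A e), fun x => by simpa using hp _⟩
  | h_empty =>
    intro ε hε
    refine ⟨0, fun ι _ _ S hS => ?_⟩
    have : S.Nonempty := by
      by_contra hn
      rw [Set.not_nonempty_iff_eq_empty] at hn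
      simp only [hn, Set.mem_empty_iff_false, ind_of_not not_false, avg_const] at hS
      linarith
    obtain ⟨x, hx⟩ := this
    exact ⟨⟨fun i => Sum.inl (x i), nofun⟩, fun y => hx⟩
  | h_option ih =>
    intro ε hε
    obtain ⟨N₁, h₁⟩ := hA (ε / 2) (half_pos hε)
    have := Fintype.ofFinite (Line A (Fin N₁))
    obtain ⟨N₂, h₂⟩ := ih (ε / 2 / (Nat.card (Line A (Fin N₁)) + 1)) (by positivity)
    refine ⟨N₁ + N₂, fun ι _ hι S hS => ?_⟩
    obtain ⟨r, hr, ⟨e⟩⟩ := nonempty_equiv_sum hι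
    let e' := e.trans (Equiv.sumComm _ _)
    obtain ⟨l, hl⟩ := exists_config_of_avg
      (fun (x : Fin N₁ → A) (y : Fin r → A) => (fun i => Sum.elim y x (e' i)) ∈ S)
      (fun (l : Line A (Fin N₁)) x => ∃ a, l a = x) hε
      (by rwa [avg_arrow_equiv e', avg_arrow_sum] at hS)
      (fun T hT => by
        obtain ⟨l, hl⟩ := h₁ (Fin N₁) (by simp) T hT
        exact ⟨l, by rintro _ ⟨a, rfl⟩; exact hl a⟩)
    obtain ⟨p, hp⟩ := h₂ (Fin r) (by simpa using hr)
      {y | ∀ x, (∃ a, l a = x) → (fun i => Sum.elim y x (e' i)) ∈ S} hl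
    refine ⟨(Subspace.ofEquiv A e').comp (p.sumLine l), fun x => ?_⟩
    rw [Subspace.comp_apply, Subspace.ofEquiv_apply, Subspace.sumLine_apply]
    exact hp _ _ ⟨_, rfl⟩

lemma avg_prod_apply {B ι : Type*} [Finite B] [Fintype ι] (f : B → ℝ) :
    avg (fun x : ι → B => ∏ i, f (x i)) = avg f ^ Nat.card ι := by
  classical
  have := Fintype.ofFinite B
  rw [avg_eq_sum, avg_eq_sum, div_pow, Nat.card_fun, Nat.cast_pow]
  congr 1
  rw [Nat.card_eq_fintype_card, ← Finset.card_univ, ← Finset.prod_const, Finset.prod_univ_sum,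
    Fintype.piFinset_univ]

lemma avg_option {A : Type*} [Finite A] (f : Option A → ℝ) (c : ℝ) (h : ∀ a, f (some a) = c) :
    avg f = (f none + Nat.card A * c) / (Nat.card A + 1) := by
  have := Fintype.ofFinite A
  rw [avg_eq_sum, Fintype.sum_option]
  simp [h]

/-- In large dimension, most words over `Option A` have many letters different from `none`. -/
lemma exists_avg_card_lt_le {A : Type} [Finite A] [Nonempty A] (n : ℕ) {β : ℝ} (hβ : 0 < β) :
    ∃ N : ℕ, ∀ (ι : Type) [Finite ι], N ≤ Nat.card ι →
      avg (fun x : ι → Option A => ind (Nat.card {i // x i ≠ none} < n)) ≤ β := by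
  classical
  let f : Option A → ℝ := fun b => if b ≠ none then 1 / 2 else 1
  have hk : (0 : ℝ) < Nat.card A := by exact_mod_cast Nat.card_pos
  have hf : avg f = (1 + Nat.card A * (1 / 2)) / (Nat.card A + 1) :=
    avg_option f (1 / 2) (by simp [f])
  have hf0 : 0 ≤ avg f := by rw [hf]; positivity
  have hf1 : avg f < 1 := by
    rw [hf, div_lt_one (by positivity)]
    linarith
  obtain ⟨N, hN⟩ := exists_pow_lt_of_lt_one (show 0 < β / 2 ^ n by positivity) hf1
  refine ⟨N, fun ι _ hι => ?_⟩
  have := Fintype.ofFinite ι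
  have key : ∀ x : ι → Option A,
      ind (Nat.card {i // x i ≠ none} < n) ≤ 2 ^ n * ∏ i, f (x i) := by
    intro x
    have h1 : ∏ i, f (x i) = (1 / 2) ^ Nat.card {i // x i ≠ none} := by
      simp only [f]
      rw [Finset.prod_ite, Finset.prod_const, Finset.prod_const_one, mul_one,
        Nat.card_eq_fintype_card, Fintype.card_subtype]
    rw [h1]
    by_cases h : Nat.card {i // x i ≠ none} < n
    · rw [ind_of h, one_div, inv_pow, ← div_eq_mul_inv, one_le_div (by positivity)]
      exact pow_le_pow_right₀ (by norm_num) h.le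
    · rw [ind_of_not h]
      positivity
  calc _ ≤ avg (fun x : ι → Option A => 2 ^ n * ∏ i, f (x i)) := avg_mono key
    _ = 2 ^ n * avg f ^ Nat.card ι := by rw [avg_const_mul, avg_prod_apply]
    _ ≤ 2 ^ n * (β / 2 ^ n) := by
      gcongr
      exact (pow_le_pow_of_le_one hf0 hf1.le hι).trans hN.le
    _ = β := by field_simp

/-- In large dimension, most words over `Option A` use the letter `none`. -/
lemma exists_avg_forall_ne_none_le {A : Type} [Finite A] {β : ℝ} (hβ : 0 < β) :
    ∃ N : ℕ, ∀ (ι : Type) [Finite ι], N ≤ Nat.card ι →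
      avg (fun x : ι → Option A => ind (∀ i, x i ≠ none)) ≤ β := by
  have hf : avg (fun b : Option A => ind (b ≠ none)) =
      (0 + Nat.card A * 1) / (Nat.card A + 1) := by
    rw [avg_option _ 1 fun a => ind_of (by simp), ind_of_not (by simp)]
  have hf1 : avg (fun b : Option A => ind (b ≠ none)) < 1 := by
    rw [hf, div_lt_one (by positivity)]
    linarith
  have hf0 : 0 ≤ avg (fun b : Option A => ind (b ≠ none)) := avg_nonneg fun b => ind_nonneg _
  obtain ⟨N, hN⟩ := exists_pow_lt_of_lt_one hβ hf1
  refine ⟨N, fun ι _ hι => ?_⟩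
  have := Fintype.ofFinite ι
  calc _ ≤ avg (fun x : ι → Option A => ∏ i, ind (x i ≠ none)) := by
        refine avg_mono fun x => ?_
        by_cases h : ∀ i, x i ≠ none
        · rw [ind_of h, Finset.prod_eq_one fun i _ => ind_of (h i)]
        · rw [ind_of_not h]
          exact Finset.prod_nonneg fun i _ => ind_nonneg _
    _ = avg (fun b : Option A => ind (b ≠ none)) ^ Nat.card ι :=
      avg_prod_apply fun b => ind (b ≠ none)
    _ ≤ β := (pow_le_pow_of_le_one hf0 hf1.le hι).trans hN.le

/-- Resampling the letters different from `none` does not change averages. -/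
lemma avg_resample {A ι : Type*} [Finite A] [Nonempty A] [Finite ι]
    (f : (ι → Option A) → ℝ) :
    avg f = avg (fun x : ι → Option A => avg (fun u : ι → A =>
      f (fun i => (x i).map fun _ => u i))) := by
  let e : (ι → Option A) × (ι → A) → (ι → Option A) × (ι → A) := fun z =>
    (fun i => (z.1 i).map fun _ => z.2 i, fun i => (z.1 i).getD (z.2 i))
  have he : Function.Involutive e := by
    rintro ⟨x, u⟩
    refine Prod.ext (funext fun i => ?_) (funext fun i => ?_) <;> cases h : x i <;> simp [e, h]
  have h1 := avg_equiv he.toPerm fun z => f z.1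
  rw [avg_prod, avg_prod (fun z : (ι → Option A) × (ι → A) => f z.1)] at h1
  simp only [avg_const] at h1
  exact h1.symm

/-- A dense set that is insensitive to exchanging the letters `none` and `a` contains large
subspaces, provided the density Hales–Jewett theorem holds for the alphabet without `none`. -/
lemma DensityHJ.exists_subspace_getD {A : Type} [Finite A] (hA : DensityHJ A) (a : A) (η : Type)
    [Finite η] {β : ℝ} (hβ : 0 < β) : ∃ N : ℕ, ∀ (ι : Type) [Finite ι], N ≤ Nat.card ι →
      ∀ E : Set (ι → A), β < avg (fun x : ι → Option A => ind ((fun i => (x i).getD a) ∈ E)) →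
        ∃ p : Subspace η (Option A) ι, ∀ x, (fun i => (p x i).getD a) ∈ E := by
  classical
  have : Nonempty A := ⟨a⟩
  obtain ⟨n, hn⟩ := hA.exists_subspace η (β / 2) (half_pos hβ)
  obtain ⟨N, hN⟩ := exists_avg_card_lt_le (A := A) n (half_pos hβ)
  refine ⟨N, fun ι _ hι E hE => ?_⟩
  by_contra! hcon
  refine hE.not_ge ?_
  rw [avg_resample]
  calc _ ≤ avg (fun x : ι → Option A => β / 2 + ind (Nat.card {i // x i ≠ none} < n)) := by
        refine avg_mono fun x => ?_
        by_cases hx : Nat.card {i // x i ≠ none} < n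
        · rw [ind_of hx]
          have : avg (fun u : ι → A =>
              ind ((fun i => ((x i).map fun _ => u i).getD a) ∈ E)) ≤ 1 :=
            avg_le fun _ => ind_le_one _
          linarith
        · rw [ind_of_not hx, add_zero]
          by_contra! hlt
          let T : Set ({i // x i ≠ none} → A) :=
            {v | (fun i => if h : x i ≠ none then v ⟨i, h⟩ else a) ∈ E}
          have hT : avg (fun u : ι → A =>
              ind ((fun i => ((x i).map fun _ => u i).getD a) ∈ E)) =
                avg (fun v => ind (v ∈ T)) := by
            rw [← avg_equiv (Equiv.piEquivPiSubtypeProd (fun i => x i ≠ none) fun _ => A).symm,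
              avg_prod]
            congr 1
            ext v
            rw [← avg_const (X := {i // ¬ x i ≠ none} → A) (ind (v ∈ T))]
            congr 1
            ext w
            congr 1
            change (_ ∈ E) = (_ ∈ E)
            congr 1
            ext i
            by_cases h : x i = none
            · simp [h]
            · obtain ⟨b, hb⟩ := Option.ne_none_iff_exists'.1 h
              simp only [hb, Option.map_some, Option.getD_some]
              simp [h]
          rw [hT] at hlt
          obtain ⟨q, hq⟩ := hn _ (not_lt.1 hx) T hlt.le
          let p : Subspace η (Option A) ι :=
            { idxFun := fun i => if h : x i ≠ none then (q.idxFun ⟨i, h⟩).map some id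
                else Sum.inl none
              proper := fun e => by
                obtain ⟨i, hi⟩ := q.proper e
                exact ⟨i, by simp [i.2, hi]⟩ }
          obtain ⟨y, hy⟩ := hcon p
          apply hy
          have hy' : (fun i => if h : x i ≠ none then q (fun j => (y j).getD a) ⟨i, h⟩ else a) ∈ E :=
            hq fun j => (y j).getD a
          convert hy' using 1
          ext i
          by_cases h : x i = none
          · simp [p, h, Subspace.coe_apply]
          · cases h' : q.idxFun ⟨i, h⟩ <;> simp [p, h, h', Subspace.coe_apply]
    _ ≤ β := by
      rw [avg_add, avg_const]
      linarith [hN ι hι]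

/-! ### Functions with small averages on subspaces -/

/-- The average of `f` on every subspace of dimension at least `d` is at most `η`. -/
def SubspaceAvgLE {B ι : Type*} [Finite B] (f : (ι → B) → ℝ) (d : ℕ) (η : ℝ) : Prop :=
  ∀ e, d ≤ e → ∀ p : Subspace (Fin e) B ι, avg (fun x => f (p x)) ≤ η

namespace SubspaceAvgLE

variable {B ι κ η : Type*} [Finite B] {f : (ι → B) → ℝ} {d : ℕ} {c : ℝ}

lemma comp (h : SubspaceAvgLE f d c) (p : Subspace η B ι) :
    SubspaceAvgLE (fun x => f (p x)) d c := by
  intro e he q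
  simpa using h e he (p.comp q)

lemma mono (h : SubspaceAvgLE f d c) {d' : ℕ} {c' : ℝ} (hd : d ≤ d') (hc : c ≤ c') :
    SubspaceAvgLE f d' c' :=
  fun e he p => (h e (hd.trans he) p).trans hc

end SubspaceAvgLE

lemma getD_sum_elim {A ι κ : Type*} (a : A) (x : ι → Option A) (y : κ → Option A) :
    (fun i => (Sum.elim x y i).getD a) =
      Sum.elim (fun i => (x i).getD a) (fun i => (y i).getD a) := by
  ext (i | i) <;> rfl

/-- One step of the greedy covering of an insensitive set by subspaces. -/
lemma avg_mul_ind_le_step {A ι κ : Type} [Finite A] [Finite ι] [Finite κ] {a : A} {d : ℕ}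
    {β c s : ℝ} (hβ : 0 ≤ β) (hs : 0 ≤ s)
    (hι : ∀ E : Set (ι → A), β < avg (fun x : ι → Option A => ind ((fun i => (x i).getD a) ∈ E)) →
      ∃ p : Subspace (Fin d) (Option A) ι, ∀ x, (fun i => (p x i).getD a) ∈ E)
    (hκ : ∀ f : (κ → Option A) → ℝ, (∀ x, f x ≤ 1) → SubspaceAvgLE f d c → ∀ E : Set (κ → A),
      avg (fun x => f x * ind ((fun i => (x i).getD a) ∈ E)) ≤
        c * avg (fun x : κ → Option A => ind ((fun i => (x i).getD a) ∈ E)) + β +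
          s * (avg (fun x : κ → Option A => ind ((fun i => (x i).getD a) ∈ E)) - β))
    (f : (ι ⊕ κ → Option A) → ℝ) (hf1 : ∀ x, f x ≤ 1) (hf : SubspaceAvgLE f d c)
    (E : Set (ι ⊕ κ → A)) :
    avg (fun x => f x * ind ((fun i => (x i).getD a) ∈ E)) ≤
      c * avg (fun x : ι ⊕ κ → Option A => ind ((fun i => (x i).getD a) ∈ E)) + β +
        (1 - 1 / Nat.card (ι → Option A)) * s *
          (avg (fun x : ι ⊕ κ → Option A => ind ((fun i => (x i).getD a) ∈ E)) - β) := by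
  let good : (κ → A) → Prop := fun w =>
    β < avg (fun z : ι → Option A => ind (Sum.elim (fun i => (z i).getD a) w ∈ E))
  have hgood : ∀ w, good w → ∃ p : Subspace (Fin d) (Option A) ι,
      ∀ x, Sum.elim (fun i => (p x i).getD a) w ∈ E :=
    fun w hw => hι {u | Sum.elim u w ∈ E} hw
  choose p hp using hgood
  let R : (ι → Option A) → (κ → A) → Prop := fun z w => ∃ h : good w, z ∈ Set.range (p w h)
  have hRE : ∀ z w, R z w → Sum.elim (fun i => (z i).getD a) w ∈ E := by
    rintro z w ⟨h, x, rfl⟩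
    exact hp w h x
  -- the averages over one fibre of the part that is covered
  have hcov : ∀ y : κ → Option A,
      avg (fun z => f (Sum.elim z y) * ind (R z fun i => (y i).getD a)) ≤
        c * avg (fun z => ind (R z fun i => (y i).getD a)) := by
    intro y
    by_cases h : good fun i => (y i).getD a
    · have hR : ∀ z, R z (fun i => (y i).getD a) = (z ∈ Set.range (p _ h)) := by
        intro z
        simp [R, h]
      simp only [hR]
      have h1 := avg_mul_ind_mem_range (p _ h).injective fun z => f (Sum.elim z y)
      have h2 := avg_mul_ind_mem_range (p _ h).injective fun _ => (1 : ℝ)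
      simp only [one_mul, avg_const] at h2
      rw [h1, h2]
      refine mul_le_mul_of_nonneg_right ?_ (by positivity)
      simpa using hf d le_rfl ((p _ h).inLeft y)
    · have hR : ∀ z, ind (R z fun i => (y i).getD a) = 0 := by
        intro z
        exact ind_of_not fun ⟨h', _⟩ => h h'
      simp [hR, avg_const]
  have hcard : ∀ y : κ → Option A, 1 / (Nat.card (ι → Option A) : ℝ) *
      ind (good fun i => (y i).getD a) ≤ avg (fun z => ind (R z fun i => (y i).getD a)) := by
    intro y
    by_cases h : good fun i => (y i).getD a
    · have hR : ∀ z, R z (fun i => (y i).getD a) = (z ∈ Set.range (p _ h)) := by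
        intro z
        simp [R, h]
      simp only [hR]
      have h2 := avg_mul_ind_mem_range (p _ h).injective fun _ => (1 : ℝ)
      simp only [one_mul, avg_const] at h2
      rw [h2, ind_of h, mul_one]
      gcongr
      exact_mod_cast Nat.card_pos
    · rw [ind_of_not h, mul_zero]
      exact avg_nonneg fun z => ind_nonneg _
  have hgood' : ∀ y : κ → Option A,
      avg (fun z : ι → Option A =>
        ind (Sum.elim (fun i => (z i).getD a) (fun i => (y i).getD a) ∈ E)) ≤
          β + ind (good fun i => (y i).getD a) := by
    intro y
    by_cases h : good fun i => (y i).getD a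
    · rw [ind_of h]
      have : avg (fun z : ι → Option A =>
          ind (Sum.elim (fun i => (z i).getD a) (fun i => (y i).getD a) ∈ E)) ≤ 1 :=
        avg_le fun _ => ind_le_one _
      linarith
    · rw [ind_of_not h]
      linarith [not_lt.1 h]
  let Q : (ι → Option A) → (κ → A) → Prop := fun z w =>
    Sum.elim (fun i => (z i).getD a) w ∈ E ∧ ¬ R z w
  have hsplit : ∀ z w, ind (Sum.elim (fun i => (z i).getD a) w ∈ E) =
      ind (R z w) + ind (Q z w) := by
    intro z w
    by_cases h : R z w
    · rw [ind_of h, ind_of (hRE z w h), ind_of_not fun h' => h'.2 h, add_zero]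
    · rw [ind_of_not h, zero_add]
      simp [Q, h]
  have hQ : ∀ z : ι → Option A,
      avg (fun y : κ → Option A => f (Sum.elim z y) * ind (Q z fun i => (y i).getD a)) ≤
        c * avg (fun y : κ → Option A => ind (Q z fun i => (y i).getD a)) + β +
          s * (avg (fun y : κ → Option A => ind (Q z fun i => (y i).getD a)) - β) :=
    fun z => hκ (fun y => f (Sum.elim z y)) (fun _ => hf1 _)
      (fun e he p => by simpa using hf e he (p.inRight z)) {w | Q z w}
  have h1 := avg_mono hcov
  have h2 := avg_mono hQ
  have h3 := avg_mono hcard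
  have h4 := avg_mono hgood'
  rw [avg_const_mul] at h1 h3
  rw [avg_add, avg_add, avg_const_mul, avg_const_mul, avg_sub, avg_const] at h2
  rw [avg_add, avg_const] at h4
  rw [avg_comm] at h4
  simp only [hsplit, avg_add] at h4
  simp only [avg_arrow_sum, getD_sum_elim, hsplit, mul_add, avg_add]
  rw [avg_comm] at h1
  rw [avg_comm fun (z : ι → Option A) (y : κ → Option A) => ind (R z fun i => (y i).getD a)] at h4 ⊢
  set U := avg (fun y : κ → Option A => avg fun z => ind (R z fun i => (y i).getD a))
  set V := avg (fun z : ι → Option A => avg fun y : κ → Option A =>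
    ind (Q z fun i => (y i).getD a))
  set P := avg (fun y : κ → Option A => ind (good fun i => (y i).getD a))
  set γ := 1 / (Nat.card (ι → Option A) : ℝ)
  have hγ : 0 ≤ γ := by positivity
  have : s * (V - β) ≤ s * ((1 - γ) * (U + V - β)) := by
    refine mul_le_mul_of_nonneg_left ?_ hs
    nlinarith
  nlinarith

lemma avg_mul_ind_le_iterate {A : Type} [Finite A] {a : A} {d M : ℕ} {β c : ℝ} (hβ : 0 ≤ β)
    (hc : 0 ≤ c)
    (hM : ∀ E : Set (Fin M → A),
      β < avg (fun x : Fin M → Option A => ind ((fun i => (x i).getD a) ∈ E)) →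
        ∃ p : Subspace (Fin d) (Option A) (Fin M), ∀ x, (fun i => (p x i).getD a) ∈ E) (T : ℕ) :
    ∀ (κ : Type) [Finite κ], M * T ≤ Nat.card κ →
      ∀ f : (κ → Option A) → ℝ, (∀ x, f x ≤ 1) → SubspaceAvgLE f d c → ∀ E : Set (κ → A),
        avg (fun x => f x * ind ((fun i => (x i).getD a) ∈ E)) ≤
          c * avg (fun x : κ → Option A => ind ((fun i => (x i).getD a) ∈ E)) + β +
            (1 - 1 / (Nat.card (Fin M → Option A) : ℝ)) ^ T *
              (avg (fun x : κ → Option A => ind ((fun i => (x i).getD a) ∈ E)) - β) := by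
  have hγ : (1 : ℝ) / (Nat.card (Fin M → Option A) : ℝ) ≤ 1 := by
    rw [div_le_one (by exact_mod_cast Nat.card_pos)]
    exact_mod_cast Nat.card_pos
  induction T with
  | zero =>
    intro κ _ _ f hf1 _ E
    have h1 : avg (fun x => f x * ind ((fun i => (x i).getD a) ∈ E)) ≤
        avg (fun x : κ → Option A => ind ((fun i => (x i).getD a) ∈ E)) :=
      avg_mono fun x => mul_le_of_le_one_left (ind_nonneg _) (hf1 x)
    have h2 : 0 ≤ avg (fun x : κ → Option A => ind ((fun i => (x i).getD a) ∈ E)) :=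
      avg_nonneg fun _ => ind_nonneg _
    nlinarith [mul_nonneg hc h2]
  | succ T ih =>
    intro κ _ hκ f hf1 hf E
    rw [Nat.mul_succ, add_comm] at hκ
    obtain ⟨r, hr, ⟨e⟩⟩ := nonempty_equiv_sum hκ
    have := avg_mul_ind_le_step hβ (s := (1 - 1 / (Nat.card (Fin M → Option A) : ℝ)) ^ T)
      (pow_nonneg (by linarith) T) hM (ih (Fin r) (by simpa using hr)) (fun x => f (fun i => x (e i)))
      (fun _ => hf1 _) (hf.comp (Subspace.ofEquiv _ e)) {x | (fun i => x (e i)) ∈ E}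
    rw [avg_arrow_equiv e, avg_arrow_equiv e, pow_succ']
    exact this

lemma exists_subspace_getD_apply {A ι η : Type*} (a : A) (p : Subspace η (Option A) ι) :
    ∃ q : Subspace η A ι, ∀ x, (fun i => (p x i).getD a) = q fun j => (x j).getD a := by
  refine ⟨⟨fun i => (p.idxFun i).map (fun b => b.getD a) id, fun e => ?_⟩, fun x => ?_⟩
  · obtain ⟨i, hi⟩ := p.proper e
    exact ⟨i, by simp [hi]⟩
  · ext i
    rw [Subspace.apply_def, Subspace.apply_def]
    cases h : p.idxFun i <;> simp [h]

/-- Restricting to an insensitive set preserves having small averages on subspaces. -/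
lemma DensityHJ.subspaceAvgLE_mul_ind {A : Type} [Finite A] (hA : DensityHJ A) (a : A) (d : ℕ)
    {β c : ℝ} (hβ : 0 < β) (hc : 0 ≤ c) : ∃ d' : ℕ, ∀ (ι : Type) [Finite ι]
      (f : (ι → Option A) → ℝ), (∀ x, f x ≤ 1) → SubspaceAvgLE f d c → ∀ E : Set (ι → A),
        SubspaceAvgLE (fun x => f x * ind ((fun i => (x i).getD a) ∈ E)) d' (c + 2 * β) := by
  obtain ⟨M, hM⟩ := hA.exists_subspace_getD a (Fin d) hβ
  have h0 : (0 : ℝ) < Nat.card (Fin M → Option A) := by exact_mod_cast Nat.card_pos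
  have hγ : (1 : ℝ) / (Nat.card (Fin M → Option A) : ℝ) ≤ 1 := by
    rw [div_le_one h0]
    exact_mod_cast Nat.card_pos
  obtain ⟨T, hT⟩ := exists_pow_lt_of_lt_one hβ
    (show 1 - 1 / (Nat.card (Fin M → Option A) : ℝ) < 1 by linarith [one_div_pos.2 h0])
  refine ⟨M * T, fun ι _ f hf1 hf E e he p => ?_⟩
  obtain ⟨q, hq⟩ := exists_subspace_getD_apply a p
  have h1 := avg_mul_ind_le_iterate hβ.le hc (hM (Fin M) (by simp)) T (Fin e) (by simpa using he)
    (fun x => f (p x)) (fun _ => hf1 _) (hf.comp p) {x | q x ∈ E}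
  simp only [hq]
  refine h1.trans ?_
  have h2 : 0 ≤ avg (fun x : Fin e → Option A => ind ((fun i => (x i).getD a) ∈ {x | q x ∈ E})) :=
    avg_nonneg fun _ => ind_nonneg _
  have h3 : avg (fun x : Fin e → Option A => ind ((fun i => (x i).getD a) ∈ {x | q x ∈ E})) ≤ 1 :=
    avg_le fun _ => ind_le_one _
  have h4 := pow_nonneg (show 0 ≤ 1 - 1 / (Nat.card (Fin M → Option A) : ℝ) by linarith) T
  nlinarith [mul_le_mul_of_nonneg_left h3 hc, mul_le_mul_of_nonneg_left h3 h4]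

/-- Restricting to a union of insensitive sets preserves having small averages on subspaces. -/
lemma DensityHJ.subspaceAvgLE_mul_ind_exists {A : Type} [Finite A] (hA : DensityHJ A)
    (s : Finset A) : ∀ β : ℝ, 0 < β → ∃ β' : ℝ, 0 < β' ∧ ∀ d : ℕ, ∃ d' : ℕ,
      ∀ (ι : Type) [Finite ι] (f : (ι → Option A) → ℝ), (∀ x, f x ≤ 1) → SubspaceAvgLE f d β' →
        ∀ E : A → Set (ι → A),
          SubspaceAvgLE (fun x => f x * ind (∃ a ∈ s, (fun i => (x i).getD a) ∉ E a)) d' β := by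
  classical
  induction s using Finset.induction_on with
  | empty =>
    intro β hβ
    refine ⟨1, one_pos, fun d => ⟨0, fun ι _ f _ _ E e _ p => ?_⟩⟩
    simpa [ind_of_not not_false, avg_const] using hβ.le
  | insert a s _ ih =>
    intro β hβ
    obtain ⟨β₁, hβ₁, h₁⟩ := ih (β / 2) (by positivity)
    obtain ⟨δ, hδ, hδ₁, hδ₂⟩ : ∃ δ : ℝ, 0 < δ ∧ 3 * δ ≤ β₁ ∧ 3 * δ ≤ β / 2 :=
      ⟨min β₁ (β / 2) / 3, by positivity, by linarith [min_le_left β₁ (β / 2)],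
        by linarith [min_le_right β₁ (β / 2)]⟩
    refine ⟨δ, hδ, fun d => ?_⟩
    obtain ⟨d₁, hd₁⟩ := hA.subspaceAvgLE_mul_ind a d hδ hδ.le
    obtain ⟨d₂, hd₂⟩ := h₁ d₁
    refine ⟨max d₁ d₂, fun ι _ f hf1 hf E e he p => ?_⟩
    have e₁ := hd₁ ι f hf1 hf (E a)ᶜ e ((le_max_left _ _).trans he) p
    have e₂ := hd₂ ι _ (fun x => mul_ind_le zero_le_one (hf1 x) _)
      ((hd₁ ι f hf1 hf (E a)).mono le_rfl (by linarith)) E e ((le_max_right _ _).trans he) p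
    calc _ = avg (fun x => f (p x) * ind ((fun i => (p x i).getD a) ∈ (E a)ᶜ) +
          f (p x) * ind ((fun i => (p x i).getD a) ∈ E a) *
            ind (∃ b ∈ s, (fun i => (p x i).getD b) ∉ E b)) := by
          congr 1
          ext x
          by_cases h : (fun i => (p x i).getD a) ∈ E a
          · simp [ind, h]
          · simp [ind, h]
      _ ≤ β := by
          rw [avg_add]
          linarith

/-! ### Sets without combinatorial lines -/

/-- A set of words that does not contain any combinatorial line. -/
def LineFree {B ι : Type*} (D : Set (ι → B)) : Prop :=
  ∀ l : Line B ι, ∃ b, l b ∉ D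

lemma LineFree.comp {B ι η : Type*} {D : Set (ι → B)} (hD : LineFree D) (p : Subspace η B ι) :
    LineFree {x | p x ∈ D} := by
  intro l
  obtain ⟨b, hb⟩ := hD ⟨fun i => (p.idxFun i).elim some l.idxFun, by
    obtain ⟨j, hj⟩ := l.proper
    obtain ⟨i, hi⟩ := p.proper j
    exact ⟨i, by simp [hi, hj]⟩⟩
  refine ⟨b, fun (h : p (l b) ∈ D) => hb ?_⟩
  convert h using 1
  ext i
  cases h : p.idxFun i <;> simp [Subspace.coe_apply, h, Line.apply_def]

lemma LineFree.sumElim_left {B ι κ : Type*} {D : Set (ι ⊕ κ → B)} (hD : LineFree D) (x : ι → B) :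
    LineFree {y | Sum.elim x y ∈ D} := by
  simpa using hD.comp ((Subspace.ofEquiv B (Equiv.refl κ)).inRight x)

lemma LineFree.sumElim_right {B ι κ : Type*} {D : Set (ι ⊕ κ → B)} (hD : LineFree D) (y : κ → B) :
    LineFree {x | Sum.elim x y ∈ D} := by
  simpa using hD.comp ((Subspace.ofEquiv B (Equiv.refl ι)).inLeft y)

lemma LineFree.notMem_of_forall_getD_mem {A ι κ : Type*} {D : Set (ι ⊕ κ → Option A)}
    (hD : LineFree D) {x : ι → Option A} (hx : ∃ i, x i = none) {y : κ → Option A}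
    (h : ∀ a, Sum.elim (fun i => some ((x i).getD a)) y ∈ D) : Sum.elim x y ∉ D := by
  obtain ⟨i, hi⟩ := hx
  obtain ⟨b, hb⟩ := hD ⟨Sum.elim (fun i => (x i).map some) fun k => some (y k),
    Sum.inl i, by simp [hi]⟩
  intro hxy
  cases b with
  | none =>
    refine hb ?_
    convert hxy using 1
    ext (i | k) : 1
    · cases hi : x i <;> simp [hi]
    · simp
  | some a =>
    refine hb ?_
    convert h a using 1
    ext (i | k) : 1
    · cases hi : x i <;> simp [hi]
    · simp

lemma le_of_le_avg {X : Type*} [Finite X] [Nonempty X] {f : X → ℝ} {b c : ℝ} (hf : ∀ x, f x ≤ b)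
    (hc : c ≤ avg f) (x : X) : b - Nat.card X * (b - c) ≤ f x := by
  have := Fintype.ofFinite X
  have h1 : avg (fun x => b - f x) ≤ b - c := by
    rw [avg_sub, avg_const]
    linarith
  rw [avg_eq_sum, div_le_iff₀ (by exact_mod_cast Nat.card_pos)] at h1
  have h2 : b - f x ≤ ∑ x, (b - f x) :=
    Finset.single_le_sum (f := fun x => b - f x) (fun x _ => by linarith [hf x])
      (Finset.mem_univ x)
  linarith

/-- The counting at the heart of the density increment: if `C` takes up a proportion `θ` and is
disjoint from `D` on most fibres, then `D` is denser on the complement of `C`. -/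
lemma mul_le_of_avg_mul_ind_le {X Y : Type*} [Finite X] [Finite Y] [Nonempty X] [Nonempty Y]
    (D C : X → Y → Prop) (V : X → Prop) {L η κ ζ β θ : ℝ} (hζ : 0 ≤ ζ) (hL : 0 ≤ L) (hθ : 0 ≤ θ)
    (hdisj : ∀ x y, V x → C x y → ¬ D x y)
    (hD : ∀ x, L - η ≤ avg (fun y => ind (D x y)))
    (hC : ∀ x, θ ≤ avg (fun y => ind (C x y)))
    (hV : avg (fun x => ind (¬ V x)) ≤ κ)
    (hβ : ∀ y, avg (fun x => (ind (D x y) - (L + ζ)) * ind (¬ C x y)) ≤ β) :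
    L * θ ≤ η + κ + ζ + β := by
  have h1 := avg_mono hβ
  rw [avg_const, avg_comm] at h1
  have h2 : ∀ x, avg (fun y => ind (D x y)) - ind (¬ V x) - (L + ζ) +
      (L + ζ) * avg (fun y => ind (C x y)) ≤
        avg (fun y => (ind (D x y) - (L + ζ)) * ind (¬ C x y)) := by
    intro x
    rw [← avg_const_mul (L + ζ), ← avg_const (X := Y) (L + ζ), ← avg_const (X := Y) (ind (¬ V x)),
      ← avg_sub, ← avg_sub, ← avg_add]
    simp only [avg_const]
    refine avg_mono fun y => ?_
    have hd := hdisj x y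
    by_cases hv : V x <;> by_cases hc : C x y <;> by_cases hd' : D x y <;>
      simp_all [ind] <;> linarith
  have h3 := avg_mono h2
  rw [avg_add, avg_sub, avg_sub, avg_const_mul, avg_const] at h3
  have h4 := avg_mono hD
  have h5 := avg_mono hC
  rw [avg_const] at h4 h5
  nlinarith [mul_le_mul_of_nonneg_left h5 (add_nonneg hL hζ), mul_nonneg hζ hθ]

/-- A dense set on which all sections are dense contains many copies of some variable word. -/
lemma DensityHJ.exists_none_avg_forall_getD {A : Type} [Finite A] [Nonempty A] {n m : ℕ}
    (hnm : n ≤ m) {L : ℝ} (hL : 0 < L)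
    (hn : ∀ S : Set (Fin n → A), L / 2 ≤ avg (fun x => ind (x ∈ S)) →
      ∃ l : Line A (Fin n), ∀ a, l a ∈ S)
    {Y : Type*} [Finite Y] [Nonempty Y] (R : (Fin m → A) → Y → Prop)
    (hR : ∀ x, L ≤ avg (fun y => ind (R x y))) :
    ∃ x : Fin m → Option A, (∃ j, x j = none) ∧
      L / 2 / (Nat.card (Line A (Fin n)) + 1) ≤
        avg (fun y => ind (∀ a, R (fun j => (x j).getD a) y)) := by
  have := Fintype.ofFinite (Line A (Fin n))
  let a₀ : A := Classical.arbitrary A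
  let g : (Fin n → A) → Fin m → A := fun u j => if h : j < n then u ⟨j, h⟩ else a₀
  obtain ⟨l, hl⟩ := exists_config_of_avg (fun u y => R (g u) y)
    (fun (l : Line A (Fin n)) x => ∃ a, l a = x) hL
    (by
      rw [avg_comm]
      exact le_avg fun x => hR _)
    (fun S hS => by
      obtain ⟨l, hl⟩ := hn S hS
      exact ⟨l, by rintro _ ⟨a, rfl⟩; exact hl a⟩)
  refine ⟨fun j => if h : j < n then l.idxFun ⟨j, h⟩ else some a₀, ?_, hl.trans ?_⟩
  · obtain ⟨i, hi⟩ := l.proper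
    exact ⟨⟨i, i.2.trans_le hnm⟩, by simp [hi]⟩
  · refine avg_mono fun y => ind_mono fun h a => ?_
    convert h _ ⟨a, rfl⟩ using 1
    ext j
    by_cases hj : (j : ℕ) < n <;> simp [g, hj, Line.apply_def]

/-- The density increment step. -/
lemma DensityHJ.exists_lineFree_avg_le_sub {A : Type} [Finite A] [Nonempty A] (hA : DensityHJ A)
    {L : ℝ} (hL : 0 < L)
    (hU : ∀ ζ : ℝ, 0 < ζ → ∃ N : ℕ, ∀ (ι : Type) [Finite ι], N ≤ Nat.card ι →
      ∀ D : Set (ι → Option A), LineFree D → avg (fun x => ind (x ∈ D)) ≤ L + ζ) :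
    ∃ ζ : ℝ, 0 < ζ ∧ ∃ N : ℕ, ∀ (ι : Type) [Finite ι], N ≤ Nat.card ι →
      ∀ D : Set (ι → Option A), LineFree D → avg (fun x => ind (x ∈ D)) ≤ L - ζ := by
  classical
  have := Fintype.ofFinite A
  obtain ⟨n, hn⟩ := hA (L / 2 / 2) (by positivity)
  set θ := L / 2 / 2 / (Nat.card (Line A (Fin n)) + 1) with hθdef
  have hθ : 0 < θ := by positivity
  have hθL : θ ≤ L / 2 := by
    have : θ ≤ L / 2 / 2 := div_le_self (by positivity) (by simp)
    linarith
  have hLθ : 0 < L * θ / 5 := by positivity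
  obtain ⟨β', hβ', hB⟩ := hA.subspaceAvgLE_mul_ind_exists Finset.univ (L * θ / 5) hLθ
  obtain ⟨d, hd⟩ := hU (L * θ / 5) hLθ
  obtain ⟨d', hd'⟩ := hB d
  obtain ⟨k, hk⟩ := exists_avg_forall_ne_none_le (A := A) hLθ
  let m := max n (max d' k)
  obtain ⟨ι₀, _, hGR⟩ := exists_subspace_mono_of_exists_none A Prop m
  set M := (Nat.card (ι₀ → Option A) : ℝ)
  have hM : 0 < M := Nat.cast_pos.2 Nat.card_pos
  set η := min (L * θ / 5) (L / 2)
  have hη : 0 < η := by positivity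
  obtain ⟨N, hN⟩ := hU (η / (2 * M)) (by positivity)
  refine ⟨η / (2 * M), by positivity, Nat.card ι₀ + N, fun ι _ hι D₀ hD₀ => ?_⟩
  by_contra! hdens
  obtain ⟨r, hr, ⟨e₀⟩⟩ := nonempty_equiv_sum hι
  let e : ι ≃ ι₀ ⊕ Fin r := e₀.trans (Equiv.sumCongr (Finite.equivFin ι₀).symm (Equiv.refl _))
  let D : Set (ι₀ ⊕ Fin r → Option A) := {x | (fun i => x (e i)) ∈ D₀}
  have hD : LineFree D := hD₀.comp (Subspace.ofEquiv _ e)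
  rw [avg_arrow_equiv e, avg_arrow_sum] at hdens
  have hdense : ∀ x, L - η ≤ avg (fun y => ind (Sum.elim x y ∈ D)) := by
    intro x
    refine le_trans ?_ (le_of_le_avg (fun x => hN (Fin r) (by simpa using hr) _
      (hD.sumElim_left x)) hdens.le x)
    have h1 : M * (L + η / (2 * M) - (L - η / (2 * M))) = η := by
      field_simp
      ring
    have h2 : 0 < η / (2 * M) := by positivity
    change L - η ≤ _ - M * _
    linarith
  have hη₁ : η ≤ L * θ / 5 := min_le_left _ _
  have hη₂ : η ≤ L / 2 := min_le_right _ _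
  let C : (ι₀ → Option A) → (Fin r → Option A) → Prop :=
    fun x y => ∀ a, Sum.elim (fun i => some ((x i).getD a)) y ∈ D
  obtain ⟨p, t, ht⟩ := hGR fun x => θ ≤ avg (fun y => ind (C x y))
  have hC : ∀ x, θ ≤ avg (fun y => ind (C (p.toOption x) y)) := by
    intro x
    by_cases hx : ∃ j, x j = none
    · obtain ⟨x', hx', h⟩ := DensityHJ.exists_none_avg_forall_getD (le_max_left n (max d' k))
        (half_pos hL) (hn (Fin n) (by simp))
        (fun (x : Fin m → A) y => Sum.elim (fun i => some (p x i)) y ∈ D)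
        fun x => (by linarith : L / 2 ≤ L - η).trans (hdense _)
      have h' : θ ≤ avg (fun y => ind (C (p.toOption x') y)) := by
        refine h.trans (avg_mono fun y => ind_mono fun h a => ?_)
        have := h a
        rw [← Subspace.toOption_getD] at this
        exact this
      rw [ht x hx, ← ht x' hx']
      exact h'
    · push Not at hx
      choose x' hx' using fun j => Option.ne_none_iff_exists'.1 (hx j)
      obtain rfl : x = fun j => some (x' j) := funext hx'
      rw [Subspace.toOption_some]
      refine (by linarith : θ ≤ L - η).trans ((hdense fun i => some (p x' i)).trans
        (avg_mono fun y => ind_mono fun h a => h))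
  have key := mul_le_of_avg_mul_ind_le (X := Fin m → Option A) (Y := Fin r → Option A)
    (fun x y => Sum.elim (p.toOption x) y ∈ D) (fun x y => C (p.toOption x) y)
    (fun x => ∃ j, x j = none) (L := L) (η := η) (κ := L * θ / 5) (ζ := L * θ / 5)
    (β := L * θ / 5) (θ := θ) hLθ.le hL.le hθ.le
    (fun x y hx h => hD.notMem_of_forall_getD_mem (p.exists_toOption_eq_none hx) h)
    (fun x => hdense _) hC
    (by
      push Not
      exact hk (Fin m) (by simp [m]))
    fun y => by
      have h1 := hd' (Fin m) (fun x => ind (Sum.elim (p.toOption x) y ∈ D) - (L + L * θ / 5))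
        (fun x => by linarith [ind_le_one (Sum.elim (p.toOption x) y ∈ D)])
        (fun e he q => by
          rw [avg_sub, avg_const]
          have := hd (Fin e) (by simpa using he) _ (((hD.sumElim_right y).comp p.toOption).comp q)
          simp only [Set.mem_ofPred_eq] at this
          linarith)
        (fun _ => {w | Sum.elim (fun i => some (p w i)) y ∈ D}) m (by simp [m])
        (Subspace.ofEquiv _ (Equiv.refl _))
      refine le_trans (le_of_eq ?_) h1
      congr 1
      ext x
      congr 2
      simp only [C, not_forall, Finset.mem_univ, true_and, Set.mem_ofPred_eq]
      simp [← Subspace.toOption_getD]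
  nlinarith

/-! ### The density Hales–Jewett theorem -/

lemma DensityHJ.of_equiv {A B : Type} [Finite A] [Finite B] (e : A ≃ B) (hA : DensityHJ A) :
    DensityHJ B := by
  intro ε hε
  obtain ⟨N, hN⟩ := hA ε hε
  refine ⟨N, fun ι _ hι S hS => ?_⟩
  rw [← avg_equiv ((Equiv.refl ι).arrowCongr e)] at hS
  obtain ⟨l, hl⟩ := hN ι hι {x | e ∘ x ∈ S} hS
  refine ⟨l.map e, fun b => ?_⟩
  rw [← e.apply_symm_apply b, Line.map_apply]
  exact hl _

lemma DensityHJ.of_unique (A : Type) [Unique A] : DensityHJ A := by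
  intro ε hε
  refine ⟨1, fun ι _ hι S hS => ?_⟩
  have hne : S.Nonempty := by
    by_contra hn
    rw [Set.not_nonempty_iff_eq_empty] at hn
    simp only [hn, Set.mem_empty_iff_false, ind_of_not not_false, avg_const] at hS
    linarith
  obtain ⟨x, hx⟩ := hne
  have : Nonempty ι := Finite.card_pos_iff.1 hι
  refine ⟨⟨fun _ => none, Classical.arbitrary ι, rfl⟩, fun a => ?_⟩
  convert hx
  exact Subsingleton.elim _ x

lemma DensityHJ.option {A : Type} [Finite A] [Nonempty A] (hA : DensityHJ A) :
    DensityHJ (Option A) := by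
  let P : Set ℝ := {r | 0 ≤ r ∧ ∃ N : ℕ, ∀ (ι : Type) [Finite ι], N ≤ Nat.card ι →
    ∀ D : Set (ι → Option A), LineFree D → avg (fun x => ind (x ∈ D)) ≤ r}
  have hbdd : BddBelow P := ⟨0, fun r hr => hr.1⟩
  have hne : P.Nonempty :=
    ⟨1, zero_le_one, 0, fun ι _ _ D _ => avg_le fun _ => ind_le_one _⟩
  have h0 : sInf P ≤ 0 := by
    by_contra! hL
    obtain ⟨ζ, hζ, N, hN⟩ := hA.exists_lineFree_avg_le_sub hL fun ζ hζ => by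
      obtain ⟨r, ⟨_, N, hN⟩, hr⟩ := exists_lt_of_csInf_lt hne (lt_add_of_pos_right (sInf P) hζ)
      exact ⟨N, fun ι _ hι D hD => (hN ι hι D hD).trans hr.le⟩
    have h1 : max 0 (sInf P - ζ) ∈ P :=
      ⟨le_max_left _ _, N, fun ι _ hι D hD => (hN ι hι D hD).trans (le_max_right _ _)⟩
    have h2 := csInf_le hbdd h1
    rcases le_max_iff.1 h2 with h | h <;> linarith
  intro ε hε
  obtain ⟨r, ⟨_, N, hN⟩, hr⟩ := exists_lt_of_csInf_lt hne (h0.trans_lt hε)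
  refine ⟨N, fun ι _ hι S hS => ?_⟩
  by_contra! hcon
  linarith [hN ι hι S hcon]

/-- The **density Hales–Jewett theorem** for the alphabet with `m + 1` letters. -/
lemma densityHJ_option_fin (m : ℕ) : DensityHJ (Option (Fin m)) := by
  induction m with
  | zero =>
    have : Unique (Option (Fin 0)) := Unique.mk' _
    exact DensityHJ.of_unique _
  | succ m ih => exact ih.option.of_equiv (finSuccEquiv m).symm.optionCongr

/-! ### Corners in finite abelian groups -/

lemma avg_addMonoidHom {G H : Type*} [AddGroup G] [AddGroup H] [Finite G] [Finite H] (φ : H →+ G)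
    (hφ : Function.Surjective φ) (F : G → ℝ) : avg (fun h => F (φ h)) = avg F := by
  choose s hs using hφ
  calc _ = avg (fun g => avg (fun h => F (φ h + g))) := by
        rw [← avg_const (X := G) (avg fun h => F (φ h))]
        congr 1
        ext g
        rw [← avg_equiv (Equiv.addRight (s g))]
        simp [hs]
    _ = _ := by
        rw [avg_comm, ← avg_const (X := H) (avg F)]
        congr 1
        ext h
        exact avg_equiv (Equiv.addLeft (φ h)) F

section words

variable {G : Type*} [AddCommGroup G] {m n : ℕ}

/-- The sum of the entries of the second component at the coordinates satisfying `P`. -/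
def sumHom (P : Fin n → Prop) [DecidablePred P] : (Fin m → G) × (Fin n → G) →+ G :=
  AddMonoidHom.mk' (fun y => ∑ j, if P j then y.2 j else 0) fun y z => by
    rw [← Finset.sum_add_distrib]
    refine Finset.sum_congr rfl fun j _ => ?_
    split_ifs <;> simp

lemma sumHom_apply (P : Fin n → Prop) [DecidablePred P] (y : (Fin m → G) × (Fin n → G)) :
    sumHom P y = ∑ j, if P j then y.2 j else 0 := rfl

/-- The point `x + ∑ j, a j • e (w j)` of `G ^ m` attached to a word `w`. -/
def wordHom (w : Fin n → Option (Fin m)) : (Fin m → G) × (Fin n → G) →+ (Fin m → G) :=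
  AddMonoidHom.mk' (fun y i => y.1 i + sumHom (fun j => w j = some i) y) fun y z => by
    ext i
    simp only [map_add, Prod.fst_add, Pi.add_apply]
    abel

lemma wordHom_apply (w : Fin n → Option (Fin m)) (y : (Fin m → G) × (Fin n → G)) (i : Fin m) :
    wordHom w y i = y.1 i + sumHom (fun j => w j = some i) y := rfl

lemma wordHom_surjective (w : Fin n → Option (Fin m)) :
    Function.Surjective (wordHom (G := G) w) := by
  intro x
  refine ⟨(x, 0), ?_⟩
  ext i
  simp [wordHom_apply, sumHom_apply]

lemma wordHom_line_some (l : Line (Option (Fin m)) (Fin n)) (i : Fin m)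
    (y : (Fin m → G) × (Fin n → G)) :
    wordHom (l (some i)) y = Function.update (wordHom (l none) y) i
      (wordHom (l none) y i + sumHom (fun j => l.idxFun j = none) y) := by
  ext k
  have h : sumHom (fun j => l (some i) j = some k) y = sumHom (fun j => l none j = some k) y +
      if i = k then sumHom (fun j => l.idxFun j = none) y else 0 := by
    by_cases hik : i = k
    · rw [if_pos hik, sumHom_apply, sumHom_apply, sumHom_apply, ← Finset.sum_add_distrib]
      refine Finset.sum_congr rfl fun j _ => ?_
      cases hj : l.idxFun j <;> simp [hj, hik]
    · rw [if_neg hik, add_zero, sumHom_apply, sumHom_apply]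
      refine Finset.sum_congr rfl fun j _ => ?_
      cases hj : l.idxFun j <;> simp [hj, hik]
  rw [wordHom_apply, h, ← add_assoc, ← wordHom_apply]
  by_cases hik : i = k
  · subst hik
    simp
  · rw [if_neg hik, add_zero, Function.update_of_ne (Ne.symm hik)]

lemma wordHom_prod_sumHom_surjective (l : Line (Option (Fin m)) (Fin n)) :
    Function.Surjective
      ((wordHom (G := G) (l none)).prod (sumHom (m := m) fun j => l.idxFun j = none)) := by
  rintro ⟨x, g⟩
  obtain ⟨j₀, hj₀⟩ := l.proper
  have h : ∀ (P : Fin n → Prop) [DecidablePred P],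
      sumHom P (x, Pi.single j₀ g) = if P j₀ then g else 0 := by
    intro P _
    rw [sumHom_apply, Finset.sum_eq_single j₀]
    · simp
    · intro j _ hj
      simp [Pi.single_eq_of_ne hj]
    · simp
  refine ⟨(x, Pi.single j₀ g), Prod.ext (funext fun i => ?_) ?_⟩
  · simp [wordHom_apply, h, Line.apply_def, hj₀]
  · simp [h, hj₀]

end words

theorem multidimensional_szemeredi_for_finite_abelian_groups
    (ε : ℝ) (hε : 0 < ε) (m : ℕ) (hm : 0 < m) :
    ∃ δ : ℝ, 0 < δ ∧
      ∀ (G : Type) [AddCommGroup G] [Fintype G] (S : Set (Fin m → G)),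
        (Nat.card ↥S : ℝ) ≥ ε * Nat.card (Fin m → G) →
          (Nat.card ↥{p : (Fin m → G) × G | p.1 ∈ S ∧
              ∀ j : Fin m, Function.update p.1 j (p.1 j + p.2) ∈ S} : ℝ) ≥
            δ * (Nat.card G : ℝ) ^ (m + 1) := by
  obtain ⟨n, hn⟩ := densityHJ_option_fin m (ε / 2) (by positivity)
  have := Fintype.ofFinite (Line (Option (Fin m)) (Fin n))
  refine ⟨ε / 2 / (Nat.card (Line (Option (Fin m)) (Fin n)) + 1), by positivity,
    fun G _ _ S hS => ?_⟩
  have hS' : ε ≤ avg (fun x => ind (x ∈ S)) := by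
    rw [avg_ind, le_div_iff₀ (by exact_mod_cast Nat.card_pos)]
    exact hS
  obtain ⟨l, hl⟩ := exists_config_of_avg
    (fun (w : Fin n → Option (Fin m)) (y : (Fin m → G) × (Fin n → G)) => wordHom w y ∈ S)
    (fun (l : Line (Option (Fin m)) (Fin n)) w => ∃ b, l b = w) hε
    (by
      rw [avg_comm]
      exact le_avg fun w => hS'.trans_eq
        (avg_addMonoidHom (wordHom w) (wordHom_surjective w) fun x => ind (x ∈ S)).symm)
    (fun T hT => by
      obtain ⟨l, hl⟩ := hn (Fin n) (by simp) T hT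
      exact ⟨l, by rintro _ ⟨b, rfl⟩; exact hl b⟩)
  let φ := (wordHom (G := G) (l none)).prod (sumHom (m := m) fun j => l.idxFun j = none)
  let T : Set ((Fin m → G) × G) := {p | p.1 ∈ S ∧
    ∀ j : Fin m, Function.update p.1 j (p.1 j + p.2) ∈ S}
  have hT : ε / 2 / (Nat.card (Line (Option (Fin m)) (Fin n)) + 1) ≤
      avg (fun y => ind (φ y ∈ T)) := by
    refine hl.trans (avg_mono fun y => ind_mono fun h => ⟨h _ ⟨none, rfl⟩, fun i => ?_⟩)
    have := h _ ⟨some i, rfl⟩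
    rw [wordHom_line_some] at this
    exact this
  rw [avg_addMonoidHom φ (wordHom_prod_sumHom_surjective l) fun p => ind (p ∈ T), avg_ind,
    le_div_iff₀ (Nat.cast_pos.2 Nat.card_pos)] at hT
  have hcard : Nat.card ((Fin m → G) × G) = Nat.card G ^ (m + 1) := by
    rw [Nat.card_prod, Nat.card_fun, Nat.card_fin, pow_succ]
  rw [hcard, Nat.cast_pow] at hT
  exact hT
end
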